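/- Suppose MN > 0 and M ≠ N. For (P̲, f, c; Q₁), (P̲, f, c; Q₂) ∈ R̃_{M,N} with the same (P̲, f, c), the canonical epimorphism M(P̲, f, c) ↠ W(P̲, f, c; Q₁) factorizes through the canonical epimorphism M(P̲, f, c) ↠ W(P̲, f, c; Q₂) (equivalently, there is a U-module epimorphism W(P̲, f, c; Q₂) ↠ W(P̲, f, c; Q₁) sending highest weight vector to highest weight vector) if and only if Q₁(z) divides Q₂(z) in ℂ[z]. -/

import Mathlib

noncomputable section

namespace QAS

open Polynomial
open scoped TensorProduct

/-! ### Basic combinatorial data -/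

/-- `l_i = 1` for `i ≤ M`, `-1` otherwise. -/
def lof (M : ℕ) (i : ℕ) : ℤ := if i ≤ M then 1 else -1

/-- the bilinear form `(ε_i, ε_j) = l_i δ_{ij}`. -/
def innerE (M : ℕ) (i j : ℕ) : ℤ := if i = j then lof M i else 0

/-- `(ε_a − ε_b, ε_c − ε_d)`. -/
def form4 (M : ℕ) (a b c d : ℕ) : ℤ :=
  innerE M a c - innerE M a d - innerE M b c + innerE M b d

/-- the Cartan pairing `c_{ij} = (ε_i − ε_{i+1}, ε_j − ε_{j+1})`. -/
def cc (M : ℕ) (i j : ℕ) : ℤ := form4 M i (i + 1) j (j + 1)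

/-- `q_i = q^{l_i}`. -/
def qpar (q : ℂ) (M : ℕ) (i : ℕ) : ℂ := q ^ lof M i

/-- the quantum integer `[m]_v`. -/
def qint (v : ℂ) (m : ℤ) : ℂ := (v ^ m - v ^ (-m)) / (v - v⁻¹)

/-- the sign `(−1)^{|X_i||X_j|}` for the generators `X_i`, `X_j`. -/
def sgn (M : ℕ) (i j : ℕ) : ℂ := if i = M ∧ j = M then -1 else 1

/-- index set `1 ≤ i ≤ M+N−1`. -/
abbrev Idx (M N : ℕ) := {i : ℕ // 1 ≤ i ∧ i ≤ M + N - 1}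

/-! ### Generators and the free superalgebra -/

/-- Drinfel'd generators; when `ext = true` we also have `K₀^{±1}`. -/
inductive Gen (M N : ℕ) (ext : Bool) : Type
  | Xp : Idx M N → ℤ → Gen M N ext
  | Xm : Idx M N → ℤ → Gen M N ext
  | K : Idx M N → Gen M N ext
  | Ki : Idx M N → Gen M N ext
  | H : Idx M N → {s : ℤ // s ≠ 0} → Gen M N ext
  | K0 : ext = true → Gen M N ext
  | K0i : ext = true → Gen M N ext

abbrev FA (M N : ℕ) (ext : Bool) := FreeAlgebra ℂ (Gen M N ext)

def gi {M N : ℕ} {ext : Bool} (g : Gen M N ext) : FA M N ext := FreeAlgebra.ι ℂ g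

def XpF (M N : ℕ) (ext : Bool) (i : ℕ) (n : ℤ) : FA M N ext :=
  if h : 1 ≤ i ∧ i ≤ M + N - 1 then gi (Gen.Xp ⟨i, h⟩ n) else 0

def XmF (M N : ℕ) (ext : Bool) (i : ℕ) (n : ℤ) : FA M N ext :=
  if h : 1 ≤ i ∧ i ≤ M + N - 1 then gi (Gen.Xm ⟨i, h⟩ n) else 0

def KF (M N : ℕ) (ext : Bool) (i : ℕ) : FA M N ext :=
  if h : 1 ≤ i ∧ i ≤ M + N - 1 then gi (Gen.K ⟨i, h⟩) else 0

def KiF (M N : ℕ) (ext : Bool) (i : ℕ) : FA M N ext :=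
  if h : 1 ≤ i ∧ i ≤ M + N - 1 then gi (Gen.Ki ⟨i, h⟩) else 0

def HF (M N : ℕ) (ext : Bool) (i : ℕ) (s : ℤ) : FA M N ext :=
  if h : (1 ≤ i ∧ i ≤ M + N - 1) ∧ s ≠ 0 then gi (Gen.H ⟨i, h.1⟩ ⟨s, h.2⟩) else 0

def K0F (M N : ℕ) (ext : Bool) : FA M N ext :=
  if h : ext = true then gi (Gen.K0 h) else 0

def K0iF (M N : ℕ) (ext : Bool) : FA M N ext :=
  if h : ext = true then gi (Gen.K0i h) else 0

/-- coefficients of `exp (t · Σ_{s ≥ 1} a_s z^s)`. -/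
def expC {A : Type} [Ring A] [Algebra ℂ A] (t : ℂ) (a : ℕ → A) : ℕ → A
  | 0 => 1
  | n + 1 =>
      ((n : ℂ) + 1)⁻¹ •
        (t • ∑ s ∈ Finset.range (n + 1), ((s : ℂ) + 1) • (a (s + 1) * expC t a (n - s)))
termination_by n => n
decreasing_by omega

/-- `φ⁺_{i,n}`, the coefficient of `z^n` in
`K_i exp((q_i − q_i⁻¹) Σ_{s>0} h_{i,s} z^s)`. -/
def phiPF (q : ℂ) (M N : ℕ) (ext : Bool) (i : ℕ) (n : ℤ) : FA M N ext :=
  if 0 ≤ n then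
    KF M N ext i *
      expC (qpar q M i - (qpar q M i)⁻¹) (fun s => HF M N ext i (s : ℤ)) n.toNat
  else 0

/-- `φ⁻_{i,n}`, the coefficient of `z^n` (`n ≤ 0`) in
`K_i⁻¹ exp(−(q_i − q_i⁻¹) Σ_{s>0} h_{i,−s} z^{−s})`. -/
def phiMF (q : ℂ) (M N : ℕ) (ext : Bool) (i : ℕ) (n : ℤ) : FA M N ext :=
  if n ≤ 0 then
    KiF M N ext i *
      expC (-(qpar q M i - (qpar q M i)⁻¹)) (fun s => HF M N ext i (-(s : ℤ))) (-n).toNat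
  else 0

/-- the `u`-bracket `[x,y]_u = xy − u·yx` (for `x` or `y` of even parity). -/
def brF {A : Type} [Ring A] [Module ℂ A] (u : ℂ) (x y : A) : A := x * y - u • (y * x)

/-- the quartic oscillation expression
`[[[X_{M−1,m}, X_{M,n}]_{q⁻¹}, X_{M+1,k}]_q, X_{M,u}]` (a graded anticommutator in the
outermost bracket, both entries being odd). -/
def oscOf {A : Type} [Ring A] [Module ℂ A] (q : ℂ) (M : ℕ) (X : ℕ → ℤ → A) (m n k u : ℤ) : A :=
  brF q (brF q⁻¹ (X (M - 1) m) (X M n)) (X (M + 1) k) * X M u +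
    X M u * brF q (brF q⁻¹ (X (M - 1) m) (X M n)) (X (M + 1) k)

/-! ### The defining relations.
`lvl = 1`: only (R1)–(R3);  `lvl = 2`: (R1)–(R5);  `lvl = 3`: all of (R1)–(R7).
`ext = true` adds `K₀^{±1}` together with its relations. -/

inductive rel (q : ℂ) (M N : ℕ) (ext : Bool) (lvl : ℕ) : FA M N ext → FA M N ext → Prop
  | KKi (i : Idx M N) : rel q M N ext lvl (gi (Gen.K i) * gi (Gen.Ki i)) 1
  | KiK (i : Idx M N) : rel q M N ext lvl (gi (Gen.Ki i) * gi (Gen.K i)) 1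
  | KK (i j : Idx M N) :
      rel q M N ext lvl (gi (Gen.K i) * gi (Gen.K j)) (gi (Gen.K j) * gi (Gen.K i))
  | KKi2 (i j : Idx M N) :
      rel q M N ext lvl (gi (Gen.K i) * gi (Gen.Ki j)) (gi (Gen.Ki j) * gi (Gen.K i))
  | KiKi (i j : Idx M N) :
      rel q M N ext lvl (gi (Gen.Ki i) * gi (Gen.Ki j)) (gi (Gen.Ki j) * gi (Gen.Ki i))
  | KH (i j : Idx M N) (s : {s : ℤ // s ≠ 0}) :
      rel q M N ext lvl (gi (Gen.K i) * gi (Gen.H j s)) (gi (Gen.H j s) * gi (Gen.K i))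
  | KiH (i j : Idx M N) (s : {s : ℤ // s ≠ 0}) :
      rel q M N ext lvl (gi (Gen.Ki i) * gi (Gen.H j s)) (gi (Gen.H j s) * gi (Gen.Ki i))
  | HH (i j : Idx M N) (s t : {s : ℤ // s ≠ 0}) :
      rel q M N ext lvl (gi (Gen.H i s) * gi (Gen.H j t)) (gi (Gen.H j t) * gi (Gen.H i s))
  | KXp (i j : Idx M N) (n : ℤ) :
      rel q M N ext lvl (gi (Gen.K i) * gi (Gen.Xp j n))
        ((q ^ cc M i.1 j.1) • (gi (Gen.Xp j n) * gi (Gen.K i)))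
  | KXm (i j : Idx M N) (n : ℤ) :
      rel q M N ext lvl (gi (Gen.K i) * gi (Gen.Xm j n))
        ((q ^ (-cc M i.1 j.1)) • (gi (Gen.Xm j n) * gi (Gen.K i)))
  | HXp (i j : Idx M N) (s : {s : ℤ // s ≠ 0}) (n : ℤ) :
      rel q M N ext lvl
        (gi (Gen.H i s) * gi (Gen.Xp j n) - gi (Gen.Xp j n) * gi (Gen.H i s))
        ((qint (qpar q M i.1) (s.1 * lof M i.1 * cc M i.1 j.1) / (s.1 : ℂ)) •
          gi (Gen.Xp j (n + s.1)))
  | HXm (i j : Idx M N) (s : {s : ℤ // s ≠ 0}) (n : ℤ) :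
      rel q M N ext lvl
        (gi (Gen.H i s) * gi (Gen.Xm j n) - gi (Gen.Xm j n) * gi (Gen.H i s))
        (-((qint (qpar q M i.1) (s.1 * lof M i.1 * cc M i.1 j.1) / (s.1 : ℂ)) •
          gi (Gen.Xm j (n + s.1))))
  | XpXm (i j : Idx M N) (m n : ℤ) :
      rel q M N ext lvl
        (gi (Gen.Xp i m) * gi (Gen.Xm j n) -
          sgn M i.1 j.1 • (gi (Gen.Xm j n) * gi (Gen.Xp i m)))
        (if i = j then
            (qpar q M i.1 - (qpar q M i.1)⁻¹)⁻¹ •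
              (phiPF q M N ext i.1 (m + n) - phiMF q M N ext i.1 (m + n))
          else 0)
  | XX0p (i j : Idx M N) (m n : ℤ) (h2 : 2 ≤ lvl) (h : cc M i.1 j.1 = 0) :
      rel q M N ext lvl
        (gi (Gen.Xp i m) * gi (Gen.Xp j n) -
          sgn M i.1 j.1 • (gi (Gen.Xp j n) * gi (Gen.Xp i m))) 0
  | XX0m (i j : Idx M N) (m n : ℤ) (h2 : 2 ≤ lvl) (h : cc M i.1 j.1 = 0) :
      rel q M N ext lvl
        (gi (Gen.Xm i m) * gi (Gen.Xm j n) -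
          sgn M i.1 j.1 • (gi (Gen.Xm j n) * gi (Gen.Xm i m))) 0
  | XXp (i j : Idx M N) (m n : ℤ) (h2 : 2 ≤ lvl) (h : cc M i.1 j.1 ≠ 0) :
      rel q M N ext lvl
        (gi (Gen.Xp i (m + 1)) * gi (Gen.Xp j n) -
          (q ^ cc M i.1 j.1) • (gi (Gen.Xp j n) * gi (Gen.Xp i (m + 1))))
        ((q ^ cc M i.1 j.1) • (gi (Gen.Xp i m) * gi (Gen.Xp j (n + 1))) -
          gi (Gen.Xp j (n + 1)) * gi (Gen.Xp i m))
  | XXm (i j : Idx M N) (m n : ℤ) (h2 : 2 ≤ lvl) (h : cc M i.1 j.1 ≠ 0) :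
      rel q M N ext lvl
        (gi (Gen.Xm i (m + 1)) * gi (Gen.Xm j n) -
          (q ^ (-cc M i.1 j.1)) • (gi (Gen.Xm j n) * gi (Gen.Xm i (m + 1))))
        ((q ^ (-cc M i.1 j.1)) • (gi (Gen.Xm i m) * gi (Gen.Xm j (n + 1))) -
          gi (Gen.Xm j (n + 1)) * gi (Gen.Xm i m))
  | serreP (i j : Idx M N) (m n k : ℤ) (h3 : 3 ≤ lvl)
      (h : cc M i.1 j.1 = 1 ∨ cc M i.1 j.1 = -1) (hi : i.1 ≠ M) :
      rel q M N ext lvl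
        (brF q (gi (Gen.Xp i m)) (brF q⁻¹ (gi (Gen.Xp i n)) (gi (Gen.Xp j k))) +
          brF q (gi (Gen.Xp i n)) (brF q⁻¹ (gi (Gen.Xp i m)) (gi (Gen.Xp j k)))) 0
  | serreM (i j : Idx M N) (m n k : ℤ) (h3 : 3 ≤ lvl)
      (h : cc M i.1 j.1 = 1 ∨ cc M i.1 j.1 = -1) (hi : i.1 ≠ M) :
      rel q M N ext lvl
        (brF q (gi (Gen.Xm i m)) (brF q⁻¹ (gi (Gen.Xm i n)) (gi (Gen.Xm j k))) +
          brF q (gi (Gen.Xm i n)) (brF q⁻¹ (gi (Gen.Xm i m)) (gi (Gen.Xm j k)))) 0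
  | oscP (m n k u : ℤ) (h3 : 3 ≤ lvl) (hM : 1 < M) (hN : 1 < N) :
      rel q M N ext lvl
        (oscOf q M (XpF M N ext) m n k u + oscOf q M (XpF M N ext) m u k n) 0
  | oscM (m n k u : ℤ) (h3 : 3 ≤ lvl) (hM : 1 < M) (hN : 1 < N) :
      rel q M N ext lvl
        (oscOf q M (XmF M N ext) m n k u + oscOf q M (XmF M N ext) m u k n) 0
  | K0K0i (he : ext = true) : rel q M N ext lvl (gi (Gen.K0 he) * gi (Gen.K0i he)) 1
  | K0iK0 (he : ext = true) : rel q M N ext lvl (gi (Gen.K0i he) * gi (Gen.K0 he)) 1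
  | K0K (he : ext = true) (i : Idx M N) :
      rel q M N ext lvl (gi (Gen.K0 he) * gi (Gen.K i)) (gi (Gen.K i) * gi (Gen.K0 he))
  | K0Ki (he : ext = true) (i : Idx M N) :
      rel q M N ext lvl (gi (Gen.K0 he) * gi (Gen.Ki i)) (gi (Gen.Ki i) * gi (Gen.K0 he))
  | K0H (he : ext = true) (i : Idx M N) (s : {s : ℤ // s ≠ 0}) :
      rel q M N ext lvl (gi (Gen.K0 he) * gi (Gen.H i s)) (gi (Gen.H i s) * gi (Gen.K0 he))
  | K0Xp (he : ext = true) (i : Idx M N) (n : ℤ) :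
      rel q M N ext lvl (gi (Gen.K0 he) * gi (Gen.Xp i n))
        ((q ^ (if i.1 = 1 then (1 : ℤ) else 0)) • (gi (Gen.Xp i n) * gi (Gen.K0 he)))
  | K0Xm (he : ext = true) (i : Idx M N) (n : ℤ) :
      rel q M N ext lvl (gi (Gen.K0 he) * gi (Gen.Xm i n))
        ((q ^ (if i.1 = 1 then (-1 : ℤ) else 0)) • (gi (Gen.Xm i n) * gi (Gen.K0 he)))

/-! ### The quantum affine superalgebras -/

abbrev ALG (q : ℂ) (M N : ℕ) (ext : Bool) (lvl : ℕ) := RingQuot (rel q M N ext lvl)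

def mkA (q : ℂ) (M N : ℕ) (ext : Bool) (lvl : ℕ) : FA M N ext →ₐ[ℂ] ALG q M N ext lvl :=
  RingQuot.mkAlgHom ℂ (rel q M N ext lvl)

def XpA (q : ℂ) (M N : ℕ) (ext : Bool) (lvl : ℕ) (i : ℕ) (n : ℤ) : ALG q M N ext lvl :=
  mkA q M N ext lvl (XpF M N ext i n)

def XmA (q : ℂ) (M N : ℕ) (ext : Bool) (lvl : ℕ) (i : ℕ) (n : ℤ) : ALG q M N ext lvl :=
  mkA q M N ext lvl (XmF M N ext i n)

def KA (q : ℂ) (M N : ℕ) (ext : Bool) (lvl : ℕ) (i : ℕ) : ALG q M N ext lvl :=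
  mkA q M N ext lvl (KF M N ext i)

def KiA (q : ℂ) (M N : ℕ) (ext : Bool) (lvl : ℕ) (i : ℕ) : ALG q M N ext lvl :=
  mkA q M N ext lvl (KiF M N ext i)

def HA (q : ℂ) (M N : ℕ) (ext : Bool) (lvl : ℕ) (i : ℕ) (s : ℤ) : ALG q M N ext lvl :=
  mkA q M N ext lvl (HF M N ext i s)

def K0A (q : ℂ) (M N : ℕ) (ext : Bool) (lvl : ℕ) : ALG q M N ext lvl :=
  mkA q M N ext lvl (K0F M N ext)

def K0iA (q : ℂ) (M N : ℕ) (ext : Bool) (lvl : ℕ) : ALG q M N ext lvl :=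
  mkA q M N ext lvl (K0iF M N ext)

def phiPA (q : ℂ) (M N : ℕ) (ext : Bool) (lvl : ℕ) (i : ℕ) (n : ℤ) : ALG q M N ext lvl :=
  mkA q M N ext lvl (phiPF q M N ext i n)

def phiMA (q : ℂ) (M N : ℕ) (ext : Bool) (lvl : ℕ) (i : ℕ) (n : ℤ) : ALG q M N ext lvl :=
  mkA q M N ext lvl (phiMF q M N ext i n)

/-- `U⁺`: the subalgebra generated by the `X⁺_{i,n}`. -/
def Aplus (q : ℂ) (M N : ℕ) (ext : Bool) (lvl : ℕ) : Subalgebra ℂ (ALG q M N ext lvl) :=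
  Algebra.adjoin ℂ {x | ∃ i : ℕ, ∃ n : ℤ, x = XpA q M N ext lvl i n}

/-- `U⁻`: the subalgebra generated by the `X⁻_{i,n}`. -/
def Aminus (q : ℂ) (M N : ℕ) (ext : Bool) (lvl : ℕ) : Subalgebra ℂ (ALG q M N ext lvl) :=
  Algebra.adjoin ℂ {x | ∃ i : ℕ, ∃ n : ℤ, x = XmA q M N ext lvl i n}

/-- `U⁰`: the subalgebra generated by the `K_i^{±1}` and `h_{i,s}`. -/
def Azero (q : ℂ) (M N : ℕ) (ext : Bool) (lvl : ℕ) : Subalgebra ℂ (ALG q M N ext lvl) :=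
  Algebra.adjoin ℂ {x | (∃ i : ℕ, x = KA q M N ext lvl i) ∨ (∃ i : ℕ, x = KiA q M N ext lvl i) ∨
    ∃ i : ℕ, ∃ s : ℤ, x = HA q M N ext lvl i s}

/-- `U'⁰`: the subalgebra generated by `U⁰` and `K₀^{±1}`. -/
def AzeroE (q : ℂ) (M N : ℕ) (ext : Bool) (lvl : ℕ) : Subalgebra ℂ (ALG q M N ext lvl) :=
  Algebra.adjoin ℂ {x | (∃ i : ℕ, x = KA q M N ext lvl i) ∨ (∃ i : ℕ, x = KiA q M N ext lvl i) ∨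
    (∃ i : ℕ, ∃ s : ℤ, x = HA q M N ext lvl i s) ∨ x = K0A q M N ext lvl ∨
      x = K0iA q M N ext lvl}

/-! ### The multiplication map on the triple tensor product -/

def triMul (q : ℂ) (M N : ℕ) (ext : Bool) (lvl : ℕ)
    (S T R : Subalgebra ℂ (ALG q M N ext lvl)) :
    (↥S ⊗[ℂ] (↥T ⊗[ℂ] ↥R)) →ₗ[ℂ] ALG q M N ext lvl :=
  TensorProduct.lift
    (((LinearMap.mul ℂ (ALG q M N ext lvl)).comp S.val.toLinearMap).compl₂
      (TensorProduct.lift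
        (((LinearMap.mul ℂ (ALG q M N ext lvl)).comp T.val.toLinearMap).compl₂
          R.val.toLinearMap)))

/-! ### Root vectors and PBW monomials -/

def Xroot (q : ℂ) (M N : ℕ) (ext : Bool) (lvl : ℕ) (i : ℕ) : ℕ → ℤ → ALG q M N ext lvl
  | 0, n => XpA q M N ext lvl i n
  | k + 1, n =>
      brF (qpar q M (i + k + 1)) (Xroot q M N ext lvl i k n) (XpA q M N ext lvl (i + k + 1) 0)

/-- the root vector `X_{α_i + ⋯ + α_j}(n)`. -/
def XrootIJ (q : ℂ) (M N : ℕ) (ext : Bool) (lvl : ℕ) (i j : ℕ) (n : ℤ) : ALG q M N ext lvl :=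
  Xroot q M N ext lvl i (j - i) n

def rootLE (a b : ℕ × ℕ) : Prop := a.1 < b.1 ∨ (a.1 = b.1 ∧ a.2 ≤ b.2)

/-- the set of PBW ordered monomials in the root vectors. -/
def pbwSet (q : ℂ) (M N : ℕ) (ext : Bool) (lvl : ℕ) : Set (ALG q M N ext lvl) :=
  {x | ∃ L : List ((ℕ × ℕ) × ℤ),
      (∀ p ∈ L, 1 ≤ p.1.1 ∧ p.1.1 ≤ p.1.2 ∧ p.1.2 ≤ M + N - 1) ∧
      L.Chain' (fun a b => rootLE a.1 b.1) ∧
      x = (L.map fun p => XrootIJ q M N ext lvl p.1.1 p.1.2 p.2).prod}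

/-- PBW ordered monomials of total degree `d` (`d i` counts the multiplicity of `α_i`). -/
def pbwDegSet (q : ℂ) (M N : ℕ) (ext : Bool) (lvl : ℕ) (d : ℕ → ℕ) : Set (ALG q M N ext lvl) :=
  {x | ∃ L : List ((ℕ × ℕ) × ℤ),
      (∀ p ∈ L, 1 ≤ p.1.1 ∧ p.1.1 ≤ p.1.2 ∧ p.1.2 ≤ M + N - 1) ∧
      L.Chain' (fun a b => rootLE a.1 b.1) ∧
      (∀ i : ℕ, ((L.map fun p => if p.1.1 ≤ i ∧ i ≤ p.1.2 then 1 else 0).sum) = d i) ∧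
      x = (L.map fun p => XrootIJ q M N ext lvl p.1.1 p.1.2 p.2).prod}

/-- words in the generators `X⁺_{i,n}` of degree `d`. -/
def wordDegSet (q : ℂ) (M N : ℕ) (ext : Bool) (lvl : ℕ) (d : ℕ → ℕ) :
    Set (ALG q M N ext lvl) :=
  {x | ∃ w : List (ℕ × ℤ), (∀ p ∈ w, 1 ≤ p.1 ∧ p.1 ≤ M + N - 1) ∧
      (∀ i : ℕ, (w.map Prod.fst).count i = d i) ∧
      x = (w.map fun p => XpA q M N ext lvl p.1 p.2).prod}

/-! ### The subspaces `I^±_{i,j}` and `O^±` -/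

def IElt (q : ℂ) (M N : ℕ) (ext : Bool) (lvl : ℕ) (pl : Bool) (i j : ℕ) (m n : ℤ) :
    ALG q M N ext lvl :=
  let X : ℕ → ℤ → ALG q M N ext lvl := if pl then XpA q M N ext lvl else XmA q M N ext lvl
  let e : ℤ := if pl then cc M i j else -cc M i j
  if cc M i j = 0 then X i m * X j n - sgn M i j • (X j n * X i m)
  else
    X i (m + 1) * X j n - (q ^ e) • (X j n * X i (m + 1)) -
      (q ^ e) • (X i m * X j (n + 1)) + X j (n + 1) * X i m

def Isub (q : ℂ) (M N : ℕ) (ext : Bool) (lvl : ℕ) (pl : Bool) (i j : ℕ) :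
    Submodule ℂ (ALG q M N ext lvl) :=
  Submodule.span ℂ (Set.range fun p : ℤ × ℤ => IElt q M N ext lvl pl i j p.1 p.2)

def IsubAll (q : ℂ) (M N : ℕ) (ext : Bool) (lvl : ℕ) (pl : Bool) :
    Submodule ℂ (ALG q M N ext lvl) :=
  ⨆ p : ℕ × ℕ, ⨆ _ : 1 ≤ p.1 ∧ p.1 ≤ p.2 ∧ p.2 ≤ M + N - 1,
    Isub q M N ext lvl pl p.1 p.2

def OscElt (q : ℂ) (M N : ℕ) (ext : Bool) (lvl : ℕ) (pl : Bool) (m n k u : ℤ) :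
    ALG q M N ext lvl :=
  let X : ℕ → ℤ → ALG q M N ext lvl := if pl then XpA q M N ext lvl else XmA q M N ext lvl
  oscOf q M X m n k u + oscOf q M X m u k n

def Osub (q : ℂ) (M N : ℕ) (ext : Bool) (lvl : ℕ) (pl : Bool) :
    Submodule ℂ (ALG q M N ext lvl) :=
  Submodule.span ℂ
    (Set.range fun p : ℤ × ℤ × ℤ × ℤ => OscElt q M N ext lvl pl p.1 p.2.1 p.2.2.1 p.2.2.2)

/-- the sign `(−1)^{(p(α_k)+p(α_u))·p(α_i)}`. -/
def gsgn (M : ℕ) (k u i : ℕ) : ℂ :=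
  if ((k = M ∧ ¬u = M) ∨ (¬k = M ∧ u = M)) ∧ i = M then -1 else 1

/-! ### Highest weights and the associated eigenvalue sequences -/

/-- `Q·f = 0` for a bilateral formal series `f`. -/
def annih (Q : Polynomial ℂ) (f : ℤ → ℂ) : Prop :=
  ∀ n : ℤ, ∑ s ∈ Finset.range (Q.natDegree + 1), Q.coeff s * f (n - s) = 0

/-- an element of `R_{M,N}`: a highest weight `(P̲, f, c)`. -/
structure HW (q : ℂ) (M N : ℕ) : Type where
  P : ℕ → Polynomial ℂ
  f : ℤ → ℂ
  c : ℂ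
  P_const : ∀ i, (P i).coeff 0 = 1
  c_ne : c ≠ 0
  torsion : ∃ Q : Polynomial ℂ, Q ≠ 0 ∧ annih Q f
  f_zero : f 0 = (c - c⁻¹) / (q - q⁻¹)

def toPS (p : Polynomial ℂ) : PowerSeries ℂ := PowerSeries.mk fun n => p.coeff n

/-- `P(z·u)`. -/
def pscale (u : ℂ) (P : Polynomial ℂ) : Polynomial ℂ := P.comp (Polynomial.C u * Polynomial.X)

/-- the coefficient of `z^n` (`n ≥ 0`) in `q_i^{deg P} P(z q_i⁻¹)/P(z q_i)`,
expanded at `z = 0`. -/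
def gammaP (q : ℂ) (M : ℕ) (i : ℕ) (P : Polynomial ℂ) (n : ℤ) : ℂ :=
  if 0 ≤ n then
    qpar q M i ^ P.natDegree *
      PowerSeries.coeff n.toNat
        (toPS (pscale (qpar q M i)⁻¹ P) * (toPS (pscale (qpar q M i) P))⁻¹)
  else 0

/-- the coefficient of `z^n` (`n ≤ 0`) in `q_i^{deg P} P(z q_i⁻¹)/P(z q_i)`,
expanded at `z = ∞`. -/
def gammaM (q : ℂ) (M : ℕ) (i : ℕ) (P : Polynomial ℂ) (n : ℤ) : ℂ :=
  if n ≤ 0 then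
    qpar q M i ^ P.natDegree *
      PowerSeries.coeff (-n).toNat
        (toPS ((pscale (qpar q M i)⁻¹ P).reflect P.natDegree) *
          (toPS ((pscale (qpar q M i) P).reflect P.natDegree))⁻¹)
  else 0

/-! ### Verma, Weyl and simple modules -/

def vermaRels (q : ℂ) (M N : ℕ) (ext : Bool) (Λ : HW q M N) : Set (ALG q M N ext 3) :=
  {x | ∃ i : ℕ, ∃ n : ℤ, x = XpA q M N ext 3 i n} ∪
  {x | ∃ i : ℕ, ∃ n : ℤ, 1 ≤ i ∧ i ≤ M + N - 1 ∧ i ≠ M ∧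
      (x = phiPA q M N ext 3 i n - algebraMap ℂ _ (gammaP q M i (Λ.P i) n) ∨
       x = phiMA q M N ext 3 i n - algebraMap ℂ _ (gammaM q M i (Λ.P i) n))} ∪
  {x | x = KA q M N ext 3 M - algebraMap ℂ _ Λ.c} ∪
  {x | ∃ n : ℤ, x = phiPA q M N ext 3 M n - phiMA q M N ext 3 M n -
      algebraMap ℂ _ ((q - q⁻¹) * Λ.f n)} ∪
  {x | ext = true ∧ x = K0A q M N ext 3 - 1}

def evenRels (q : ℂ) (M N : ℕ) (ext : Bool) (Λ : HW q M N) : Set (ALG q M N ext 3) :=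
  {x | ∃ i : ℕ, 1 ≤ i ∧ i ≤ M + N - 1 ∧ i ≠ M ∧
      x = XmA q M N ext 3 i 0 ^ (1 + (Λ.P i).natDegree)}

def oddElt (q : ℂ) (M N : ℕ) (ext : Bool) (Q : Polynomial ℂ) (n : ℤ) : ALG q M N ext 3 :=
  ∑ s ∈ Finset.range (Q.natDegree + 1),
    Q.coeff (Q.natDegree - s) • XmA q M N ext 3 M ((s : ℤ) + n)

def oddRels (q : ℂ) (M N : ℕ) (ext : Bool) (Q : Polynomial ℂ) : Set (ALG q M N ext 3) :=
  if M = 1 ∧ N = 1 then {x | ∃ n : ℤ, x = oddElt q M N ext Q n}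
  else {oddElt q M N ext Q 0}

def vermaIdeal (q : ℂ) (M N : ℕ) (ext : Bool) (Λ : HW q M N) : Ideal (ALG q M N ext 3) :=
  Ideal.span (vermaRels q M N ext Λ)

def weylIdeal (q : ℂ) (M N : ℕ) (ext : Bool) (Λ : HW q M N) (Q : Polynomial ℂ) :
    Ideal (ALG q M N ext 3) :=
  Ideal.span (vermaRels q M N ext Λ ∪ evenRels q M N ext Λ ∪ oddRels q M N ext Q)

def uweylIdeal (q : ℂ) (M N : ℕ) (ext : Bool) (Λ : HW q M N) : Ideal (ALG q M N ext 3) :=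
  Ideal.span (vermaRels q M N ext Λ ∪ evenRels q M N ext Λ)

/-- the Verma module `M(Λ)`. -/
def VermaMod (q : ℂ) (M N : ℕ) (ext : Bool) (Λ : HW q M N) : Type :=
  ALG q M N ext 3 ⧸ vermaIdeal q M N ext Λ

/-- the Weyl module `W(Λ; Q)`. -/
def WeylMod (q : ℂ) (M N : ℕ) (ext : Bool) (Λ : HW q M N) (Q : Polynomial ℂ) : Type :=
  ALG q M N ext 3 ⧸ weylIdeal q M N ext Λ Q

/-- the universal Weyl module `W(Λ)`. -/
def UWeylMod (q : ℂ) (M N : ℕ) (ext : Bool) (Λ : HW q M N) : Type :=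
  ALG q M N ext 3 ⧸ uweylIdeal q M N ext Λ

instance (q : ℂ) (M N : ℕ) (ext : Bool) (Λ : HW q M N) : AddCommGroup (VermaMod q M N ext Λ) :=
  inferInstanceAs (AddCommGroup (ALG q M N ext 3 ⧸ vermaIdeal q M N ext Λ))
instance (q : ℂ) (M N : ℕ) (ext : Bool) (Λ : HW q M N) :
    Module (ALG q M N ext 3) (VermaMod q M N ext Λ) :=
  inferInstanceAs (Module (ALG q M N ext 3) (ALG q M N ext 3 ⧸ vermaIdeal q M N ext Λ))
instance (q : ℂ) (M N : ℕ) (ext : Bool) (Λ : HW q M N) : Module ℂ (VermaMod q M N ext Λ) :=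
  inferInstanceAs (Module ℂ (ALG q M N ext 3 ⧸ vermaIdeal q M N ext Λ))
instance (q : ℂ) (M N : ℕ) (ext : Bool) (Λ : HW q M N) :
    IsScalarTower ℂ (ALG q M N ext 3) (VermaMod q M N ext Λ) :=
  inferInstanceAs (IsScalarTower ℂ (ALG q M N ext 3) (ALG q M N ext 3 ⧸ vermaIdeal q M N ext Λ))

instance (q : ℂ) (M N : ℕ) (ext : Bool) (Λ : HW q M N) (Q : Polynomial ℂ) :
    AddCommGroup (WeylMod q M N ext Λ Q) :=
  inferInstanceAs (AddCommGroup (ALG q M N ext 3 ⧸ weylIdeal q M N ext Λ Q))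
instance (q : ℂ) (M N : ℕ) (ext : Bool) (Λ : HW q M N) (Q : Polynomial ℂ) :
    Module (ALG q M N ext 3) (WeylMod q M N ext Λ Q) :=
  inferInstanceAs (Module (ALG q M N ext 3) (ALG q M N ext 3 ⧸ weylIdeal q M N ext Λ Q))
instance (q : ℂ) (M N : ℕ) (ext : Bool) (Λ : HW q M N) (Q : Polynomial ℂ) :
    Module ℂ (WeylMod q M N ext Λ Q) :=
  inferInstanceAs (Module ℂ (ALG q M N ext 3 ⧸ weylIdeal q M N ext Λ Q))
instance (q : ℂ) (M N : ℕ) (ext : Bool) (Λ : HW q M N) (Q : Polynomial ℂ) :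
    IsScalarTower ℂ (ALG q M N ext 3) (WeylMod q M N ext Λ Q) :=
  inferInstanceAs
    (IsScalarTower ℂ (ALG q M N ext 3) (ALG q M N ext 3 ⧸ weylIdeal q M N ext Λ Q))

instance (q : ℂ) (M N : ℕ) (ext : Bool) (Λ : HW q M N) : AddCommGroup (UWeylMod q M N ext Λ) :=
  inferInstanceAs (AddCommGroup (ALG q M N ext 3 ⧸ uweylIdeal q M N ext Λ))
instance (q : ℂ) (M N : ℕ) (ext : Bool) (Λ : HW q M N) :
    Module (ALG q M N ext 3) (UWeylMod q M N ext Λ) :=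
  inferInstanceAs (Module (ALG q M N ext 3) (ALG q M N ext 3 ⧸ uweylIdeal q M N ext Λ))
instance (q : ℂ) (M N : ℕ) (ext : Bool) (Λ : HW q M N) : Module ℂ (UWeylMod q M N ext Λ) :=
  inferInstanceAs (Module ℂ (ALG q M N ext 3 ⧸ uweylIdeal q M N ext Λ))
instance (q : ℂ) (M N : ℕ) (ext : Bool) (Λ : HW q M N) :
    IsScalarTower ℂ (ALG q M N ext 3) (UWeylMod q M N ext Λ) :=
  inferInstanceAs (IsScalarTower ℂ (ALG q M N ext 3) (ALG q M N ext 3 ⧸ uweylIdeal q M N ext Λ))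

/-- the highest weight vector (image of `1`). -/
def vgen (q : ℂ) (M N : ℕ) (Λ : HW q M N) : VermaMod q M N true Λ :=
  Submodule.Quotient.mk 1

/-- the sum of all submodules not containing the highest weight vector (the unique
maximal submodule of the Verma module). -/
def radV (q : ℂ) (M N : ℕ) (Λ : HW q M N) :
    Submodule (ALG q M N true 3) (VermaMod q M N true Λ) :=
  sSup {p | vgen q M N Λ ∉ p}

/-- the simple quotient `S'(Λ)`. -/
def SimpMod (q : ℂ) (M N : ℕ) (Λ : HW q M N) : Type :=
  VermaMod q M N true Λ ⧸ radV q M N Λ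

instance (q : ℂ) (M N : ℕ) (Λ : HW q M N) : AddCommGroup (SimpMod q M N Λ) :=
  inferInstanceAs (AddCommGroup (VermaMod q M N true Λ ⧸ radV q M N Λ))
instance (q : ℂ) (M N : ℕ) (Λ : HW q M N) :
    Module (ALG q M N true 3) (SimpMod q M N Λ) :=
  inferInstanceAs (Module (ALG q M N true 3) (VermaMod q M N true Λ ⧸ radV q M N Λ))
instance (q : ℂ) (M N : ℕ) (Λ : HW q M N) : Module ℂ (SimpMod q M N Λ) :=
  inferInstanceAs (Module ℂ (VermaMod q M N true Λ ⧸ radV q M N Λ))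
instance (q : ℂ) (M N : ℕ) (Λ : HW q M N) :
    IsScalarTower ℂ (ALG q M N true 3) (SimpMod q M N Λ) :=
  inferInstanceAs (IsScalarTower ℂ (ALG q M N true 3) (VermaMod q M N true Λ ⧸ radV q M N Λ))

/-! ### Weight spaces -/

/-- `K_i` for `0 ≤ i`, with `K₀` at `i = 0`. -/
def Kgen (q : ℂ) (M N : ℕ) (ext : Bool) (lvl : ℕ) (i : ℕ) : ALG q M N ext lvl :=
  if i = 0 then K0A q M N ext lvl else KA q M N ext lvl i

/-- the `μ`-weight space of a module. -/
def wtSp (q : ℂ) (M N : ℕ) (ext : Bool) {W : Type} [AddCommGroup W] [Module ℂ W]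
    [Module (ALG q M N ext 3) W] [IsScalarTower ℂ (ALG q M N ext 3) W] (μ : ℕ → ℂ) :
    Submodule ℂ W where
  carrier := {w | ∀ i < M + N, Kgen q M N ext 3 i • w = μ i • w}
  add_mem' := by
    intro a b ha hb i hi
    rw [smul_add, ha i hi, hb i hi, smul_add]
  zero_mem' := by
    intro i hi
    rw [smul_zero, smul_zero]
  smul_mem' := by
    intro c w hw i hi
    have h1 : Kgen q M N ext 3 i • (c • w) = c • (Kgen q M N ext 3 i • w) := by
      rw [← algebraMap_smul (ALG q M N ext 3) c w, ← mul_smul, ← Algebra.commutes, mul_smul,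
        algebraMap_smul]
    rw [h1, hw i hi, smul_comm]

/-- the character `λ_Λ`. -/
def lamF (q : ℂ) (M N : ℕ) (Λ : HW q M N) : ℕ → ℂ :=
  fun i => if i = 0 then 1 else if i = M then Λ.c else qpar q M i ^ (Λ.P i).natDegree

/-- the character `α_j`. -/
def alF (q : ℂ) (M : ℕ) (j : ℕ) : ℕ → ℂ :=
  fun i => if i = 0 then (if j = 1 then q else 1) else q ^ cc M j i

/-! ### The generators of `U` inside `U'` -/

def UGenSet (q : ℂ) (M N : ℕ) : Set (ALG q M N true 3) :=
  {x | (∃ i : ℕ, ∃ n : ℤ, x = XpA q M N true 3 i n) ∨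
    (∃ i : ℕ, ∃ n : ℤ, x = XmA q M N true 3 i n) ∨
    (∃ i : ℕ, x = KA q M N true 3 i) ∨ (∃ i : ℕ, x = KiA q M N true 3 i) ∨
    ∃ i : ℕ, ∃ s : ℤ, x = HA q M N true 3 i s}

/-! ### One-sided presentations (for `U^±`) -/

def XgF (M N : ℕ) (i : ℕ) (n : ℤ) : FreeAlgebra ℂ (Idx M N × ℤ) :=
  if h : 1 ≤ i ∧ i ≤ M + N - 1 then FreeAlgebra.ι ℂ ((⟨i, h⟩, n) : Idx M N × ℤ) else 0

inductive rel1 (q : ℂ) (M N : ℕ) (pl : Bool) :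
    FreeAlgebra ℂ (Idx M N × ℤ) → FreeAlgebra ℂ (Idx M N × ℤ) → Prop
  | comm0 (i j : Idx M N) (m n : ℤ) (h : cc M i.1 j.1 = 0) :
      rel1 q M N pl
        (FreeAlgebra.ι ℂ ((i, m) : Idx M N × ℤ) * FreeAlgebra.ι ℂ ((j, n) : Idx M N × ℤ) -
          sgn M i.1 j.1 •
            (FreeAlgebra.ι ℂ ((j, n) : Idx M N × ℤ) * FreeAlgebra.ι ℂ ((i, m) : Idx M N × ℤ))) 0
  | deg2 (i j : Idx M N) (m n : ℤ) (h : cc M i.1 j.1 ≠ 0) :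
      rel1 q M N pl
        (FreeAlgebra.ι ℂ ((i, m + 1) : Idx M N × ℤ) * FreeAlgebra.ι ℂ ((j, n) : Idx M N × ℤ) -
          (q ^ (if pl then cc M i.1 j.1 else -cc M i.1 j.1)) •
            (FreeAlgebra.ι ℂ ((j, n) : Idx M N × ℤ) *
              FreeAlgebra.ι ℂ ((i, m + 1) : Idx M N × ℤ)))
        ((q ^ (if pl then cc M i.1 j.1 else -cc M i.1 j.1)) •
            (FreeAlgebra.ι ℂ ((i, m) : Idx M N × ℤ) *
              FreeAlgebra.ι ℂ ((j, n + 1) : Idx M N × ℤ)) -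
          FreeAlgebra.ι ℂ ((j, n + 1) : Idx M N × ℤ) * FreeAlgebra.ι ℂ ((i, m) : Idx M N × ℤ))
  | serre (i j : Idx M N) (m n k : ℤ) (h : cc M i.1 j.1 = 1 ∨ cc M i.1 j.1 = -1)
      (hi : i.1 ≠ M) :
      rel1 q M N pl
        (brF q (FreeAlgebra.ι ℂ ((i, m) : Idx M N × ℤ))
            (brF q⁻¹ (FreeAlgebra.ι ℂ ((i, n) : Idx M N × ℤ))
              (FreeAlgebra.ι ℂ ((j, k) : Idx M N × ℤ))) +
          brF q (FreeAlgebra.ι ℂ ((i, n) : Idx M N × ℤ))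
            (brF q⁻¹ (FreeAlgebra.ι ℂ ((i, m) : Idx M N × ℤ))
              (FreeAlgebra.ι ℂ ((j, k) : Idx M N × ℤ)))) 0
  | osc (m n k u : ℤ) (hM : 1 < M) (hN : 1 < N) :
      rel1 q M N pl (oscOf q M (XgF M N) m n k u + oscOf q M (XgF M N) m u k n) 0

end QAS

noncomputable section
namespace QW
open Finset

/-- words -/
abbrev Wd (ι : Type) := List (ι × ℤ)
/-- the tensor space -/
abbrev TT (ι : Type) := Wd ι →₀ ℂ

structure Dat (ι : Type) where
  pr : ι → ι → ℂ
  sg : ι → ι → ℂ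
  ka : ι → ℂ
  pr_ne : ∀ i j, pr i j ≠ 0
  pr_symm : ∀ i j, pr i j = pr j i
  sg_sq : ∀ i j, sg i j * sg i j = 1
  sg_symm : ∀ i j, sg i j = sg j i
  ka_ne : ∀ i, ka i ≠ 0

variable {ι : Type}

def wd (w : Wd ι) : TT ι := Finsupp.single w 1

def lin {V : Type} [AddCommGroup V] [Module ℂ V] (f : Wd ι → V) : TT ι →ₗ[ℂ] V :=
  Finsupp.linearCombination ℂ f

@[simp] theorem lin_wd {V : Type} [AddCommGroup V] [Module ℂ V] (f : Wd ι → V) (w : Wd ι) :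
    lin f (wd w) = f w := by simp [lin, wd]

theorem lin_ext {V : Type} [AddCommGroup V] [Module ℂ V] {A B : TT ι →ₗ[ℂ] V}
    (h : ∀ w, A (wd w) = B (wd w)) : A = B := by
  apply Finsupp.lhom_ext'
  intro w
  ext
  simpa [wd] using h w

theorem TT_ind {p : TT ι → Prop} (x : TT ι) (h0 : p 0) (hadd : ∀ x y, p x → p y → p (x + y))
    (hs : ∀ (c : ℂ) w, p (c • wd w)) : p x := by
  induction x using Finsupp.induction_linear with
  | zero => exact h0
  | add f g hf hg => exact hadd f g hf hg
  | single a b => simpa [wd] using hs b a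

/-- `X⁻_{j,n}` -/
def Xm (j : ι) (n : ℤ) : Module.End ℂ (TT ι) := lin fun w => wd ((j, n) :: w)

@[simp] theorem Xm_wd (j : ι) (n : ℤ) (w : Wd ι) : Xm j n (wd w) = wd ((j, n) :: w) := by
  simp [Xm]

/-- word induction for endomorphism-type identities -/
theorem lin_ext_cons {V : Type} [AddCommGroup V] [Module ℂ V] {A B : TT ι →ₗ[ℂ] V}
    (h0 : A (wd []) = B (wd []))
    (h : ∀ j n w, A (wd w) = B (wd w) → A (Xm j n (wd w)) = B (Xm j n (wd w))) : A = B := by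
  apply lin_ext
  intro w
  induction w with
  | nil => exact h0
  | cons a w ih => simpa using h a.1 a.2 w ih

section ops
variable (D : Dat ι)

def dco (i j : ι) (s : ℤ) : ℂ := (D.pr i j ^ s - D.pr i j ^ (-s)) / (D.ka i * s)

/-- coefficients of `(p - y)/(1 - p y)` -/
def gco (p : ℂ) : ℕ → ℂ
  | 0 => p
  | a + 1 => p ^ (a + 2) - p ^ a

def Hw (η : ℂ) (i : ι) (s : ℤ) : Wd ι → TT ι
  | [] => η • wd []
  | (j, n) :: w => Xm j n (Hw η i s w) + dco D i j s • wd ((j, n + s) :: w)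

def Hop (η : ℂ) (i : ι) (s : ℤ) : Module.End ℂ (TT ι) := lin (Hw D η i s)

theorem Hop_nil (η : ℂ) (i : ι) (s : ℤ) : Hop D η i s (wd []) = η • wd [] := by
  simp [Hop, Hw]

theorem Hop_Xm (η : ℂ) (i : ι) (s : ℤ) (j : ι) (n : ℤ) :
    Hop D η i s * Xm j n = Xm j n * Hop D η i s + dco D i j s • Xm j (n + s) := by
  apply lin_ext; intro w; simp [Hop, Hw]

def Kw (k : ℂ) (ε : ℤ) (i : ι) : Wd ι → TT ι
  | [] => k • wd []
  | (j, n) :: w => (D.pr i j ^ ε) • Xm j n (Kw k ε i w)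

def Kop (k : ℂ) (ε : ℤ) (i : ι) : Module.End ℂ (TT ι) := lin (Kw D k ε i)

theorem Kop_nil (k : ℂ) (ε : ℤ) (i : ι) : Kop D k ε i (wd []) = k • wd [] := by
  simp [Kop, Kw]

theorem Kop_Xm (k : ℂ) (ε : ℤ) (i : ι) (j : ι) (n : ℤ) :
    Kop D k ε i * Xm j n = (D.pr i j ^ ε) • (Xm j n * Kop D k ε i) := by
  apply lin_ext; intro w; simp [Kop, Kw]

def Phw (ε : ℤ) (i : ι) (b : ℕ → ℂ) : Wd ι → ℕ → TT ι
  | [], k => b k • wd []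
  | (j, n) :: w, k => ∑ a ∈ range (k + 1),
      gco (D.pr i j ^ ε) a • Xm j (n + ε * a) (Phw ε i b w (k - a))

def Phi (ε : ℤ) (i : ι) (b : ℕ → ℂ) (k : ℕ) : Module.End ℂ (TT ι) :=
  lin fun w => Phw D ε i b w k

theorem Phi_nil (ε : ℤ) (i : ι) (b : ℕ → ℂ) (k : ℕ) :
    Phi D ε i b k (wd []) = b k • wd [] := by
  simp [Phi, Phw]

theorem Phi_Xm (ε : ℤ) (i : ι) (b : ℕ → ℂ) (k : ℕ) (j : ι) (n : ℤ) :
    Phi D ε i b k * Xm j n = ∑ a ∈ range (k + 1),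
      gco (D.pr i j ^ ε) a • (Xm j (n + ε * a) * Phi D ε i b (k - a)) := by
  apply lin_ext; intro w; simp [Phi, Phw, LinearMap.sum_apply]

/-- delta base -/
def dl : ℕ → ℂ := fun k => if k = 0 then 1 else 0

theorem Phi_lin (ε : ℤ) (i : ι) (b : ℕ → ℂ) (k : ℕ) :
    Phi D ε i b k = ∑ a ∈ range (k + 1), b a • Phi D ε i dl (k - a) := by
  apply lin_ext
  intro w
  induction w generalizing k with
  | nil =>
    rw [Phi_nil, LinearMap.sum_apply, Finset.sum_eq_single_of_mem k (by simp)]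
    · simp [Phi_nil, dl]
    · intro a ha hne
      simp only [mem_range] at ha
      have : k - a ≠ 0 := by omega
      simp [Phi_nil, dl, this]
  | cons x w ih =>
    obtain ⟨j, n⟩ := x
    have h1 := fun b k => congrArg (fun A => A (wd w)) (Phi_Xm D ε i b k j n)
    simp only [Module.End.mul_apply, Xm_wd, LinearMap.sum_apply, LinearMap.smul_apply] at h1
    rw [h1]
    simp only [LinearMap.sum_apply, LinearMap.smul_apply, h1]
    simp only [ih, LinearMap.sum_apply, LinearMap.smul_apply, map_sum, map_smul, Finset.smul_sum]
    rw [Finset.sum_sigma', Finset.sum_sigma']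
    refine Finset.sum_bij' (fun x _ => ⟨x.2, x.1⟩) (fun x _ => ⟨x.2, x.1⟩) ?_ ?_ ?_ ?_ ?_
    · rintro ⟨a, c⟩ h; simp at h ⊢; omega
    · rintro ⟨a, c⟩ h; simp at h ⊢; omega
    · rintro ⟨a, c⟩ h; rfl
    · rintro ⟨a, c⟩ h; rfl
    · rintro ⟨a, c⟩ h
      simp only
      rw [smul_comm, show k - a - c = k - c - a by omega]

/-- two-sided family: `φ⁺_n` (n≥0) minus `φ⁻_n` (n≤0). -/
def phZ (γ : ℤ → ι → ℕ → ℂ) (i : ι) (n : ℤ) : Module.End ℂ (TT ι) :=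
  (if 0 ≤ n then Phi D 1 i (γ 1 i) n.toNat else 0) -
    (if n ≤ 0 then Phi D (-1) i (γ (-1) i) (-n).toNat else 0)

variable [DecidableEq ι]

def Xpw (γ : ℤ → ι → ℕ → ℂ) (i : ι) (m : ℤ) : Wd ι → TT ι
  | [] => 0
  | (j, n) :: w => D.sg i j • Xm j n (Xpw γ i m w) +
      if i = j then (D.ka i)⁻¹ • phZ D γ i (m + n) (wd w) else 0

def Xp (γ : ℤ → ι → ℕ → ℂ) (i : ι) (m : ℤ) : Module.End ℂ (TT ι) := lin (Xpw D γ i m)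

theorem Xp_nil (γ : ℤ → ι → ℕ → ℂ) (i : ι) (m : ℤ) : Xp D γ i m (wd []) = 0 := by
  simp [Xp, Xpw]

theorem Xp_Xm (γ : ℤ → ι → ℕ → ℂ) (i : ι) (m : ℤ) (j : ι) (n : ℤ) :
    Xp D γ i m * Xm j n = D.sg i j • (Xm j n * Xp D γ i m) +
      if i = j then (D.ka i)⁻¹ • phZ D γ i (m + n) else 0 := by
  apply lin_ext; intro w
  by_cases h : i = j <;> simp [Xp, Xpw, h]

end ops

section gen
/-! generic exchange lemma -/
open QAS

theorem expC_zero {A : Type} [Ring A] [Algebra ℂ A] (t : ℂ) (a : ℕ → A) : expC t a 0 = 1 := by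
  rw [expC]

theorem expC_succ {A : Type} [Ring A] [Algebra ℂ A] (t : ℂ) (a : ℕ → A) (n : ℕ) :
    expC t a (n + 1) = ((n : ℂ) + 1)⁻¹ •
        (t • ∑ s ∈ Finset.range (n + 1), ((s : ℂ) + 1) • (a (s + 1) * expC t a (n - s))) := by
  rw [expC]

theorem expC_succ' {A : Type} [Ring A] [Algebra ℂ A] (t : ℂ) (a : ℕ → A) (n : ℕ) :
    ((n : ℂ) + 1) • expC t a (n + 1) =
        t • ∑ s ∈ Finset.range (n + 1), ((s : ℂ) + 1) • (a (s + 1) * expC t a (n - s)) := by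
  rw [expC_succ, smul_smul, mul_inv_cancel₀ (by exact_mod_cast Nat.succ_ne_zero n), one_smul]

theorem expC_commute {A : Type} [Ring A] [Algebra ℂ A] (t : ℂ) (a : ℕ → A) (x : A)
    (h : ∀ s, Commute x (a s)) (n : ℕ) : Commute x (expC t a n) := by
  induction n using Nat.strong_induction_on with
  | _ n ih =>
    cases n with
    | zero => rw [expC_zero]; exact Commute.one_right x
    | succ n =>
      rw [expC_succ]
      refine Commute.smul_right (Commute.smul_right (Commute.sum_right _ _ _ ?_) _) _
      intro s hs
      refine Commute.smul_right ((h _).mul_right (ih _ ?_)) _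
      omega

end gen
end QW
end

noncomputable section
namespace QW
open Finset QAS

theorem expC_succ_ad {A : Type} [Ring A] [Algebra ℂ A] (t : ℂ) (a : ℕ → A) (n : ℕ) :
    ((n : ℂ) + 1) • expC t a (n + 1) =
        t • ∑ x ∈ antidiagonal n, ((x.1 : ℂ) + 1) • (a (x.1 + 1) * expC t a x.2) := by
  rw [expC_succ', Finset.Nat.sum_antidiagonal_eq_sum_range_succ_mk]

theorem exch_left {A : Type} [Ring A] [Algebra ℂ A] (t : ℂ) (ε : ℤ) (H : ℕ → A) (X : ℤ → A)
    (d : ℕ → ℂ) (h : ∀ s n, H (s + 1) * X n = X n * H (s + 1) + d (s + 1) • X (n + ε * ((s + 1 : ℕ) : ℤ)))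
    (k : ℕ) : ∀ n : ℤ, expC t H k * X n =
      ∑ x ∈ antidiagonal k, expC t d x.1 • (X (n + ε * x.1) * expC t H x.2) := by
  induction k using Nat.strong_induction_on with
  | _ k ih =>
    intro n
    cases k with
    | zero => simp [expC_zero]
    | succ k =>
      have hk : ((k : ℂ) + 1) ≠ 0 := by exact_mod_cast Nat.succ_ne_zero k
      apply (smul_right_injective A hk)
      simp only
      rw [← smul_mul_assoc, expC_succ_ad, smul_mul_assoc, Finset.sum_mul]
      have e1 : ((k : ℂ) + 1) • ∑ x ∈ antidiagonal (k + 1),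
            expC t d x.1 • (X (n + ε * x.1) * expC t H x.2) =
          ∑ x ∈ antidiagonal (k + 1), ((x.1 : ℂ) * expC t d x.1) • (X (n + ε * x.1) * expC t H x.2)
          + ∑ x ∈ antidiagonal (k + 1),
            expC t d x.1 • (X (n + ε * x.1) * ((x.2 : ℂ) • expC t H x.2)) := by
        rw [Finset.smul_sum, ← Finset.sum_add_distrib]
        refine Finset.sum_congr rfl fun x hx => ?_
        have hx : x.1 + x.2 = k + 1 := by simpa using hx
        have : ((k : ℂ) + 1) = x.1 + x.2 := by exact_mod_cast hx.symm
        rw [this, mul_smul_comm, smul_smul, smul_smul, ← add_smul]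
        congr 1; ring
      rw [e1, Finset.Nat.sum_antidiagonal_succ, Finset.Nat.sum_antidiagonal_succ']
      simp only [Nat.cast_zero, zero_mul, zero_smul, zero_add, mul_zero, smul_zero, Nat.cast_add,
        Nat.cast_one, expC_succ_ad]
      have e2 : ∀ a : ℕ, ((a : ℂ) + 1) * expC t d (a + 1) =
          t * ∑ x ∈ antidiagonal a, ((x.1 : ℂ) + 1) * (d (x.1 + 1) * expC t d x.2) := by
        intro a
        simpa using expC_succ_ad t d a
      simp only [e2]
      have e3 : ∑ x ∈ antidiagonal k, ((x.1 : ℂ) + 1) • (H (x.1 + 1) * expC t H x.2) * X n =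
        ∑ x ∈ antidiagonal k, ∑ y ∈ antidiagonal x.2, (
          (((x.1 : ℂ) + 1) * expC t d y.1) • (X (n + ε * y.1) * (H (x.1 + 1) * expC t H y.2)) +
          (((x.1 : ℂ) + 1) * expC t d y.1 * d (x.1 + 1)) •
            (X (n + ε * y.1 + ε * ((x.1 + 1 : ℕ) : ℤ)) * expC t H y.2)) := by
        refine Finset.sum_congr rfl fun x hx => ?_
        have hx : x.1 + x.2 = k := by simpa using hx
        rw [smul_mul_assoc, mul_assoc, ih _ (by omega), Finset.mul_sum, Finset.smul_sum]
        refine Finset.sum_congr rfl fun y hy => ?_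
        rw [mul_smul_comm, ← mul_assoc, h, add_mul, smul_add, smul_add, smul_mul_assoc, mul_assoc]
        simp only [smul_smul]
        ring_nf
      rw [e3]
      simp only [Finset.sum_add_distrib, smul_add]
      rw [add_comm]
      congr 1
      · simp only [Finset.mul_sum, Finset.sum_smul, Finset.smul_sum]
        rw [Finset.sum_sigma', Finset.sum_sigma']
        refine Finset.sum_bij' (fun x _ => ⟨(x.1.1 + x.2.1, x.2.2), (x.1.1, x.2.1)⟩)
          (fun x _ => ⟨(x.2.1, x.2.2 + x.1.2), (x.2.2, x.1.2)⟩) ?_ ?_ ?_ ?_ ?_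
        · rintro ⟨⟨a, c⟩, ⟨b, e⟩⟩ h; simp at h ⊢; omega
        · rintro ⟨⟨a, c⟩, ⟨b, e⟩⟩ h; simp at h ⊢; omega
        · rintro ⟨⟨a, c⟩, ⟨b, e⟩⟩ h; simp at h ⊢; omega
        · rintro ⟨⟨a, c⟩, ⟨b, e⟩⟩ h; simp at h ⊢; omega
        · rintro ⟨⟨a, c⟩, ⟨b, e⟩⟩ h
          simp only [smul_smul]
          congr 1
          · ring
          · congr 2; push_cast; ring
      · simp only [Finset.mul_sum, Finset.smul_sum, mul_smul_comm]
        rw [Finset.sum_sigma', Finset.sum_sigma']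
        refine Finset.sum_bij' (fun x _ => ⟨(x.2.1, x.1.1 + x.2.2), (x.1.1, x.2.2)⟩)
          (fun x _ => ⟨(x.2.1, x.1.1 + x.2.2), (x.1.1, x.2.2)⟩) ?_ ?_ ?_ ?_ ?_
        · rintro ⟨⟨a, c⟩, ⟨b, e⟩⟩ h; simp at h ⊢; omega
        · rintro ⟨⟨a, c⟩, ⟨b, e⟩⟩ h; simp at h ⊢; omega
        · rintro ⟨⟨a, c⟩, ⟨b, e⟩⟩ h; simp at h ⊢; omega
        · rintro ⟨⟨a, c⟩, ⟨b, e⟩⟩ h; simp at h ⊢; omega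
        · rintro ⟨⟨a, c⟩, ⟨b, e⟩⟩ h
          simp only [smul_smul]
          congr 1
          ring

/-- value on the opposite algebra -/
theorem expC_op {A : Type} [Ring A] [Algebra ℂ A] (t : ℂ) (a : ℕ → A)
    (hc : ∀ s r, Commute (a s) (a r)) (n : ℕ) :
    expC t (fun s => MulOpposite.op (a s)) n = MulOpposite.op (expC t a n) := by
  induction n using Nat.strong_induction_on with
  | _ n ih =>
    cases n with
    | zero => simp [expC_zero]
    | succ n =>
      rw [expC_succ, expC_succ, MulOpposite.op_smul, MulOpposite.op_smul, Finset.op_sum]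
      congr 2
      refine Finset.sum_congr rfl fun s hs => ?_
      rw [ih _ (by omega), MulOpposite.op_smul,
        ← MulOpposite.op_mul, (expC_commute t a (a (s + 1)) (fun r => hc _ _) _).eq]

theorem exch_right {A : Type} [Ring A] [Algebra ℂ A] (t : ℂ) (ε : ℤ) (H : ℕ → A) (X : ℤ → A)
    (hc : ∀ s r, Commute (H s) (H r))
    (d : ℕ → ℂ) (h : ∀ s n, X n * H (s + 1) = H (s + 1) * X n + d (s + 1) • X (n + ε * ((s + 1 : ℕ) : ℤ)))
    (k : ℕ) (n : ℤ) : X n * expC t H k =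
      ∑ x ∈ antidiagonal k, expC t d x.1 • (expC t H x.2 * X (n + ε * x.1)) := by
  have := exch_left (A := Aᵐᵒᵖ) t ε (fun s => MulOpposite.op (H s)) (fun n => MulOpposite.op (X n)) d
    (by
      intro s n
      rw [← MulOpposite.op_mul, h, MulOpposite.op_add, MulOpposite.op_mul, MulOpposite.op_smul]) k n
  simp only [expC_op t H hc, ← MulOpposite.op_mul, ← MulOpposite.op_smul, ← Finset.op_sum] at this
  exact MulOpposite.op_injective this

/-- coefficients of `(1 - y/p)/(1 - p y)` -/
theorem gco_eq (p : ℂ) (hp : p ≠ 0) (t : ℂ) (d : ℕ → ℂ)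
    (hd : ∀ s : ℕ, t * ((s : ℂ) + 1) * d (s + 1) = p ^ (s + 1) - p⁻¹ ^ (s + 1)) (k : ℕ) :
    p * expC t d k = gco p k := by
  induction k using Nat.strong_induction_on with
  | _ k ih =>
    cases k with
    | zero => simp [expC_zero, gco]
    | succ k =>
      have hk : ((k : ℂ) + 1) ≠ 0 := by exact_mod_cast Nat.succ_ne_zero k
      apply mul_left_cancel₀ hk
      have e1 := expC_succ' t d k
      simp only [smul_eq_mul] at e1
      rw [mul_left_comm, e1, mul_left_comm]
      have e2 : t * (p * ∑ s ∈ range (k + 1), ((s : ℂ) + 1) * (d (s + 1) * expC t d (k - s))) =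
          ∑ s ∈ range (k + 1), (p ^ (s + 1) - p⁻¹ ^ (s + 1)) * gco p (k - s) := by
        rw [Finset.mul_sum, Finset.mul_sum]
        refine Finset.sum_congr rfl fun s hs => ?_
        rw [← hd, ← ih _ (by omega)]; ring
      rw [e2]
      clear e1 e2 ih hk
      -- sum evaluation: reflect and induct
      have key : ∀ k : ℕ, ∑ s ∈ range (k + 1), p ^ (s + 1) * gco p (k - s) =
          (k + 1) * (p ^ (k + 2)) - k * p ^ k := by
        intro k
        rw [Finset.sum_range_succ, Nat.sub_self]
        have : ∑ s ∈ range k, p ^ (s + 1) * gco p (k - s) =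
            ∑ s ∈ range k, (p ^ (k + 2) - p ^ k) := by
          refine Finset.sum_congr rfl fun s hs => ?_
          have hs := Finset.mem_range.1 hs
          obtain ⟨r, rfl⟩ : ∃ r, k = s + r + 1 := ⟨k - s - 1, by omega⟩
          rw [show s + r + 1 - s = r + 1 by omega, gco]; ring
        rw [this]; simp [gco]; ring
      have key2 : ∀ k : ℕ, ∑ s ∈ range (k + 1), p⁻¹ ^ (s + 1) * gco p (k - s) = p ^ k := by
        intro k
        induction k with
        | zero => simp [gco, hp]
        | succ k ih =>
          rw [Finset.sum_range_succ']
          have : ∑ s ∈ range (k + 1), p⁻¹ ^ (s + 1 + 1) * gco p (k + 1 - (s + 1)) =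
              p⁻¹ * p ^ k := by
            rw [← ih, Finset.mul_sum]
            refine Finset.sum_congr rfl fun s hs => ?_
            rw [Nat.add_sub_add_right]; ring
          rw [this]; simp [gco]; field_simp; ring
      simp only [sub_mul, Finset.sum_sub_distrib, key, key2]
      rw [gco]
      ring

end QW
end

noncomputable section
set_option linter.unusedSimpArgs false
set_option linter.unusedSectionVars false
namespace QW
open Finset QAS

variable {ι : Type}

/-- induction principle with general vectors -/
theorem end_ext_Xm {A B : Module.End ℂ (TT ι)}
    (h0 : A (wd []) = B (wd []))
    (h : ∀ (j : ι) (n : ℤ) (w : Wd ι), A (wd w) = B (wd w) →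
      (A * Xm j n : Module.End ℂ (TT ι)) (wd w) = (B * Xm j n : Module.End ℂ (TT ι)) (wd w)) : A = B :=
  lin_ext_cons h0 h

theorem HH_comm (D : Dat ι) (a b : ℂ) (i j : ι) (s t : ℤ) :
    Hop D a i s * Hop D b j t = Hop D b j t * Hop D a i s := by
  apply end_ext_Xm
  · simp [Hop_nil, smul_smul, mul_comm]
  · intro k n w ih
    have e1 : Hop D a i s * Hop D b j t * Xm k n = Xm k n * (Hop D a i s * Hop D b j t)
        + dco D i k s • (Xm k (n + s) * Hop D b j t) + dco D j k t • (Xm k (n + t) * Hop D a i s)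
        + (dco D i k s * dco D j k t) • Xm k (n + s + t) := by
      rw [mul_assoc, Hop_Xm, mul_add, mul_smul_comm, Hop_Xm, ← mul_assoc, Hop_Xm, add_mul, mul_assoc,
        smul_add, smul_smul, smul_mul_assoc, add_right_comm n t s, mul_comm (dco D j k t)]
      abel
    have e2 : Hop D b j t * Hop D a i s * Xm k n = Xm k n * (Hop D b j t * Hop D a i s)
        + dco D i k s • (Xm k (n + s) * Hop D b j t) + dco D j k t • (Xm k (n + t) * Hop D a i s)
        + (dco D i k s * dco D j k t) • Xm k (n + s + t) := by
      rw [mul_assoc, Hop_Xm, mul_add, mul_smul_comm, Hop_Xm, ← mul_assoc, Hop_Xm, add_mul, mul_assoc,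
        smul_add, smul_smul, smul_mul_assoc]
      abel
    rw [e1, e2]
    simp only [LinearMap.add_apply, Module.End.mul_apply] at ih ⊢
    rw [ih]

theorem KH_comm (D : Dat ι) (a b : ℂ) (ε : ℤ) (i j : ι) (t : ℤ) :
    Kop D a ε i * Hop D b j t = Hop D b j t * Kop D a ε i := by
  apply end_ext_Xm
  · simp [Hop_nil, Kop_nil, smul_smul, mul_comm]
  · intro k n w ih
    have e1 : Kop D a ε i * Hop D b j t * Xm k n = D.pr i k ^ ε • (Xm k n * (Kop D a ε i * Hop D b j t)
        + dco D j k t • (Xm k (n + t) * Kop D a ε i)) := by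
      rw [mul_assoc, Hop_Xm, mul_add, mul_smul_comm, Kop_Xm, ← mul_assoc, Kop_Xm, smul_mul_assoc,
        mul_assoc, smul_add, smul_comm (dco D j k t)]
    have e2 : Hop D b j t * Kop D a ε i * Xm k n = D.pr i k ^ ε • (Xm k n * (Hop D b j t * Kop D a ε i)
        + dco D j k t • (Xm k (n + t) * Kop D a ε i)) := by
      rw [mul_assoc, Kop_Xm, mul_smul_comm, ← mul_assoc, Hop_Xm, add_mul, mul_assoc, smul_mul_assoc]
    rw [e1, e2]
    simp only [LinearMap.add_apply, LinearMap.smul_apply, Module.End.mul_apply] at ih ⊢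
    rw [ih]

theorem KK_comm (D : Dat ι) (a b : ℂ) (ε δ : ℤ) (i j : ι) :
    Kop D a ε i * Kop D b δ j = Kop D b δ j * Kop D a ε i := by
  apply end_ext_Xm
  · simp [Kop_nil, smul_smul, mul_comm]
  · intro k n w ih
    rw [mul_assoc, Kop_Xm, mul_smul_comm, ← mul_assoc, Kop_Xm, mul_assoc, Kop_Xm,
      mul_smul_comm, ← mul_assoc, Kop_Xm]
    simp only [LinearMap.smul_apply, Module.End.mul_apply, smul_mul_assoc] at ih ⊢
    rw [ih, smul_comm]

theorem K_inv (D : Dat ι) (a b : ℂ) (hab : a * b = 1) (ε : ℤ) (i : ι) :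
    Kop D a ε i * Kop D b (-ε) i = 1 := by
  apply end_ext_Xm
  · simp [Kop_nil, smul_smul, mul_comm, hab]
  · intro k n w ih
    rw [mul_assoc, Kop_Xm, mul_smul_comm, ← mul_assoc, Kop_Xm]
    simp only [LinearMap.smul_apply, Module.End.mul_apply, smul_mul_assoc, Module.End.one_apply] at ih ⊢
    rw [ih, smul_smul, ← zpow_add₀ (D.pr_ne _ _)]
    simp

structure HWD (ι : Type) where
  ke : ι → ℂ
  ke_ne : ∀ i, ke i ≠ 0
  η : ι → ℤ → ℂ

def gam (D : Dat ι) (W : HWD ι) (ε : ℤ) (i : ι) (k : ℕ) : ℂ :=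
  W.ke i ^ ε * expC ((ε : ℂ) * D.ka i) (fun s => W.η i (ε * s)) k

def HO (D : Dat ι) (W : HWD ι) (i : ι) (s : ℤ) : Module.End ℂ (TT ι) := Hop D (W.η i s) i s
def KO (D : Dat ι) (W : HWD ι) (ε : ℤ) (i : ι) : Module.End ℂ (TT ι) := Kop D (W.ke i ^ ε) ε i
def PhO (D : Dat ι) (W : HWD ι) (ε : ℤ) (i : ι) (k : ℕ) : Module.End ℂ (TT ι) :=
  Phi D ε i (gam D W ε i) k

theorem dco_gco (D : Dat ι) (i j : ι) (ε : ℤ) (hε : ε = 1 ∨ ε = -1) (k : ℕ) :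
    D.pr i j ^ ε * expC ((ε : ℂ) * D.ka i) (fun s => dco D i j (ε * s)) k
      = gco (D.pr i j ^ ε) k := by
  have hk := D.ka_ne i
  have hp := D.pr_ne i j
  apply gco_eq _ (zpow_ne_zero _ (D.pr_ne i j))
  intro s
  have hs : ((s : ℂ) + 1) ≠ 0 := by exact_mod_cast Nat.succ_ne_zero s
  rcases hε with rfl | rfl
  · simp only [dco]
    push_cast
    simp only [one_mul]
    rw [zpow_neg, zpow_one, inv_pow, ← Nat.cast_succ (R := ℤ), zpow_natCast]
    field_simp
  · simp only [dco]
    push_cast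
    rw [show (-1 : ℤ) * ((s : ℤ) + 1) = -((s + 1 : ℕ) : ℤ) by push_cast; ring]
    rw [neg_neg, zpow_neg, zpow_natCast]
    simp only [zpow_neg, zpow_one, inv_pow, inv_inv]
    field_simp

theorem expH_Xm (D : Dat ι) (W : HWD ι) (ε : ℤ) (t : ℂ) (i j : ι) (n : ℤ) (k : ℕ) :
    expC t (fun s : ℕ => HO D W i (ε * s)) k * Xm j n =
      ∑ x ∈ antidiagonal k, expC t (fun s : ℕ => dco D i j (ε * s)) x.1 •
        (Xm j (n + ε * x.1) * expC t (fun s : ℕ => HO D W i (ε * s)) x.2) := by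
  apply exch_left
  intro s n
  simp only [HO, Hop_Xm]

theorem expH_nil (D : Dat ι) (W : HWD ι) (ε : ℤ) (t : ℂ) (i : ι) (k : ℕ) :
    expC t (fun s : ℕ => HO D W i (ε * s)) k (wd []) =
      expC t (fun s : ℕ => W.η i (ε * s)) k • wd [] := by
  induction k using Nat.strong_induction_on with
  | _ k ih =>
    cases k with
    | zero => simp [expC_zero]
    | succ k =>
      rw [expC_succ, expC_succ]
      simp only [LinearMap.smul_apply, LinearMap.sum_apply, Module.End.mul_apply, smul_eq_mul,
        mul_smul, Finset.sum_smul]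
      congr 2
      refine Finset.sum_congr rfl fun s hs => ?_
      rw [ih _ (by omega), map_smul, HO, Hop_nil, smul_comm (expC _ _ _)]

theorem PhO_eq (D : Dat ι) (W : HWD ι) (ε : ℤ) (hε : ε = 1 ∨ ε = -1) (i : ι) (k : ℕ) :
    PhO D W ε i k = KO D W ε i * expC ((ε : ℂ) * D.ka i) (fun s : ℕ => HO D W i (ε * s)) k := by
  apply lin_ext
  intro w
  induction w generalizing k with
  | nil =>
    rw [PhO, Phi_nil, Module.End.mul_apply, expH_nil, map_smul, KO, Kop_nil, smul_smul, gam, mul_comm]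
  | cons x w ih =>
    obtain ⟨j, n⟩ := x
    rw [← Xm_wd, ← Module.End.mul_apply, ← Module.End.mul_apply, mul_assoc, expH_Xm, PhO, Phi_Xm,
      Finset.Nat.sum_antidiagonal_eq_sum_range_succ_mk, Finset.mul_sum, LinearMap.sum_apply,
      LinearMap.sum_apply]
    refine Finset.sum_congr rfl fun a ha => ?_
    have := ih (k - a)
    rw [PhO] at this
    simp only [LinearMap.smul_apply, Module.End.mul_apply, this, ← dco_gco D i j ε hε]
    rw [mul_comm, mul_smul, map_smul]
    congr 1
    have h2 := congrArg (fun A => A (expC ((ε : ℂ) * D.ka i) (fun s : ℕ => HO D W i (ε * s)) (k - a) (wd w)))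
      (Kop_Xm D (W.ke i ^ ε) ε i j (n + ε * a))
    simpa [KO] using h2.symm

theorem H_PhO (D : Dat ι) (W : HWD ι) (ε : ℤ) (hε : ε = 1 ∨ ε = -1) (i j : ι) (s : ℤ) (k : ℕ) :
    HO D W j s * PhO D W ε i k = PhO D W ε i k * HO D W j s := by
  rw [PhO_eq D W ε hε]
  refine (Commute.mul_right ?_ ?_ : Commute _ _).eq
  · exact (KH_comm _ _ _ _ _ _ _).symm
  · apply expC_commute
    intro r
    exact HH_comm _ _ _ _ _ _ _

theorem K_PhO (D : Dat ι) (W : HWD ι) (ε δ : ℤ) (hε : ε = 1 ∨ ε = -1) (i j : ι) (k : ℕ) :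
    KO D W δ j * PhO D W ε i k = PhO D W ε i k * KO D W δ j := by
  rw [PhO_eq D W ε hε]
  refine (Commute.mul_right ?_ ?_ : Commute _ _).eq
  · exact (KK_comm _ _ _ _ _ _ _)
  · apply expC_commute
    intro r
    exact KH_comm _ _ _ _ _ _ _

theorem H_phZ (D : Dat ι) (W : HWD ι) (i j : ι) (s n : ℤ) :
    HO D W j s * phZ D (gam D W) i n = phZ D (gam D W) i n * HO D W j s := by
  have h1 := H_PhO D W 1 (Or.inl rfl) i j s n.toNat
  have h2 := H_PhO D W (-1) (Or.inr rfl) i j s (-n).toNat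
  simp only [PhO] at h1 h2
  replace h1 := fun v => congrArg (fun A => A v) h1
  replace h2 := fun v => congrArg (fun A => A v) h2
  simp only [Module.End.mul_apply] at h1 h2
  refine LinearMap.ext fun v => ?_
  unfold phZ
  simp only [Module.End.mul_apply, LinearMap.sub_apply, map_sub]
  congr 1
  · split_ifs <;> simp [h1]
  · split_ifs <;> simp [h2]

theorem K_phZ (D : Dat ι) (W : HWD ι) (δ : ℤ) (i j : ι) (n : ℤ) :
    KO D W δ j * phZ D (gam D W) i n = phZ D (gam D W) i n * KO D W δ j := by
  have h1 := K_PhO D W 1 δ (Or.inl rfl) i j n.toNat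
  have h2 := K_PhO D W (-1) δ (Or.inr rfl) i j (-n).toNat
  simp only [PhO] at h1 h2
  replace h1 := fun v => congrArg (fun A => A v) h1
  replace h2 := fun v => congrArg (fun A => A v) h2
  simp only [Module.End.mul_apply] at h1 h2
  refine LinearMap.ext fun v => ?_
  unfold phZ
  simp only [Module.End.mul_apply, LinearMap.sub_apply, map_sub]
  congr 1
  · split_ifs <;> simp [h1]
  · split_ifs <;> simp [h2]

variable [DecidableEq ι]

def XO (D : Dat ι) (W : HWD ι) (i : ι) (m : ℤ) : Module.End ℂ (TT ι) := Xp D (gam D W) i m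

theorem XO_Xm_apply (D : Dat ι) (γ : ℤ → ι → ℕ → ℂ) (i j : ι) (m n : ℤ) (v : TT ι) :
    Xp D γ i m (Xm j n v) = D.sg i j • Xm j n (Xp D γ i m v) +
      if i = j then (D.ka i)⁻¹ • phZ D γ i (m + n) v else 0 := by
  have := congrArg (fun A => A v) (Xp_Xm D γ i m j n)
  simp only [Module.End.mul_apply, LinearMap.add_apply, LinearMap.smul_apply] at this
  rw [this]
  split_ifs <;> simp

theorem Hop_Xm_apply (D : Dat ι) (η : ℂ) (i : ι) (s : ℤ) (j : ι) (n : ℤ) (v : TT ι) :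
    Hop D η i s (Xm j n v) = Xm j n (Hop D η i s v) + dco D i j s • Xm j (n + s) v :=
  congrArg (fun A => A v) (Hop_Xm D η i s j n)

theorem Kop_Xm_apply (D : Dat ι) (η : ℂ) (ε : ℤ) (i : ι) (j : ι) (n : ℤ) (v : TT ι) :
    Kop D η ε i (Xm j n v) = (D.pr i j ^ ε) • Xm j n (Kop D η ε i v)  :=
  congrArg (fun A => A v) (Kop_Xm D η ε i j n)

theorem HO_XO (D : Dat ι) (W : HWD ι) (i j : ι) (s m : ℤ) :
    XO D W j m * HO D W i s = HO D W i s * XO D W j m + dco D i j s • XO D W j (m + s) := by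
  apply end_ext_Xm
  · simp [HO, XO, Hop_nil, Xp_nil]
  · intro k n w ih
    have hz := congrArg (fun A => A (wd w)) (H_phZ D W j i s (m + n))
    simp only [LinearMap.add_apply, LinearMap.smul_apply, Module.End.mul_apply] at ih hz ⊢
    simp only [HO, XO] at ih hz ⊢
    simp only [Hop_Xm_apply, XO_Xm_apply, map_add, map_smul, ih, smul_add]
    by_cases h : j = k
    · subst h
      simp only [if_true, map_smul, ← hz, smul_add, add_right_comm m s n, add_assoc m n s]
      module
    · simp only [h, if_false, map_zero, smul_zero]
      module

theorem KO_XO (D : Dat ι) (W : HWD ι) (ε : ℤ) (i j : ι) (m : ℤ) :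
    XO D W j m * KO D W ε i = D.pr i j ^ ε • (KO D W ε i * XO D W j m) := by
  apply end_ext_Xm
  · simp [KO, XO, Kop_nil, Xp_nil]
  · intro k n w ih
    have hz := congrArg (fun A => A (wd w)) (K_phZ D W ε j i (m + n))
    simp only [LinearMap.add_apply, LinearMap.smul_apply, Module.End.mul_apply] at ih hz ⊢
    simp only [KO, XO] at ih hz ⊢
    simp only [Kop_Xm_apply, XO_Xm_apply, map_add, map_smul, ih, smul_add]
    by_cases h : j = k
    · subst h
      simp only [if_true, map_smul, ← hz]
    · simp only [h, if_false, map_zero, smul_zero, add_zero]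
      module

theorem XO_PhO (D : Dat ι) (W : HWD ι) (ε : ℤ) (hε : ε = 1 ∨ ε = -1) (i j : ι) (n : ℤ) (k : ℕ) :
    XO D W j n * PhO D W ε i k = ∑ a ∈ range (k + 1),
      gco (D.pr i j ^ ε) a • (PhO D W ε i (k - a) * XO D W j (n + ε * a)) := by
  rw [PhO_eq D W ε hε, ← mul_assoc, KO_XO, smul_mul_assoc, mul_assoc,
    exch_right ((ε : ℂ) * D.ka i) ε (fun s : ℕ => HO D W i (ε * s)) (fun n => XO D W j n)
      (fun s r => by
        show HO D W i _ * HO D W i _ = _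
        exact HH_comm D _ _ i i (ε * s) (ε * r)) (fun s => dco D i j (ε * s))
      (fun s n => by simp only [HO_XO]) k n,
    Finset.Nat.sum_antidiagonal_eq_sum_range_succ_mk, Finset.mul_sum, Finset.smul_sum]
  refine Finset.sum_congr rfl fun a ha => ?_
  rw [mul_smul_comm, smul_smul, dco_gco D i j ε hε, PhO_eq D W ε hε, mul_assoc]

end QW
end

noncomputable section
namespace QW
set_option linter.unusedSectionVars false
set_option linter.unusedSimpArgs false
open Finset

variable {ι : Type} [DecidableEq ι] (D : Dat ι)
variable {K : Type} [Field K] [Algebra ℂ K] (u : ℕ → K) (col : ℕ → ι)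

/-- the rational factor -/
def gq (p x y : K) : K := (p * x - y) / (x - p * y)

def zt (a b : ℕ) : K :=
  if a = b then 0 else
    if b < a then gq (algebraMap ℂ K (D.pr (col a) (col b))) (u a) (u b)
    else algebraMap ℂ K (D.sg (col a) (col b))

def Generic (A : Finset ℕ) : Prop :=
  (∀ a ∈ A, u a ≠ 0) ∧
    ∀ a ∈ A, ∀ b ∈ A, a ≠ b → u a - algebraMap ℂ K (D.pr (col a) (col b)) * u b ≠ 0

theorem Generic.mono {A B : Finset ℕ} (h : Generic D u col A) (hB : B ⊆ A) : Generic D u col B :=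
  ⟨fun a ha => h.1 a (hB ha), fun a ha b hb => h.2 a (hB ha) b (hB hb)⟩

theorem zt_swap {A : Finset ℕ} (h : Generic D u col A) {a b : ℕ} (ha : a ∈ A) (hb : b ∈ A)
    (hab : a ≠ b) : zt D u col a b = algebraMap ℂ K (D.sg (col a) (col b)) *
      gq (algebraMap ℂ K (D.pr (col a) (col b))) (u a) (u b) * zt D u col b a := by
  have h1 := h.2 a ha b hb hab
  have h2 := h.2 b hb a ha hab.symm
  have hs : algebraMap ℂ K (D.sg (col a) (col b)) * algebraMap ℂ K (D.sg (col a) (col b)) = 1 := by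
    rw [← map_mul, D.sg_sq, map_one]
  rw [D.pr_symm] at h2
  unfold zt
  rw [if_neg hab, if_neg hab.symm]
  rcases lt_or_gt_of_ne hab with h | h
  · rw [if_neg (by omega), if_pos h, D.pr_symm (col b)]
    unfold gq
    set p := algebraMap ℂ K (D.pr (col a) (col b))
    set s := algebraMap ℂ K (D.sg (col a) (col b))
    have : (p * u a - u b) / (u a - p * u b) * ((p * u b - u a) / (u b - p * u a)) = 1 := by
      field_simp; ring
    rw [mul_assoc, this, mul_one]
  · rw [if_pos h, if_neg (by omega), D.sg_symm (col b)]
    rw [mul_right_comm, hs, one_mul]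

def Fop (j : ι) (n : ℤ) : Module.End ℂ (Finset ℕ → K) where
  toFun F A := ∑ a ∈ A, if col a = j then
    u a ^ n * (∏ b ∈ A.erase a, zt D u col a b) * F (A.erase a) else 0
  map_add' F G := by
    funext A
    simp only [Pi.add_apply, ← Finset.sum_add_distrib]
    refine Finset.sum_congr rfl fun a _ => ?_
    split_ifs <;> ring
  map_smul' c F := by
    funext A
    simp only [Pi.smul_apply, Finset.smul_sum, RingHom.id_apply]
    refine Finset.sum_congr rfl fun a _ => ?_
    split_ifs <;> simp

theorem Fop_apply (j : ι) (n : ℤ) (F : Finset ℕ → K) (A : Finset ℕ) :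
    Fop D u col j n F A = ∑ a ∈ A, if col a = j then
    u a ^ n * (∏ b ∈ A.erase a, zt D u col a b) * F (A.erase a) else 0 := rfl

def Psw : Wd ι → (Finset ℕ → K)
  | [] => fun A => if A = ∅ then 1 else 0
  | (j, n) :: w => Fop D u col j n (Psw w)

def Psi : TT ι →ₗ[ℂ] (Finset ℕ → K) := lin (Psw D u col)

theorem Psi_nil (A : Finset ℕ) : Psi D u col (wd []) A = if A = ∅ then 1 else 0 := by
  simp [Psi, Psw]

theorem Psi_Xm (j : ι) (n : ℤ) (x : TT ι) :
    Psi D u col (Xm j n x) = Fop D u col j n (Psi D u col x) := by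
  have : Psi D u col ∘ₗ Xm j n = Fop D u col j n ∘ₗ Psi D u col := by
    apply lin_ext; intro w; simp [Psi, Psw]
  exact congrArg (fun A => A x) this

/-! expansion of words -/
def FL (F : Finset ℕ → K) : List (ι × ℤ) → (Finset ℕ → K)
  | [] => F
  | x :: l => Fop D u col x.1 x.2 (FL F l)

def ee (x : ι × ℤ) (a : ℕ) : K := if col a = x.1 then u a ^ x.2 else 0

def Cst (F : Finset ℕ → K) (A s : Finset ℕ) : K :=
  (∏ x ∈ s, ∏ r ∈ A \ s, zt D u col x r) * F (A \ s)

def Full (F : Finset ℕ → K) (A : Finset ℕ) : List (ι × ℤ) → List ℕ → K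
  | [], B => Cst D u col F A B.toFinset
  | x :: l, B => ∑ a ∈ A, ee u col x a * (B.map (fun b => zt D u col b a)).prod * Full F A l (a :: B)

theorem zt_self (a : ℕ) : zt D u col a a = 0 := by simp [zt]

theorem Full_eq (F : Finset ℕ → K) (A : Finset ℕ) (l : List (ι × ℤ)) : ∀ (B : List ℕ),
    B.Nodup → B.toFinset ⊆ A → Cst D u col (FL D u col F l) A B.toFinset = Full D u col F A l B := by
  induction l with
  | nil => intro B _ _; rfl
  | cons x l ih =>
    intro B hB hBA
    rw [Full]
    have h1 : ∑ a ∈ A, ee u col x a * (B.map (fun b => zt D u col b a)).prod * Full D u col F A l (a :: B)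
      = ∑ a ∈ A \ B.toFinset, ee u col x a * (B.map (fun b => zt D u col b a)).prod *
          Full D u col F A l (a :: B) := by
      symm
      apply Finset.sum_subset (Finset.sdiff_subset)
      intro a ha hn
      have haB : a ∈ B := by simpa [ha] using hn
      have : (B.map (fun b => zt D u col b a)).prod = 0 := by
        apply List.prod_eq_zero
        rw [List.mem_map]
        exact ⟨a, haB, zt_self D u col a⟩
      rw [this]; ring
    rw [h1, Cst, FL, Fop_apply, Finset.mul_sum]
    refine Finset.sum_congr rfl fun a ha => ?_
    obtain ⟨haA, haB⟩ := Finset.mem_sdiff.1 ha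
    have haB' : a ∉ B := by simpa using haB
    have hnd : (a :: B).Nodup := List.nodup_cons.2 ⟨haB', hB⟩
    have hsub : (a :: B).toFinset ⊆ A := by
      rw [List.toFinset_cons]; exact Finset.insert_subset haA hBA
    rw [← ih (a :: B) hnd hsub, Cst, List.toFinset_cons]
    have hs : A \ insert a B.toFinset = (A \ B.toFinset).erase a := by
      ext y; simp [not_or]; tauto
    rw [hs, Finset.prod_insert haB, ee, ← List.prod_toFinset _ hB]
    split_ifs with hc
    · have h3 : ∏ x ∈ B.toFinset, ∏ r ∈ A \ B.toFinset, zt D u col x r =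
          (∏ x ∈ B.toFinset, zt D u col x a) *
            ∏ x ∈ B.toFinset, ∏ r ∈ (A \ B.toFinset).erase a, zt D u col x r := by
        rw [← Finset.prod_mul_distrib]
        refine Finset.prod_congr rfl fun y _ => ?_
        rw [Finset.mul_prod_erase _ _ ha]
      rw [h3]; ring
    · ring

theorem FL_eq (F : Finset ℕ → K) (A : Finset ℕ) (l : List (ι × ℤ)) :
    FL D u col F l A = Full D u col F A l [] := by
  rw [← Full_eq D u col F A l [] List.nodup_nil (by simp)]
  simp [Cst]

theorem expand2 (F : Finset ℕ → K) (A : Finset ℕ) (x y : ι × ℤ) :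
    FL D u col F [x, y] A = ∑ a ∈ A, ∑ b ∈ A, ee u col x a * ee u col y b *
      zt D u col a b * Cst D u col F A {a, b} := by
  rw [FL_eq]
  simp only [Full, Finset.mul_sum, List.map_cons, List.map_nil, List.prod_cons, List.prod_nil]
  refine Finset.sum_congr rfl fun a _ => Finset.sum_congr rfl fun b _ => ?_
  rw [show ([b, a] : List ℕ).toFinset = {a, b} by ext; simp; tauto]
  ring

theorem expand3 (F : Finset ℕ → K) (A : Finset ℕ) (x y z : ι × ℤ) :
    FL D u col F [x, y, z] A = ∑ a ∈ A, ∑ b ∈ A, ∑ c ∈ A, ee u col x a * ee u col y b * ee u col z c *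
      (zt D u col a b * zt D u col a c * zt D u col b c) * Cst D u col F A {a, b, c} := by
  rw [FL_eq]
  simp only [Full, Finset.mul_sum, List.map_cons, List.map_nil, List.prod_cons, List.prod_nil]
  refine Finset.sum_congr rfl fun a _ => Finset.sum_congr rfl fun b _ =>
    Finset.sum_congr rfl fun c _ => ?_
  rw [show ([c, b, a] : List ℕ).toFinset = {a, b, c} by ext; simp; tauto]
  ring

theorem expand4 (F : Finset ℕ → K) (A : Finset ℕ) (x y z w : ι × ℤ) :
    FL D u col F [x, y, z, w] A = ∑ a ∈ A, ∑ b ∈ A, ∑ c ∈ A, ∑ d ∈ A,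
      ee u col x a * ee u col y b * ee u col z c * ee u col w d *
      (zt D u col a b * zt D u col a c * zt D u col a d * zt D u col b c * zt D u col b d *
        zt D u col c d) * Cst D u col F A {a, b, c, d} := by
  rw [FL_eq]
  simp only [Full, Finset.mul_sum, List.map_cons, List.map_nil, List.prod_cons, List.prod_nil]
  refine Finset.sum_congr rfl fun a _ => Finset.sum_congr rfl fun b _ =>
    Finset.sum_congr rfl fun c _ => Finset.sum_congr rfl fun d _ => ?_
  rw [show ([d, c, b, a] : List ℕ).toFinset = {a, b, c, d} by ext; simp; tauto]
  ring

end QW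
end

noncomputable section
namespace QW
set_option linter.unusedSectionVars false
set_option linter.unusedSimpArgs false
open Finset

variable {ι : Type} [DecidableEq ι] (D : Dat ι)
variable {K : Type} [Field K] [Algebra ℂ K] (u : ℕ → K) (col : ℕ → ι)

theorem ee_mul_congr {x : ι × ℤ} {a : ℕ} {s t : K} (h : col a = x.1 → s = t) :
    ee u col x a * s = ee u col x a * t := by
  unfold ee
  split_ifs with hc
  · rw [h hc]
  · ring

theorem quad0 {A : Finset ℕ} (hG : Generic D u col A) (F : Finset ℕ → K) (i j : ι) (m n : ℤ)
    (hp : D.pr i j = 1) :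
    FL D u col F [(i, m), (j, n)] A = algebraMap ℂ K (D.sg i j) * FL D u col F [(j, n), (i, m)] A := by
  rw [expand2, expand2, Finset.sum_comm (s := A) (t := A) (f := fun a b => ee u col (j, n) a * _ * _ * _),
    Finset.mul_sum]
  refine Finset.sum_congr rfl fun a ha => ?_
  rw [Finset.mul_sum]
  refine Finset.sum_congr rfl fun b hb => ?_
  by_cases hab : a = b
  · subst hab; simp [zt_self]
  have hset : ({b, a} : Finset ℕ) = {a, b} := Finset.pair_comm _ _
  rw [hset]
  have key : ee u col (i, m) a * (ee u col (j, n) b * zt D u col a b) =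
      ee u col (i, m) a * (ee u col (j, n) b * (algebraMap ℂ K (D.sg i j) * zt D u col b a)) := by
    refine ee_mul_congr u col fun hi => ?_
    refine ee_mul_congr u col fun hj => ?_
    simp only at hi hj
    have h2 := hG.2 a ha b hb hab
    rw [zt_swap D u col hG ha hb hab, hi, hj, hp]
    rw [hi, hj, hp] at h2
    simp only [map_one, one_mul] at h2
    simp [gq, div_self h2]
  linear_combination Cst D u col F A {a, b} * key

theorem quad1 {A : Finset ℕ} (hG : Generic D u col A) (F : Finset ℕ → K) (i j : ι) (m n : ℤ)
    (hs : D.sg i j = 1) :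
    FL D u col F [(i, m + 1), (j, n)] A - algebraMap ℂ K (D.pr i j) * FL D u col F [(j, n), (i, m + 1)] A
     - algebraMap ℂ K (D.pr i j) * FL D u col F [(i, m), (j, n + 1)] A +
       FL D u col F [(j, n + 1), (i, m)] A = 0 := by
  have e : ∀ m n, FL D u col F [(j, n), (i, m)] A = ∑ a ∈ A, ∑ b ∈ A,
      ee u col (i, m) a * ee u col (j, n) b * zt D u col b a * Cst D u col F A {a, b} := by
    intro m n
    rw [expand2, Finset.sum_comm]
    refine Finset.sum_congr rfl fun a ha => Finset.sum_congr rfl fun b hb => ?_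
    rw [Finset.pair_comm]; ring
  rw [e, e, expand2, expand2]
  simp only [Finset.mul_sum, ← Finset.sum_sub_distrib, ← Finset.sum_add_distrib]
  refine Finset.sum_eq_zero fun a ha => Finset.sum_eq_zero fun b hb => ?_
  by_cases hab : a = b
  · subst hab; simp [zt_self]
  unfold ee
  by_cases hi : col a = i
  swap
  · simp [hi]
  by_cases hj : col b = j
  swap
  · simp [hj]
  simp only [hi, hj, if_true]
  have h2 := hG.2 a ha b hb hab
  rw [zt_swap D u col hG ha hb hab, hi, hj, hs]
  rw [hi, hj] at h2
  rw [zpow_add_one₀ (hG.1 a ha), zpow_add_one₀ (hG.1 b hb), gq]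
  field_simp
  simp only [map_one]
  ring

theorem serre_id (r x y z : K) (hr : r ≠ 0) (h1 : x * r ^ 2 - y ≠ 0) (h2 : x - r * z ≠ 0)
    (h3 : y - r * z ≠ 0) (h4 : x - (r ^ 2)⁻¹ * y ≠ 0) :
    gq (r ^ 2)⁻¹ x y * gq r x z * gq r y z + gq r y z * gq r x z
     - (r + r⁻¹) * (gq (r ^ 2)⁻¹ x y * gq r x z + gq r y z) + 1 + gq (r ^ 2)⁻¹ x y = 0 := by
  have : gq (r ^ 2)⁻¹ x y = (x - r ^ 2 * y) / (x * r ^ 2 - y) := by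
    unfold gq
    rw [div_eq_div_iff h4 h1]
    field_simp
  rw [this]
  unfold gq
  field_simp
  ring

def S3 (A : Finset ℕ) (T : ℕ → ℕ → ℕ → K) : K := ∑ a ∈ A, ∑ b ∈ A, ∑ c ∈ A, T a b c
theorem S3_1 (A : Finset ℕ) (T : ℕ → ℕ → ℕ → K) : S3 A T = S3 A (fun a b c => T b a c) := by
  unfold S3; rw [Finset.sum_comm]
theorem S3_2 (A : Finset ℕ) (T : ℕ → ℕ → ℕ → K) : S3 A T = S3 A (fun a b c => T a c b) := by
  unfold S3; refine Finset.sum_congr rfl fun a _ => ?_; rw [Finset.sum_comm]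

def G3 (F : Finset ℕ → K) (A : Finset ℕ) (x y z : ι × ℤ) (a b c : ℕ) : K :=
  ee u col x a * ee u col y b * ee u col z c *
      (zt D u col a b * zt D u col a c * zt D u col b c) * Cst D u col F A {a, b, c}

theorem expand3' (F : Finset ℕ → K) (A : Finset ℕ) (x y z : ι × ℤ) :
    FL D u col F [x, y, z] A = S3 A (G3 D u col F A x y z) := expand3 D u col F A x y z

theorem serre0 {A : Finset ℕ} (hG : Generic D u col A) (F : Finset ℕ → K) (i j : ι) (m n k : ℤ)
    (hs : D.sg i j = 1) (hsi : D.sg i i = 1) (hp : D.pr i i = (D.pr i j ^ 2)⁻¹) :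
    FL D u col F [(i, m), (i, n), (j, k)] A + FL D u col F [(i, n), (i, m), (j, k)] A
     - algebraMap ℂ K (D.pr i j + (D.pr i j)⁻¹) *
      (FL D u col F [(i, m), (j, k), (i, n)] A + FL D u col F [(i, n), (j, k), (i, m)] A)
     + FL D u col F [(j, k), (i, n), (i, m)] A + FL D u col F [(j, k), (i, m), (i, n)] A = 0 := by
  rw [expand3', expand3', expand3', expand3', expand3', expand3']
  rw [S3_1 A (G3 D u col F A (i, n) (i, m) (j, k)), S3_2 A (G3 D u col F A (i, m) (j, k) (i, n)),
    S3_2 A (G3 D u col F A (i, n) (j, k) (i, m)), S3_1 A (fun a b c => G3 D u col F A (i, n) (j, k) (i, m) a c b),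
    S3_1 A (G3 D u col F A (j, k) (i, n) (i, m)), S3_2 A (fun a b c => G3 D u col F A (j, k) (i, n) (i, m) b a c),
    S3_1 A (fun a b c => G3 D u col F A (j, k) (i, n) (i, m) c a b),
    S3_1 A (G3 D u col F A (j, k) (i, m) (i, n)), S3_2 A (fun a b c => G3 D u col F A (j, k) (i, m) (i, n) b a c)]
  unfold S3
  simp only [mul_add, Finset.mul_sum, ← Finset.sum_sub_distrib, ← Finset.sum_add_distrib]
  refine Finset.sum_eq_zero fun a ha => Finset.sum_eq_zero fun b hb => Finset.sum_eq_zero fun c hc => ?_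
  unfold G3
  have s1 : ({b, a, c} : Finset ℕ) = {a, b, c} := by ext; simp; tauto
  have s2 : ({a, c, b} : Finset ℕ) = {a, b, c} := by ext; simp; tauto
  have s3 : ({c, a, b} : Finset ℕ) = {a, b, c} := by ext; simp; tauto
  have s4 : ({c, b, a} : Finset ℕ) = {a, b, c} := by ext; simp; tauto
  have s5 : ({b, c, a} : Finset ℕ) = {a, b, c} := by ext; simp; tauto
  simp only [s1, s2, s3, s4, s5]
  by_cases hab : a = b
  · subst hab; simp [zt_self]
  by_cases hac : a = c
  · subst hac; simp [zt_self]
  by_cases hbc : b = c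
  · subst hbc; simp [zt_self]
  unfold ee
  by_cases hia : col a = i
  swap
  · simp [hia]
  by_cases hib : col b = i
  swap
  · simp [hib]
  by_cases hjc : col c = j
  swap
  · simp [hjc]
  simp only [hia, hib, hjc, if_true]
  have h1 := hG.2 b hb a ha (Ne.symm hab)
  have h2 := hG.2 a ha c hc hac
  have h3 := hG.2 b hb c hc hbc
  have h4 := hG.2 a ha b hb hab
  rw [zt_swap D u col hG ha hb hab, zt_swap D u col hG ha hc hac, zt_swap D u col hG hb hc hbc]
  rw [hia, hib, hp] at h1 h4
  rw [hia, hjc] at h2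
  rw [hib, hjc] at h3
  rw [hia, hib, hjc, hs, hsi, hp]
  have hr : algebraMap ℂ K (D.pr i j) ≠ 0 := by simpa using D.pr_ne i j
  simp only [map_inv₀, map_pow, map_add, map_one, one_mul] at h1 h2 h3 h4 ⊢
  have h1' : u a * algebraMap ℂ K (D.pr i j) ^ 2 - u b ≠ 0 := by
    intro hh
    apply h4
    rw [← sub_eq_zero.1 hh]; field_simp; ring
  have key := serre_id (algebraMap ℂ K (D.pr i j)) (u a) (u b) (u c) hr h1' h2 h3 h4
  linear_combination u a ^ m * u b ^ n * u c ^ k * zt D u col b a * zt D u col c a * zt D u col c b *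
    Cst D u col F A {a, b, c} * key

def S4 (A : Finset ℕ) (T : ℕ → ℕ → ℕ → ℕ → K) : K := ∑ a ∈ A, ∑ b ∈ A, ∑ c ∈ A, ∑ d ∈ A, T a b c d
theorem S4_1 (A : Finset ℕ) (T : ℕ → ℕ → ℕ → ℕ → K) : S4 A T = S4 A (fun a b c d => T b a c d) := by
  unfold S4; rw [Finset.sum_comm]
theorem S4_2 (A : Finset ℕ) (T : ℕ → ℕ → ℕ → ℕ → K) : S4 A T = S4 A (fun a b c d => T a c b d) := by
  unfold S4; refine Finset.sum_congr rfl fun a _ => ?_; rw [Finset.sum_comm]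
theorem S4_3 (A : Finset ℕ) (T : ℕ → ℕ → ℕ → ℕ → K) : S4 A T = S4 A (fun a b c d => T a b d c) := by
  unfold S4; refine Finset.sum_congr rfl fun a _ => Finset.sum_congr rfl fun a _ => ?_; rw [Finset.sum_comm]

def G4 (F : Finset ℕ → K) (A : Finset ℕ) (x y z w : ι × ℤ) (a b c d : ℕ) : K :=
  ee u col x a * ee u col y b * ee u col z c * ee u col w d *
      (zt D u col a b * zt D u col a c * zt D u col a d * zt D u col b c * zt D u col b d *
        zt D u col c d) * Cst D u col F A {a, b, c, d}

theorem expand4' (F : Finset ℕ → K) (A : Finset ℕ) (x y z w : ι × ℤ) :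
    FL D u col F [x, y, z, w] A = S4 A (G4 D u col F A x y z w) := expand4 D u col F A x y z w

/-- the oscillation identity. -/
theorem osc_id (p x y z w : K) (hp : p ≠ 0) (h1 : y - p * x ≠ 0) (h2 : w - p * x ≠ 0)
    (h3 : z - p⁻¹ * y ≠ 0) (h4 : w - p⁻¹ * z ≠ 0) (A B C E : K)
    (eA : A = gq p y x) (eB : B = gq p w x) (eC : C = gq p⁻¹ z y) (eE : E = gq p⁻¹ w z) :
    1 - B * E - E * C + A * E + A * C - A * B * C * E - B * C + A * B =
      (p + p⁻¹) * (A - B * E * C) := by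
  have h3' : p * z - y ≠ 0 := by
    intro hh; apply h3; rw [← sub_eq_zero.1 hh]; field_simp; ring
  have h4' : p * w - z ≠ 0 := by
    intro hh; apply h4; rw [← sub_eq_zero.1 hh]; field_simp; ring
  have eC' : C = (z - p * y) / (p * z - y) := by
    rw [eC, gq, div_eq_div_iff h3 h3']; field_simp
  have eE' : E = (w - p * z) / (p * w - z) := by
    rw [eE, gq, div_eq_div_iff h4 h4']; field_simp
  rw [eC', eE', eA, eB]
  unfold gq
  field_simp
  ring

theorem S4_2134 (A : Finset ℕ) (T : ℕ → ℕ → ℕ → ℕ → K) : S4 A T = S4 A (fun a b c d => T b a c d) := by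
  rw [S4_1 A T]
theorem S4_3124 (A : Finset ℕ) (T : ℕ → ℕ → ℕ → ℕ → K) : S4 A T = S4 A (fun a b c d => T c a b d) := by
  rw [S4_1 A T, S4_2 A]
theorem S4_3214 (A : Finset ℕ) (T : ℕ → ℕ → ℕ → ℕ → K) : S4 A T = S4 A (fun a b c d => T c b a d) := by
  rw [S4_2 A T, S4_1 A, S4_2 A]
theorem S4_4123 (A : Finset ℕ) (T : ℕ → ℕ → ℕ → ℕ → K) : S4 A T = S4 A (fun a b c d => T d a b c) := by
  rw [S4_1 A T, S4_2 A, S4_3 A]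
theorem S4_4213 (A : Finset ℕ) (T : ℕ → ℕ → ℕ → ℕ → K) : S4 A T = S4 A (fun a b c d => T d b a c) := by
  rw [S4_2 A T, S4_1 A, S4_2 A, S4_3 A]
theorem S4_4312 (A : Finset ℕ) (T : ℕ → ℕ → ℕ → ℕ → K) : S4 A T = S4 A (fun a b c d => T d c a b) := by
  rw [S4_2 A T, S4_1 A, S4_3 A, S4_2 A, S4_3 A]
theorem S4_4321 (A : Finset ℕ) (T : ℕ → ℕ → ℕ → ℕ → K) : S4 A T = S4 A (fun a b c d => T d c b a) := by
  rw [S4_2 A T, S4_1 A, S4_3 A, S4_2 A, S4_3 A, S4_1 A]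
theorem S4_1432 (A : Finset ℕ) (T : ℕ → ℕ → ℕ → ℕ → K) : S4 A T = S4 A (fun a b c d => T a d c b) := by
  rw [S4_2 A T, S4_3 A, S4_2 A]
theorem S4_4132 (A : Finset ℕ) (T : ℕ → ℕ → ℕ → ℕ → K) : S4 A T = S4 A (fun a b c d => T d a c b) := by
  rw [S4_1 A T, S4_3 A, S4_2 A, S4_3 A]
theorem S4_3142 (A : Finset ℕ) (T : ℕ → ℕ → ℕ → ℕ → K) : S4 A T = S4 A (fun a b c d => T c a d b) := by
  rw [S4_1 A T, S4_3 A, S4_2 A]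
theorem S4_3412 (A : Finset ℕ) (T : ℕ → ℕ → ℕ → ℕ → K) : S4 A T = S4 A (fun a b c d => T c d a b) := by
  rw [S4_2 A T, S4_1 A, S4_3 A, S4_2 A]
theorem S4_2143 (A : Finset ℕ) (T : ℕ → ℕ → ℕ → ℕ → K) : S4 A T = S4 A (fun a b c d => T b a d c) := by
  rw [S4_1 A T, S4_3 A]
theorem S4_2413 (A : Finset ℕ) (T : ℕ → ℕ → ℕ → ℕ → K) : S4 A T = S4 A (fun a b c d => T b d a c) := by
  rw [S4_2 A T, S4_1 A, S4_3 A]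
theorem S4_2314 (A : Finset ℕ) (T : ℕ → ℕ → ℕ → ℕ → K) : S4 A T = S4 A (fun a b c d => T b c a d) := by
  rw [S4_2 A T, S4_1 A]
theorem S4_2341 (A : Finset ℕ) (T : ℕ → ℕ → ℕ → ℕ → K) : S4 A T = S4 A (fun a b c d => T b c d a) := by
  rw [S4_3 A T, S4_2 A, S4_1 A]

theorem osc0 {A : Finset ℕ} (hG : Generic D u col A) (F : Finset ℕ → K) (i j k : ι) (m n l o : ℤ)
    (al be : K) (hp13 : D.pr i k = 1) (hp23 : D.pr j k = (D.pr i j)⁻¹)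
    (hp24 : D.pr j j = 1) (hs12 : D.sg i j = 1) (hs13 : D.sg i k = 1) (hs23 : D.sg j k = 1)
    (hs24 : D.sg j j = -1)
    (hab : al + be = algebraMap ℂ K (D.pr i j + (D.pr i j)⁻¹)) (X1 X2 X3 X4 : ι × ℤ)
    (e1 : X1 = (i, m)) (e2 : X2 = (j, n)) (e3 : X3 = (k, l)) (e4 : X4 = (j, o)) :
    FL D u col F [X1, X2, X3, X4] A
    - al * FL D u col F [X2, X1, X3, X4] A
    - be * FL D u col F [X3, X1, X2, X4] A
    + FL D u col F [X3, X2, X1, X4] A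
    + FL D u col F [X4, X1, X2, X3] A
    - al * FL D u col F [X4, X2, X1, X3] A
    - be * FL D u col F [X4, X3, X1, X2] A
    + FL D u col F [X4, X3, X2, X1] A
    + FL D u col F [X1, X4, X3, X2] A
    - al * FL D u col F [X4, X1, X3, X2] A
    - be * FL D u col F [X3, X1, X4, X2] A
    + FL D u col F [X3, X4, X1, X2] A
    + FL D u col F [X2, X1, X4, X3] A
    - al * FL D u col F [X2, X4, X1, X3] A
    - be * FL D u col F [X2, X3, X1, X4] A
    + FL D u col F [X2, X3, X4, X1] A = 0 := by
  simp only [expand4']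
  rw [S4_2134 A (G4 D u col F A X2 X1 X3 X4),
    S4_3124 A (G4 D u col F A X3 X1 X2 X4),
    S4_3214 A (G4 D u col F A X3 X2 X1 X4),
    S4_4123 A (G4 D u col F A X4 X1 X2 X3),
    S4_4213 A (G4 D u col F A X4 X2 X1 X3),
    S4_4312 A (G4 D u col F A X4 X3 X1 X2),
    S4_4321 A (G4 D u col F A X4 X3 X2 X1),
    S4_1432 A (G4 D u col F A X1 X4 X3 X2),
    S4_4132 A (G4 D u col F A X4 X1 X3 X2),
    S4_3142 A (G4 D u col F A X3 X1 X4 X2),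
    S4_3412 A (G4 D u col F A X3 X4 X1 X2),
    S4_2143 A (G4 D u col F A X2 X1 X4 X3),
    S4_2413 A (G4 D u col F A X2 X4 X1 X3),
    S4_2314 A (G4 D u col F A X2 X3 X1 X4),
    S4_2341 A (G4 D u col F A X2 X3 X4 X1)]
  unfold S4
  simp only [Finset.mul_sum, ← Finset.sum_sub_distrib, ← Finset.sum_add_distrib]
  refine Finset.sum_eq_zero fun a ha => Finset.sum_eq_zero fun b hb =>
    Finset.sum_eq_zero fun c hc => Finset.sum_eq_zero fun d hd => ?_
  unfold G4
  have s2134 : ({b, a, c, d} : Finset ℕ) = {a, b, c, d} := by ext; simp; tauto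
  have s3124 : ({c, a, b, d} : Finset ℕ) = {a, b, c, d} := by ext; simp; tauto
  have s3214 : ({c, b, a, d} : Finset ℕ) = {a, b, c, d} := by ext; simp; tauto
  have s4123 : ({d, a, b, c} : Finset ℕ) = {a, b, c, d} := by ext; simp; tauto
  have s4213 : ({d, b, a, c} : Finset ℕ) = {a, b, c, d} := by ext; simp; tauto
  have s4312 : ({d, c, a, b} : Finset ℕ) = {a, b, c, d} := by ext; simp; tauto
  have s4321 : ({d, c, b, a} : Finset ℕ) = {a, b, c, d} := by ext; simp; tauto
  have s1432 : ({a, d, c, b} : Finset ℕ) = {a, b, c, d} := by ext; simp; tauto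
  have s4132 : ({d, a, c, b} : Finset ℕ) = {a, b, c, d} := by ext; simp; tauto
  have s3142 : ({c, a, d, b} : Finset ℕ) = {a, b, c, d} := by ext; simp; tauto
  have s3412 : ({c, d, a, b} : Finset ℕ) = {a, b, c, d} := by ext; simp; tauto
  have s2143 : ({b, a, d, c} : Finset ℕ) = {a, b, c, d} := by ext; simp; tauto
  have s2413 : ({b, d, a, c} : Finset ℕ) = {a, b, c, d} := by ext; simp; tauto
  have s2314 : ({b, c, a, d} : Finset ℕ) = {a, b, c, d} := by ext; simp; tauto
  have s2341 : ({b, c, d, a} : Finset ℕ) = {a, b, c, d} := by ext; simp; tauto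
  simp only [s2134, s3124, s3214, s4123, s4213, s4312, s4321, s1432, s4132, s3142, s3412, s2143, s2413, s2314, s2341]
  by_cases hlab : a = b
  · subst hlab; simp [zt_self]
  by_cases hac : a = c
  · subst hac; simp [zt_self]
  by_cases had : a = d
  · subst had; simp [zt_self]
  by_cases hbc : b = c
  · subst hbc; simp [zt_self]
  by_cases hbd : b = d
  · subst hbd; simp [zt_self]
  by_cases hcd : c = d
  · subst hcd; simp [zt_self]
  by_cases ha' : col a = i
  swap
  · have : ee u col X1 a = 0 := by subst e1 e2 e3 e4; simp [ee, ha']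
    rw [this]; ring
  by_cases hb' : col b = j
  swap
  · have : ee u col X2 b = 0 := by subst e1 e2 e3 e4; simp [ee, hb']
    rw [this]; ring
  by_cases hc' : col c = k
  swap
  · have : ee u col X3 c = 0 := by subst e1 e2 e3 e4; simp [ee, hc']
    rw [this]; ring
  by_cases hd' : col d = j
  swap
  · have : ee u col X4 d = 0 := by subst e1 e2 e3 e4; simp [ee, hd']
    rw [this]; ring
  have h1 := hG.2 b hb a ha (Ne.symm hlab)
  have h2 := hG.2 d hd a ha (Ne.symm had)
  have h3 := hG.2 c hc b hb (Ne.symm hbc)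
  have h4 := hG.2 d hd c hc (Ne.symm hcd)
  have h5 := hG.2 c hc a ha (Ne.symm hac)
  have h6 := hG.2 d hd b hb (Ne.symm hbd)
  rw [zt_swap D u col hG hb ha (Ne.symm hlab), zt_swap D u col hG hd ha (Ne.symm had),
    zt_swap D u col hG hc hb (Ne.symm hbc), zt_swap D u col hG hd hc (Ne.symm hcd),
    zt_swap D u col hG hc ha (Ne.symm hac), zt_swap D u col hG hd hb (Ne.symm hbd)]
  rw [ha', hb', D.pr_symm j i] at h1
  rw [ha', hd', D.pr_symm j i] at h2
  rw [hb', hc', D.pr_symm k j, hp23] at h3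
  rw [hc', hd', hp23] at h4
  rw [ha', hc', D.pr_symm k i, hp13] at h5
  rw [hb', hd', hp24] at h6
  rw [ha', hb', hc', hd', D.sg_symm j i, D.sg_symm k j, D.sg_symm k i, D.pr_symm j i,
    D.pr_symm k j, D.pr_symm k i, hs12, hs13, hs23, hs24, hp13, hp23, hp24]
  have hr : algebraMap ℂ K (D.pr i j) ≠ 0 := by simpa using D.pr_ne i j
  simp only [map_inv₀, map_add, map_one, map_neg, one_mul] at h1 h2 h3 h4 h5 h6 hab ⊢
  have g5 : gq (1 : K) (u c) (u a) = 1 := by simp [gq, div_self h5]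
  have g6 : gq (1 : K) (u d) (u b) = 1 := by simp [gq, div_self h6]
  rw [g5, g6]
  have key := osc_id (algebraMap ℂ K (D.pr i j)) (u a) (u b) (u c) (u d) hr h1 h2 h3 h4 _ _ _ _ rfl rfl rfl rfl
  rw [← hab] at key
  generalize gq (algebraMap ℂ K (D.pr i j)) (u b) (u a) = A' at key ⊢
  generalize gq (algebraMap ℂ K (D.pr i j)) (u d) (u a) = B' at key ⊢
  generalize gq (algebraMap ℂ K (D.pr i j))⁻¹ (u c) (u b) = C' at key ⊢
  generalize gq (algebraMap ℂ K (D.pr i j))⁻¹ (u d) (u c) = E' at key ⊢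
  linear_combination ee u col X1 a * ee u col X2 b * ee u col X3 c * ee u col X4 d *
    (zt D u col a b * zt D u col a c * zt D u col a d * zt D u col b c * zt D u col b d *
        zt D u col c d) * Cst D u col F A {a, b, c, d} * key

end QW
end

noncomputable section
namespace QW
set_option linter.unusedSectionVars false
set_option linter.unusedSimpArgs false
open Finset

variable {ι : Type} [DecidableEq ι] (D : Dat ι)

/-- the kernel of all the shuffle evaluations -/
def inI (x : TT ι) : Prop :=
  ∀ (K : Type) [Field K] [Algebra ℂ K] (u : ℕ → K) (col : ℕ → ι) (A : Finset ℕ),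
    Generic D u col A → Psi D u col x A = 0

/-! parity twist -/
def tw (j : ι) : Module.End ℂ (TT ι) := lin fun w => (w.map fun y => D.sg j y.1).prod • wd w

theorem tw_nil (j : ι) : tw D j (wd []) = wd [] := by simp [tw]

theorem tw_Xm (j k : ι) (n : ℤ) (x : TT ι) : tw D j (Xm k n x) = D.sg j k • Xm k n (tw D j x) := by
  have : tw D j * Xm k n = D.sg j k • (Xm k n * tw D j) := by
    apply lin_ext; intro w; simp [tw, mul_smul]
  exact congrArg (fun A => A x) this

section
variable {K : Type} [Field K] [Algebra ℂ K] (u : ℕ → K) (col : ℕ → ι)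

theorem smul_K (c : ℂ) (x : K) : c • x = algebraMap ℂ K c * x := Algebra.smul_def c x

theorem Psi_tw (j : ι) (x : TT ι) : ∀ A, Psi D u col (tw D j x) A =
    (∏ b ∈ A, algebraMap ℂ K (D.sg j (col b))) * Psi D u col x A := by
  induction x using TT_ind with
  | h0 => simp
  | hadd x y hx hy => intro A; simp [hx, hy, mul_add]
  | hs c w =>
    intro A
    simp only [map_smul, Pi.smul_apply, smul_K]
    rw [mul_left_comm]
    congr 1
    induction w generalizing A with
    | nil =>
      rw [tw_nil, Psi_nil]
      split_ifs with h
      · subst h; simp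
      · ring
    | cons y w ih =>
      obtain ⟨k, n⟩ := y
      rw [← Xm_wd, tw_Xm, map_smul, Pi.smul_apply, smul_K, Psi_Xm, Psi_Xm, Fop_apply, Fop_apply,
        Finset.mul_sum, Finset.mul_sum]
      refine Finset.sum_congr rfl fun a ha => ?_
      split_ifs with h
      · rw [ih, ← Finset.mul_prod_erase _ _ ha, h]; ring
      · ring

/-- the generating series of `gco` -/
def gser (p : ℂ) (v : K) : PowerSeries K := PowerSeries.mk fun a => algebraMap ℂ K (gco p a) * v ^ a

def mkb (b : ℕ → ℂ) : PowerSeries K := PowerSeries.mk fun a => algebraMap ℂ K (b a)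

theorem Psi_Phi (ε : ℤ) (i : ι) (b : ℕ → ℂ) (x : TT ι) : ∀ (k : ℕ) (A : Finset ℕ), (∀ a ∈ A, u a ≠ 0) →
    Psi D u col (Phi D ε i b k x) A =
      PowerSeries.coeff k (mkb b * ∏ c ∈ A, gser (D.pr i (col c) ^ ε) (u c ^ ε)) * Psi D u col x A := by
  induction x using TT_ind with
  | h0 => simp
  | hadd x y hx hy => intro k A hA; simp [hx k A hA, hy k A hA, mul_add]
  | hs c w =>
    intro k A hA
    simp only [map_smul, Pi.smul_apply, smul_K]
    rw [mul_left_comm]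
    congr 1
    induction w generalizing A k with
    | nil =>
      rw [Phi_nil, map_smul, Pi.smul_apply, smul_K, Psi_nil]
      split_ifs with h
      · subst h; simp [mkb]
      · ring
    | cons y w ih =>
      obtain ⟨j, n⟩ := y
      have h1 := congrArg (fun A => A (wd w)) (Phi_Xm D ε i b k j n)
      simp only [Module.End.mul_apply, LinearMap.sum_apply, LinearMap.smul_apply] at h1
      rw [← Xm_wd, h1, map_sum, Finset.sum_apply]
      simp only [map_smul, Pi.smul_apply, smul_K, Psi_Xm, Fop_apply, Finset.mul_sum]
      rw [Finset.sum_comm]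
      refine Finset.sum_congr rfl fun c hc => ?_
      by_cases h : col c = j
      swap
      · simp [h]
      simp only [h, if_true]
      rw [← Finset.mul_prod_erase A (fun c => gser (D.pr i (col c) ^ ε) (u c ^ ε)) hc, mul_left_comm (mkb b), PowerSeries.coeff_mul,
        Finset.Nat.sum_antidiagonal_eq_sum_range_succ (fun a b' => PowerSeries.coeff a
          (gser (D.pr i (col c) ^ ε) (u c ^ ε)) * PowerSeries.coeff b' (mkb b * ∏ x ∈ A.erase c,
            gser (D.pr i (col x) ^ ε) (u x ^ ε))), Finset.sum_mul]
      refine Finset.sum_congr rfl fun a _ => ?_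
      rw [ih _ _ (fun a ha => hA a (Finset.mem_of_mem_erase ha)), zpow_add₀ (hA c hc), h]
      simp only [gser, PowerSeries.coeff_mk]
      rw [zpow_mul, zpow_natCast]
      ring

theorem gser_eq (p : ℂ) (v : K) :
    (1 - PowerSeries.C (algebraMap ℂ K p * v) * PowerSeries.X) * gser p v =
      PowerSeries.C (algebraMap ℂ K p) - PowerSeries.C v * PowerSeries.X := by
  ext n
  rw [sub_mul, one_mul, map_sub, map_sub, mul_assoc, PowerSeries.coeff_C_mul]
  cases n with
  | zero => simp [gser, gco]
  | succ n =>
    rw [PowerSeries.coeff_succ_X_mul, PowerSeries.coeff_C_mul]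
    cases n with
    | zero =>
      simp [gser, gco, PowerSeries.coeff_C, PowerSeries.coeff_X, mul_assoc]
      ring
    | succ n =>
      simp [gser, gco, PowerSeries.coeff_C, PowerSeries.coeff_X]
      ring

end

/-! the derivations -/
def Dw (ε : ℤ) (j : ι) (b : ℤ) : Wd ι → TT ι
  | [] => 0
  | (k, n) :: w => D.sg j k • Xm k n (Dw ε j b w) +
      if j = k then (if 0 ≤ ε * (b + n) then Phi D ε j dl (ε * (b + n)).toNat (wd w) else 0) else 0

def Dop (ε : ℤ) (j : ι) (b : ℤ) : Module.End ℂ (TT ι) := lin (Dw D ε j b)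

theorem Dop_nil (ε : ℤ) (j : ι) (b : ℤ) : Dop D ε j b (wd []) = 0 := by simp [Dop, Dw]

theorem Dop_wd (ε : ℤ) (j : ι) (b : ℤ) (k : ι) (n : ℤ) (w : Wd ι) :
    Dop D ε j b (wd ((k, n) :: w)) = D.sg j k • Xm k n (Dop D ε j b (wd w)) +
      if j = k then (if 0 ≤ ε * (b + n) then Phi D ε j dl (ε * (b + n)).toNat (wd w) else 0) else 0 := by
  simp [Dop, Dw]

theorem Xp_Dop (γ : ℤ → ι → ℕ → ℂ) (j : ι) (m : ℤ) (x : TT ι) : ∃ N0 : ℕ, ∀ N ≥ N0,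
    Xp D γ j m x = (D.ka j)⁻¹ • (∑ n ∈ range N, γ 1 j n • Dop D 1 j (m - n) x
      - ∑ n ∈ range N, γ (-1) j n • Dop D (-1) j (m + n) x) := by
  induction x using TT_ind with
  | h0 => exact ⟨0, fun N _ => by simp⟩
  | hadd x y hx hy =>
    obtain ⟨N1, h1⟩ := hx
    obtain ⟨N2, h2⟩ := hy
    refine ⟨max N1 N2, fun N hN => ?_⟩
    rw [map_add, h1 N (le_trans (le_max_left _ _) hN), h2 N (le_trans (le_max_right _ _) hN)]
    simp only [map_add, smul_add, Finset.sum_add_distrib]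
    module
  | hs c w =>
    suffices h : ∃ N0 : ℕ, ∀ N ≥ N0, Xp D γ j m (wd w) = (D.ka j)⁻¹ • (∑ n ∈ range N, γ 1 j n • Dop D 1 j (m - n) (wd w)
      - ∑ n ∈ range N, γ (-1) j n • Dop D (-1) j (m + n) (wd w)) by
      obtain ⟨N0, h⟩ := h
      refine ⟨N0, fun N hN => ?_⟩
      rw [map_smul, h N hN]
      simp only [map_smul, smul_sub, Finset.smul_sum, smul_comm c]
    induction w with
    | nil => exact ⟨0, fun N _ => by simp [Xp_nil, Dop_nil]⟩
    | cons y w ih =>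
      obtain ⟨k, n⟩ := y
      obtain ⟨N0, h⟩ := ih
      refine ⟨max N0 ((m + n).natAbs + 1), fun N hN => ?_⟩
      have hN1 : N0 ≤ N := le_trans (le_max_left _ _) hN
      have hN2 : (m + n).natAbs + 1 ≤ N := le_trans (le_max_right _ _) hN
      rw [← Xm_wd, XO_Xm_apply, h N hN1]
      simp only [Xm_wd, Dop_wd]
      by_cases hjk : j = k
      swap
      · simp only [hjk, if_false, add_zero, map_sub, map_smul, map_sum]
        simp only [smul_comm _ (D.sg j k), ← Finset.smul_sum, ← smul_sub]
      subst hjk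
      simp only [if_true, smul_add, Finset.sum_add_distrib, add_sub_add_comm, map_sub, map_smul, map_sum]
      congr 1
      · simp only [smul_comm _ (D.sg j j), ← Finset.smul_sum, ← smul_sub]
      · congr 1
        unfold phZ
        rw [LinearMap.sub_apply]
        congr 1
        · by_cases h0 : 0 ≤ m + n
          · rw [if_pos h0, Phi_lin, LinearMap.sum_apply]
            rw [← Finset.sum_subset (Finset.range_subset_range.2 (show (m + n).toNat + 1 ≤ N by omega))]
            · refine Finset.sum_congr rfl fun a ha => ?_
              rw [mem_range] at ha
              rw [if_pos (by omega), LinearMap.smul_apply]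
              congr 4
              omega
            · intro a _ ha
              rw [mem_range] at ha
              rw [if_neg (by omega), smul_zero]
          · rw [if_neg h0, LinearMap.zero_apply]
            symm
            refine Finset.sum_eq_zero fun a _ => ?_
            rw [if_neg (by omega), smul_zero]
        · by_cases h0 : m + n ≤ 0
          · rw [if_pos h0, Phi_lin, LinearMap.sum_apply]
            rw [← Finset.sum_subset (Finset.range_subset_range.2 (show (-(m + n)).toNat + 1 ≤ N by omega))]
            · refine Finset.sum_congr rfl fun a ha => ?_
              rw [mem_range] at ha
              rw [if_pos (by omega), LinearMap.smul_apply]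
              congr 4
              omega
            · intro a _ ha
              rw [mem_range] at ha
              rw [if_neg (by omega), smul_zero]
          · rw [if_neg h0, LinearMap.zero_apply]
            symm
            refine Finset.sum_eq_zero fun a _ => ?_
            rw [if_neg (by omega), smul_zero]

end QW
end

noncomputable section
namespace QW
set_option linter.unusedSectionVars false
set_option linter.unusedSimpArgs false
open Finset

variable {ι : Type} [DecidableEq ι] (D : Dat ι)

theorem Psi_map {K L : Type} [Field K] [Algebra ℂ K] [Field L] [Algebra ℂ L] (φ : K →+* L)
    (hφ : ∀ c, φ (algebraMap ℂ K c) = algebraMap ℂ L c) (u : ℕ → K) (u' : ℕ → L)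
    (col col' : ℕ → ι) (x : TT ι) : ∀ A : Finset ℕ, (∀ a ∈ A, u' a = φ (u a)) →
      (∀ a ∈ A, col' a = col a) → Psi D u' col' x A = φ (Psi D u col x A) := by
  induction x using TT_ind with
  | h0 => simp
  | hadd x y hx hy => intro A h1 h2; simp [hx A h1 h2, hy A h1 h2]
  | hs c w =>
    intro A h1 h2
    simp only [map_smul, Pi.smul_apply, smul_K, map_mul, hφ]
    congr 1
    induction w generalizing A with
    | nil => rw [Psi_nil, Psi_nil]; split_ifs <;> simp
    | cons y w ih =>
      obtain ⟨k, n⟩ := y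
      rw [← Xm_wd, Psi_Xm, Psi_Xm, Fop_apply, Fop_apply, map_sum]
      refine Finset.sum_congr rfl fun a ha => ?_
      rw [h2 a ha]
      split_ifs with h
      · rw [map_mul, map_mul, map_zpow₀, map_prod, h1 a ha,
          ih _ (fun b hb => h1 b (mem_of_mem_erase hb)) (fun b hb => h2 b (mem_of_mem_erase hb))]
        congr 2
        refine Finset.prod_congr rfl fun b hb => ?_
        have hb' := mem_of_mem_erase hb
        unfold zt
        rw [h2 a ha, h2 b hb', h1 a ha, h1 b hb']
        split_ifs
        · simp
        · unfold gq; rw [map_div₀, map_sub, map_sub, map_mul, map_mul, hφ]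
        · rw [hφ]
      · simp

theorem Psi_smul {K : Type} [Field K] [Algebra ℂ K] (u : ℕ → K) (col : ℕ → ι) (c : ℂ) (x : TT ι) (A : Finset ℕ) :
    Psi D u col (c • x) A = algebraMap ℂ K c * Psi D u col x A := by
  rw [map_smul, Pi.smul_apply, smul_K]

section
variable (K : Type) [Field K] [Algebra ℂ K]

/-- Laurent series -/
abbrev LS := HahnSeries ℤ K

@[reducible] def algL : Algebra ℂ (LS K) := RingHom.toAlgebra ((HahnSeries.C (Γ := ℤ) (R := K)).comp (algebraMap ℂ K))

attribute [local instance] algL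

theorem algL_apply (c : ℂ) : algebraMap ℂ (LS K) c = HahnSeries.C (algebraMap ℂ K c) := rfl

theorem single_zpow' (e n : ℤ) : (HahnSeries.single e (1 : K) : LS K) ^ n = HahnSeries.single (e * n) 1 := by
  rw [RatFunc.single_zpow e, RatFunc.single_zpow (e * n), zpow_mul]

variable {K}

theorem ofPS_coeff_neg (f : PowerSeries K) (n : ℤ) (h : ¬ 0 ≤ n) :
    (HahnSeries.ofPowerSeries ℤ K f).coeff n = 0 := by
  rw [HahnSeries.ofPowerSeries_apply]
  apply HahnSeries.embDomain_of_notMem_range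
  rintro ⟨k, hk⟩
  simp at hk
  omega

theorem coeff_C_mul' (c : K) (x : LS K) (n : ℤ) : (HahnSeries.C c * x).coeff n = c * x.coeff n := by
  rw [HahnSeries.C_mul_eq_smul]; rfl

theorem gq_ser (ε : ℤ) (hε : ε = 1 ∨ ε = -1) (p : ℂ) (hp : p ≠ 0) (v : K) (hv : v ≠ 0) :
    gq (algebraMap ℂ (LS K) p) (HahnSeries.single (-ε) 1) (HahnSeries.C v) =
      HahnSeries.ofPowerSeries ℤ K (gser (p ^ ε) (v ^ ε)) := by
  have h := congrArg (HahnSeries.ofPowerSeries ℤ K) (gser_eq (p ^ ε) (v ^ ε))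
  simp only [map_mul, map_sub, map_one, HahnSeries.ofPowerSeries_C, HahnSeries.ofPowerSeries_X] at h
  have hp' : algebraMap ℂ K p ≠ 0 := by simpa using hp
  have hden : (HahnSeries.single (-ε) 1 : LS K) - algebraMap ℂ (LS K) p * HahnSeries.C v ≠ 0 := by
    intro h0
    have := congrArg (fun x => HahnSeries.coeff x (-ε)) h0
    rw [algL_apply, ← map_mul, HahnSeries.C_apply] at this
    simp only [HahnSeries.coeff_sub, HahnSeries.coeff_single, if_true, HahnSeries.coeff_zero] at this
    rw [if_neg (by omega)] at this
    simp at this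
  rw [gq, div_eq_iff hden]
  rw [algL_apply]
  set G := HahnSeries.ofPowerSeries ℤ K (gser (p ^ ε) (v ^ ε))
  have hX : (HahnSeries.single (1 : ℤ) (1 : K) : LS K) * HahnSeries.single (-1 : ℤ) 1 = 1 := by
    rw [HahnSeries.single_mul_single]; simp
  rcases hε with rfl | rfl
  · simp only [zpow_one] at h
    set t : LS K := HahnSeries.single (1 : ℤ) (1 : K)
    set s : LS K := HahnSeries.single (-1 : ℤ) (1 : K)
    linear_combination (-s) * h + (HahnSeries.C v - HahnSeries.C (algebraMap ℂ K p) * HahnSeries.C v * G) * hX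
  · rw [zpow_neg_one, zpow_neg_one, neg_neg] at *
    have e1 : (HahnSeries.C (algebraMap ℂ K p) : LS K) * HahnSeries.C (algebraMap ℂ K p⁻¹) = 1 := by
      rw [← map_mul, ← map_mul, mul_inv_cancel₀ hp, map_one, map_one]
    have e2 : (HahnSeries.C v : LS K) * HahnSeries.C v⁻¹ = 1 := by
      rw [← map_mul, mul_inv_cancel₀ hv, map_one]
    set t : LS K := HahnSeries.single (1 : ℤ) (1 : K)
    set P : LS K := HahnSeries.C (algebraMap ℂ K p)
    set P' : LS K := HahnSeries.C (algebraMap ℂ K p⁻¹)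
    set V : LS K := HahnSeries.C v
    set V' : LS K := HahnSeries.C v⁻¹
    linear_combination (P * V) * h + (V + V * V' * t * G) * e1 + (t*G - P * t) * e2

variable (u : ℕ → K) (col : ℕ → ι)

def uL (n0 : ℕ) (ε : ℤ) : ℕ → LS K := Function.update (fun a => HahnSeries.C (u a)) n0 (HahnSeries.single (-ε) 1)
def cL (n0 : ℕ) (j : ι) : ℕ → ι := Function.update col n0 j

theorem Generic_L {A : Finset ℕ} (hG : Generic D u col A) (n0 : ℕ) (ε : ℤ) (hε : ε = 1 ∨ ε = -1) (j : ι)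
    (hn : ∀ a ∈ A, a < n0) : Generic D (uL u n0 ε) (cL col n0 j) (insert n0 A) := by
  have hne : ∀ a ∈ A, a ≠ n0 := fun a ha => (hn a ha).ne
  have hu : ∀ a ∈ A, uL u n0 ε a = HahnSeries.C (u a) := fun a ha => by simp [uL, hne a ha]
  have hc : ∀ a ∈ A, cL col n0 j a = col a := fun a ha => by simp [cL, hne a ha]
  have hun : uL u n0 ε n0 = HahnSeries.single (-ε) 1 := by simp [uL]
  have hcn : cL col n0 j n0 = j := by simp [cL]
  constructor
  · intro a ha
    rcases mem_insert.1 ha with rfl | ha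
    · rw [hun]; simp
    · rw [hu a ha]
      simpa using hG.1 a ha
  · intro a ha b hb hab
    rcases mem_insert.1 ha with rfl | ha
    · rcases mem_insert.1 hb with rfl | hb
      · exact absurd rfl hab
      · rw [hun, hu b hb, algL_apply, ← map_mul, HahnSeries.C_apply]
        intro h0
        have := congrArg (fun x => HahnSeries.coeff x (-ε)) h0
        simp only [HahnSeries.coeff_sub, HahnSeries.coeff_single, if_true, HahnSeries.coeff_zero] at this
        rw [if_neg (by omega)] at this
        simp at this
    · rcases mem_insert.1 hb with hbn | hb
      · rw [hbn, hun, hu a ha, algL_apply, HahnSeries.C_apply (u a)]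
        intro h0
        have := congrArg (fun x => HahnSeries.coeff x (-ε)) h0
        simp only [HahnSeries.coeff_sub, coeff_C_mul', HahnSeries.coeff_single, if_true, HahnSeries.coeff_zero] at this
        rw [if_neg (by omega)] at this
        simp [D.pr_ne] at this
      · rw [hu a ha, hu b hb, hc a ha, hc b hb, algL_apply, ← map_mul, ← map_sub]
        have := hG.2 a ha b hb hab
        intro h0
        exact this (HahnSeries.C_injective (by rw [h0, map_zero]))

theorem Psi_Dop (n0 : ℕ) (ε : ℤ) (hε : ε = 1 ∨ ε = -1) (j : ι) (b : ℤ) (x : TT ι) :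
    ∀ A : Finset ℕ, (∀ a ∈ A, a < n0) → (∀ a ∈ A, u a ≠ 0) →
      (Psi D (uL u n0 ε) (cL col n0 j) x (insert n0 A)).coeff (ε * b) = Psi D u col (Dop D ε j b x) A := by
  induction x using TT_ind with
  | h0 => simp
  | hadd x y hx hy => intro A h1 h2; simp [hx A h1 h2, hy A h1 h2]
  | hs c w =>
    intro A h1 h2
    rw [Psi_smul, map_smul, Psi_smul, algL_apply, coeff_C_mul']
    congr 1
    induction w generalizing A with
    | nil => rw [Psi_nil, Dop_nil]; simp
    | cons y w ih =>
      obtain ⟨k, n⟩ := y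
      have hne : ∀ a ∈ A, a ≠ n0 := fun a ha => (h1 a ha).ne
      have hu : ∀ a ∈ A, uL u n0 ε a = HahnSeries.C (u a) := fun a ha => by simp [uL, hne a ha]
      have hc : ∀ a ∈ A, cL col n0 j a = col a := fun a ha => by simp [cL, hne a ha]
      have hun : uL u n0 ε n0 = HahnSeries.single (-ε) 1 := by simp [uL]
      have hcn : cL col n0 j n0 = j := by simp [cL]
      have hnA : n0 ∉ A := fun h => hne _ h rfl
      rw [← Xm_wd, Psi_Xm, Xm_wd, Dop_wd, Fop_apply, Finset.sum_insert hnA, HahnSeries.coeff_add, map_add,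
        Pi.add_apply, add_comm]
      congr 1
      · rw [map_smul, Pi.smul_apply, smul_K, Psi_Xm, Fop_apply, Finset.mul_sum]
        have : ∀ s : Finset ℕ, ∀ g : ℕ → LS K, (∑ a ∈ s, g a).coeff (ε * b) = ∑ a ∈ s, (g a).coeff (ε * b) :=
          fun s g => map_sum (HahnSeries.coeff.addMonoidHom (R := K) (ε * b)) g s
        rw [this]
        refine Finset.sum_congr rfl fun a ha => ?_
        rw [hc a ha]
        by_cases hk : col a = k
        swap
        · simp [hk]
        rw [if_pos hk, if_pos hk]
        have hA : A.erase a ⊆ A := erase_subset _ _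
        have hins : (insert n0 A).erase a = insert n0 (A.erase a) :=
          Finset.erase_insert_of_ne (hne a ha).symm
        have hn' : n0 ∉ A.erase a := fun h => hnA (hA h)
        rw [hins, Finset.prod_insert hn', ← ih _ (fun b hb => h1 b (hA hb)) (fun b hb => h2 b (hA hb))]
        have e1 : zt D (uL u n0 ε) (cL col n0 j) a n0 = HahnSeries.C (algebraMap ℂ K (D.sg j k)) := by
          unfold zt
          rw [if_neg (hne a ha), if_neg (by have := h1 a ha; omega), hcn, hc a ha, hk, algL_apply, D.sg_symm]
        have e2 : ∏ b ∈ A.erase a, zt D (uL u n0 ε) (cL col n0 j) a b =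
            HahnSeries.C (∏ b ∈ A.erase a, zt D u col a b) := by
          rw [map_prod]
          refine Finset.prod_congr rfl fun b hb => ?_
          unfold zt
          rw [hc a ha, hc b (hA hb), hu a ha, hu b (hA hb)]
          split_ifs
          · simp
          · unfold gq; rw [map_div₀, map_sub, map_sub, map_mul, map_mul, algL_apply]
          · rw [algL_apply]
        rw [e1, e2, hu a ha, ← map_zpow₀, ← map_mul, ← map_mul, coeff_C_mul']
        ring
      · rw [hcn]
        by_cases hk : j = k
        swap
        · simp [hk]
        rw [if_pos hk, if_pos hk, Finset.erase_insert hnA]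
        have e3 : Psi D (uL u n0 ε) (cL col n0 j) (wd w) A = HahnSeries.C (Psi D u col (wd w) A) :=
          Psi_map D (L := LS K) HahnSeries.C (fun c => (algL_apply K c).symm) u (uL u n0 ε) col (cL col n0 j) (wd w) A hu hc
        have e4 : ∏ b ∈ A, zt D (uL u n0 ε) (cL col n0 j) n0 b =
            HahnSeries.ofPowerSeries ℤ K (∏ b ∈ A, gser (D.pr j (col b) ^ ε) (u b ^ ε)) := by
          rw [map_prod]
          refine Finset.prod_congr rfl fun b hb => ?_
          unfold zt
          rw [if_neg (hne b hb).symm, if_pos (h1 b hb), hcn, hc b hb, hun, hu b hb,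
            gq_ser ε hε _ (D.pr_ne _ _) _ (h2 b hb)]
        rw [e3, e4, hun, single_zpow', mul_comm, coeff_C_mul', HahnSeries.coeff_single_mul, one_mul,
          show ε * b - -ε * n = ε * (b + n) by ring]
        split_ifs with h0
        · obtain ⟨r, hr⟩ := Int.eq_ofNat_of_zero_le h0
          rw [Psi_Phi D u col ε j dl _ _ A h2, hr, Int.toNat_natCast, HahnSeries.ofPowerSeries_apply_coeff]
          have : (mkb dl : PowerSeries K) = 1 := by
            ext n; simp [mkb, dl, PowerSeries.coeff_one]
          rw [this, one_mul, mul_comm]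
        · rw [ofPS_coeff_neg _ _ h0]; simp

theorem inI_Dop (ε : ℤ) (hε : ε = 1 ∨ ε = -1) (j : ι) (b : ℤ) (x : TT ι) (hx : inI D x) :
    inI D (Dop D ε j b x) := by
  intro K _ _ u col A hG
  obtain ⟨n0, hn0⟩ : ∃ n0, ∀ a ∈ A, a < n0 :=
    ⟨A.sup id + 1, fun a ha => Nat.lt_succ_of_le (Finset.le_sup (f := id) ha)⟩
  rw [← Psi_Dop D u col n0 ε hε j b x A hn0 hG.1]
  rw [hx (LS K) (uL u n0 ε) (cL col n0 j) (insert n0 A) (Generic_L D u col hG n0 ε hε j hn0)]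
  rfl

theorem inI_tw (j : ι) (x : TT ι) (hx : inI D x) : inI D (tw D j x) := by
  intro K _ _ u col A hG
  rw [Psi_tw, hx K u col A hG, mul_zero]

theorem inI_zero : inI D (0 : TT ι) := by intro K _ _ u col A hG; simp
theorem inI_add {x y : TT ι} (hx : inI D x) (hy : inI D y) : inI D (x + y) := by
  intro K _ _ u col A hG; simp [hx K u col A hG, hy K u col A hG]
theorem inI_smul (c : ℂ) {x : TT ι} (hx : inI D x) : inI D (c • x) := by
  intro K _ _ u col A hG; simp [hx K u col A hG]

def Isub : Submodule ℂ (TT ι) where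
  carrier := {x | inI D x}
  zero_mem' := inI_zero D
  add_mem' := inI_add D
  smul_mem' := fun c _ => inI_smul D c

theorem Phi_Isub (ε : ℤ) (i : ι) (b : ℕ → ℂ) (k : ℕ) (x : TT ι) (hx : x ∈ Isub D) :
    Phi D ε i b k x ∈ Isub D := by
  intro K _ _ u col A hG
  rw [Psi_Phi D u col ε i b x k A hG.1, hx K u col A hG, mul_zero]

theorem Xp_Isub (γ : ℤ → ι → ℕ → ℂ) (j : ι) (m : ℤ) (x : TT ι) (hx : x ∈ Isub D) :
    Xp D γ j m x ∈ Isub D := by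
  obtain ⟨N, h⟩ := Xp_Dop D γ j m x
  rw [h N le_rfl]
  refine Submodule.smul_mem _ _ (Submodule.sub_mem _ ?_ ?_)
  · exact Submodule.sum_mem _ fun n _ => Submodule.smul_mem _ _ (inI_Dop D 1 (Or.inl rfl) _ _ _ hx)
  · exact Submodule.sum_mem _ fun n _ => Submodule.smul_mem _ _ (inI_Dop D (-1) (Or.inr rfl) _ _ _ hx)

theorem Isub_nil [Nonempty ι] (x : TT ι) (hx : x ∈ Isub D) : x [] = 0 := by
  obtain ⟨i⟩ := ‹Nonempty ι›
  have h := hx ℂ (fun _ => 1) (fun _ => i) ∅ ⟨by simp, by simp⟩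
  have : ∀ y : TT ι, Psi D (fun _ => (1:ℂ)) (fun _ => i) y ∅ = y [] := by
    intro y
    induction y using TT_ind with
    | h0 => simp
    | hadd x y hx hy => simp [hx, hy]
    | hs c w =>
      rw [map_smul, Pi.smul_apply, Finsupp.smul_apply]
      congr 1
      cases w with
      | nil => rw [Psi_nil]; simp [wd]
      | cons y w => obtain ⟨k, n⟩ := y; rw [← Xm_wd, Psi_Xm, Fop_apply, Xm_wd]; simp [wd]
  rw [← this, h]

theorem Isub_one (x : TT ι) (hx : x ∈ Isub D) (i : ι) (n : ℤ) : x [(i, n)] = 0 := by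
  have h := hx (LS ℂ) (fun _ => HahnSeries.single 1 1) (fun _ => i) {0} ⟨by simp, by
    intro a ha b hb hab; simp at ha hb; omega⟩
  have : ∀ y : TT ι, (Psi D (fun _ => (HahnSeries.single 1 1 : LS ℂ)) (fun _ => i) y {0}).coeff n = y [(i, n)] := by
    intro y
    induction y using TT_ind with
    | h0 => simp
    | hadd x y hx hy => simp [hx, hy]
    | hs c w =>
      rw [Psi_smul, Finsupp.smul_apply, algL_apply, coeff_C_mul']
      congr 1
      cases w with
      | nil => rw [Psi_nil]; simp [wd]
      | cons y w =>
        obtain ⟨k, m⟩ := y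
        rw [← Xm_wd, Psi_Xm, Fop_apply, Xm_wd]
        rw [Finset.sum_singleton]
        cases w with
        | nil =>
          rw [Finset.erase_singleton, Psi_nil]
          by_cases h1 : i = k
          · subst h1
            simp only [if_true, Finset.prod_empty, mul_one, single_zpow', one_mul, wd, HahnSeries.coeff_single,
              Finsupp.single_apply]
            by_cases h2 : n = m
            · simp [h2]
            · rw [if_neg h2, if_neg (by simp [Ne.symm h2])]
          · rw [if_neg h1]
            simp only [wd, Finsupp.single_apply]
            rw [if_neg (by simp [Ne.symm h1])]; rfl
        | cons y w =>
          obtain ⟨k', m'⟩ := y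
          rw [Finset.erase_singleton, ← Xm_wd, Psi_Xm, Fop_apply]
          simp [wd, Finsupp.single_apply]
  rw [← this, h]; rfl

end
end QW
end

noncomputable section
namespace QW
set_option linter.unusedSectionVars false
set_option linter.unusedSimpArgs false
open Finset

variable {ι : Type} [DecidableEq ι] (D : Dat ι) (W : HWD ι)

def omw : Wd ι → Module.End ℂ (TT ι)
  | [] => 1
  | (j, n) :: w => omw w * XO D W j n

def om : TT ι →ₗ[ℂ] Module.End ℂ (TT ι) := lin (omw D W)

theorem om_nil : om D W (wd []) = 1 := by simp [om, omw]

theorem om_Xm (j : ι) (n : ℤ) (x : TT ι) : om D W (Xm j n x) = om D W x * XO D W j n := by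
  induction x using TT_ind with
  | h0 => simp
  | hadd x y hx hy => simp [hx, hy, add_mul]
  | hs c w => rw [map_smul, map_smul, map_smul, smul_mul_assoc]; congr 1; simp [om, omw]

theorem om_PhO (ε : ℤ) (hε : ε = 1 ∨ ε = -1) (i : ι) (x : TT ι) : ∀ k : ℕ,
    om D W x * PhO D W ε i k = ∑ a ∈ range (k + 1), PhO D W ε i (k - a) * om D W (Phi D ε i dl a x) := by
  induction x using TT_ind with
  | h0 => simp
  | hadd x y hx hy => intro k; simp [add_mul, hx, hy, mul_add, Finset.sum_add_distrib]
  | hs c w =>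
    intro k
    simp only [map_smul, smul_mul_assoc, mul_smul_comm, ← Finset.smul_sum]
    congr 1
    induction w generalizing k with
    | nil =>
      simp only [om_nil, Phi_nil, map_smul, one_mul, mul_smul_comm, mul_one]
      rw [Finset.sum_eq_single 0]
      · simp [dl]
      · intro a _ ha; simp [dl, ha]
      · simp
    | cons y w ih =>
      obtain ⟨j, n⟩ := y
      have h1 : ∀ a, om D W (Phi D ε i dl a (wd ((j, n) :: w))) = ∑ b ∈ range (a + 1),
          gco (D.pr i j ^ ε) b • (om D W (Phi D ε i dl (a - b) (wd w)) * XO D W j (n + ε * b)) := by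
        intro a
        have h1 := congrArg (fun A => A (wd w)) (Phi_Xm D ε i dl a j n)
        simp only [Module.End.mul_apply, LinearMap.sum_apply, LinearMap.smul_apply] at h1
        rw [← Xm_wd, h1, map_sum]
        simp only [map_smul, om_Xm]
      simp only [h1]
      rw [← Xm_wd, om_Xm, mul_assoc, XO_PhO D W ε hε]
      simp only [Finset.mul_sum, mul_smul_comm]
      let f : ℕ → ℕ → Module.End ℂ (TT ι) := fun a b => gco (D.pr i j ^ ε) a •
        (PhO D W ε i (k - a - b) * (om D W (Phi D ε i dl b (wd w)) * XO D W j (n + ε * a)))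
      have h2 := Finset.sum_range_diag_flip (k + 1) f
      trans ∑ m ∈ range (k + 1), ∑ b ∈ range (k + 1 - m), f m b
      · refine Finset.sum_congr rfl fun a ha => ?_
        have ha' : a ≤ k := by simpa [Nat.lt_succ_iff] using ha
        rw [← mul_assoc, ih, Finset.sum_mul, Finset.smul_sum, show k + 1 - a = k - a + 1 by omega]
        refine Finset.sum_congr rfl fun b _ => ?_
        simp only [f, mul_assoc]
      · rw [← h2]
        refine Finset.sum_congr rfl fun c hc => ?_
        refine Finset.sum_congr rfl fun a ha => ?_
        have : a ≤ c := by simpa [Nat.lt_succ_iff] using ha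
        simp only [f]
        rw [show k - a - (c - a) = k - c by omega]

theorem om_Xminus (j : ι) (m : ℤ) (x : TT ι) : ∃ N0 : ℕ, ∀ N ≥ N0, ∀ v : TT ι,
    om D W x (Xm j m v) = Xm j m (om D W (tw D j x) v) + (D.ka j)⁻¹ •
      (∑ n ∈ range N, PhO D W 1 j n (om D W (Dop D 1 j (m - n) x) v)
      - ∑ n ∈ range N, PhO D W (-1) j n (om D W (Dop D (-1) j (m + n) x) v)) := by
  induction x using TT_ind with
  | h0 => exact ⟨0, fun N _ v => by simp⟩
  | hadd x y hx hy =>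
    obtain ⟨N1, h1⟩ := hx
    obtain ⟨N2, h2⟩ := hy
    refine ⟨max N1 N2, fun N hN v => ?_⟩
    rw [map_add, LinearMap.add_apply, h1 N (le_trans (le_max_left _ _) hN), h2 N (le_trans (le_max_right _ _) hN)]
    simp only [map_add, LinearMap.add_apply, Finset.sum_add_distrib]
    module
  | hs c w =>
    suffices h : ∃ N0 : ℕ, ∀ N ≥ N0, ∀ v : TT ι, om D W (wd w) (Xm j m v) = Xm j m (om D W (tw D j (wd w)) v) + (D.ka j)⁻¹ •
      (∑ n ∈ range N, PhO D W 1 j n (om D W (Dop D 1 j (m - n) (wd w)) v)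
      - ∑ n ∈ range N, PhO D W (-1) j n (om D W (Dop D (-1) j (m + n) (wd w)) v)) by
      obtain ⟨N0, h⟩ := h
      refine ⟨N0, fun N hN v => ?_⟩
      simp only [map_smul, LinearMap.smul_apply, ← Finset.smul_sum, h N hN]
      module
    induction w with
    | nil => exact ⟨0, fun N _ v => by simp [om_nil, tw_nil, Dop_nil]⟩
    | cons y w ih =>
      obtain ⟨k, r⟩ := y
      obtain ⟨N0, ih⟩ := ih
      refine ⟨max N0 ((r + m).natAbs + 1), fun N hN v => ?_⟩
      have hN1 := le_trans (le_max_left _ _) hN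
      have hN2 := le_trans (le_max_right _ _) hN
      have hD : ∀ (ε b : ℤ), om D W (Dop D ε j b (wd ((k, r) :: w))) v =
          D.sg j k • (om D W (Dop D ε j b (wd w)) (XO D W k r v)) +
          if j = k then (if 0 ≤ ε * (b + r) then om D W (Phi D ε j dl (ε * (b + r)).toNat (wd w)) v else 0) else 0 := by
        intro ε b
        rw [Dop_wd, map_add, map_smul, om_Xm, LinearMap.add_apply, LinearMap.smul_apply, Module.End.mul_apply]
        congr 1
        split_ifs <;> simp
      have hX : XO D W k r (Xm j m v) = D.sg j k • (Xm j m (XO D W k r v)) +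
          if j = k then (D.ka j)⁻¹ • phZ D (gam D W) j (r + m) v else 0 := by
        rw [XO, XO_Xm_apply, D.sg_symm]
        congr 1
        by_cases h : j = k
        · subst h; simp
        · rw [if_neg h, if_neg (Ne.symm h)]
      have key : om D W (wd w) (phZ D (gam D W) j (r + m) v) =
          ∑ n ∈ range N, PhO D W 1 j n (if 0 ≤ 1 * (m - n + r) then
            om D W (Phi D 1 j dl (1 * (m - n + r)).toNat (wd w)) v else 0) -
          ∑ n ∈ range N, PhO D W (-1) j n (if 0 ≤ -1 * (m + n + r) then
            om D W (Phi D (-1) j dl (-1 * (m + n + r)).toNat (wd w)) v else 0) := by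
        have aux : ∀ (ε : ℤ) (hε : ε = 1 ∨ ε = -1), om D W (wd w) (if 0 ≤ ε * (r + m) then PhO D W ε j (ε * (r + m)).toNat v else 0)
            = ∑ n ∈ range N, PhO D W ε j n (if 0 ≤ ε * (m - ε * n + r) then
            om D W (Phi D ε j dl (ε * (m - ε * n + r)).toNat (wd w)) v else 0) := by
          intro ε hε
          have hεε : ε * ε = 1 := by rcases hε with rfl | rfl <;> rfl
          have e : ∀ n : ℕ, ε * (m - ε * n + r) = ε * (r + m) - n := by
            intro n; linear_combination (-(n : ℤ)) * hεε
          simp only [e]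
          split_ifs with h0
          · obtain ⟨K, hK⟩ := Int.eq_ofNat_of_zero_le h0
            have hKN : K + 1 ≤ N := by
              rcases hε with rfl | rfl <;> omega
            have hP := congrArg (fun A => A v) (om_PhO D W ε hε j (wd w) K)
            simp only [Module.End.mul_apply, LinearMap.sum_apply] at hP
            rw [hK, Int.toNat_natCast, hP]
            rw [← Finset.sum_range_reflect]
            rw [← Finset.sum_subset (Finset.range_mono hKN)]
            · refine Finset.sum_congr rfl fun n hn => ?_
              have hn' : n ≤ K := by simpa [Nat.lt_succ_iff] using hn
              rw [if_pos (by omega), show K + 1 - 1 - n = K - n by omega, show K - (K - n) = n by omega,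
                show ((K : ℤ) - n).toNat = K - n by omega]
            · intro n _ hn
              rw [if_neg (by simp at hn; omega), map_zero]
          · rw [map_zero, Finset.sum_eq_zero]
            intro n _
            rw [if_neg (by omega), map_zero]
        have a1 := aux 1 (Or.inl rfl)
        have a2 := aux (-1) (Or.inr rfl)
        simp only [one_mul, neg_one_mul, sub_neg_eq_add] at a1 a2 ⊢
        rw [← a1, ← a2, phZ, LinearMap.sub_apply, map_sub]
        by_cases h1 : 0 ≤ r + m <;> by_cases h2 : r + m ≤ 0 <;>
          simp only [h1, h2, PhO, (show (0 ≤ -(r + m)) ↔ (r + m ≤ 0) by omega), if_true, if_false, LinearMap.zero_apply]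
      rw [← Xm_wd, om_Xm, Module.End.mul_apply, hX, tw_Xm, map_smul, om_Xm, Xm_wd, map_add, map_smul, ih N hN1]
      simp only [hD, LinearMap.smul_apply, map_add, map_smul, Module.End.mul_apply, Finset.sum_add_distrib,
        ← Finset.smul_sum]
      by_cases h : j = k
      · simp only [if_pos h]
        rw [map_smul, key]
        module
      · simp only [if_neg h, map_zero, Finset.sum_const_zero]
        module

theorem om_Isub [Nonempty ι] (s : TT ι) (hs : s ∈ Isub D) : om D W s = 0 := by
  apply lin_ext
  intro w
  rw [LinearMap.zero_apply]
  induction w generalizing s with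
  | nil =>
    have h : ∀ s : TT ι, om D W s (wd []) = s [] • wd [] := by
      intro s
      induction s using TT_ind with
      | h0 => simp
      | hadd x y hx hy => simp [hx, hy, add_smul]
      | hs c w =>
        cases w with
        | nil => simp [om_nil]; simp [wd]
        | cons y w =>
          obtain ⟨k, r⟩ := y
          rw [← Xm_wd, map_smul, om_Xm, Xm_wd, LinearMap.smul_apply, Module.End.mul_apply, XO, Xp_nil]
          simp [wd]
    rw [h, Isub_nil D s hs, zero_smul]
  | cons y w ih =>
    obtain ⟨k, r⟩ := y
    obtain ⟨N, h⟩ := om_Xminus D W k r s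
    have := h N le_rfl (wd w)
    rw [← Xm_wd, this, ih _ (inI_tw D _ _ hs)]
    simp only [ih _ (inI_Dop D 1 (Or.inl rfl) _ _ _ hs), ih _ (inI_Dop D (-1) (Or.inr rfl) _ _ _ hs)]
    simp

end QW
end

noncomputable section
namespace QW
set_option linter.unusedSectionVars false
set_option linter.unusedSimpArgs false
open Finset

variable {ι : Type} [DecidableEq ι] (D : Dat ι) (W : HWD ι)

theorem rm_quad0 (i j : ι) (m n : ℤ) (hp : D.pr i j = 1) (y : TT ι) :
    Xm i m (Xm j n y) - D.sg i j • Xm j n (Xm i m y) ∈ Isub D := by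
  intro K _ _ u col A hG
  have h := quad0 D u col hG (Psi D u col y) i j m n hp
  simp only [FL] at h
  simp only [map_sub, map_smul, Psi_Xm, Pi.sub_apply, Pi.smul_apply, smul_K]
  rw [h]; ring

theorem rm_quad1 (i j : ι) (m n : ℤ) (hs : D.sg i j = 1) (y : TT ι) :
    Xm i (m + 1) (Xm j n y) - D.pr i j • Xm j n (Xm i (m + 1) y)
      - D.pr i j • Xm i m (Xm j (n + 1) y) + Xm j (n + 1) (Xm i m y) ∈ Isub D := by
  intro K _ _ u col A hG
  have h := quad1 D u col hG (Psi D u col y) i j m n hs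
  simp only [FL] at h
  simp only [map_sub, map_add, map_smul, Psi_Xm, Pi.sub_apply, Pi.add_apply, Pi.smul_apply, smul_K]
  exact h

theorem rm_serre (i j : ι) (m n k : ℤ) (hs : D.sg i j = 1) (hsi : D.sg i i = 1)
    (hp : D.pr i i = (D.pr i j ^ 2)⁻¹) (r : ℂ) (hr : r = D.pr i j + (D.pr i j)⁻¹) (y : TT ι) :
    Xm i m (Xm i n (Xm j k y)) + Xm i n (Xm i m (Xm j k y))
      - r • (Xm i m (Xm j k (Xm i n y)) + Xm i n (Xm j k (Xm i m y)))
      + Xm j k (Xm i n (Xm i m y)) + Xm j k (Xm i m (Xm i n y)) ∈ Isub D := by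
  intro K _ _ u col A hG
  have h := serre0 D u col hG (Psi D u col y) i j m n k hs hsi hp
  simp only [FL] at h
  simp only [map_sub, map_add, map_smul, Psi_Xm, Pi.sub_apply, Pi.add_apply, Pi.smul_apply, smul_K, hr]
  simpa using h

theorem rm_osc (i j k : ι) (m n l o : ℤ)
    (al be : ℂ) (hp13 : D.pr i k = 1) (hp23 : D.pr j k = (D.pr i j)⁻¹)
    (hp24 : D.pr j j = 1) (hs12 : D.sg i j = 1) (hs13 : D.sg i k = 1) (hs23 : D.sg j k = 1)
    (hs24 : D.sg j j = -1)
    (hab : al + be = D.pr i j + (D.pr i j)⁻¹) (y : TT ι)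
    (A B C E : Module.End ℂ (TT ι)) (hA : A = Xm i m) (hB : B = Xm j n) (hC : C = Xm k l)
    (hE : E = Xm j o) :
    A (B (C (E y))) - al • B (A (C (E y))) - be • C (A (B (E y))) + C (B (A (E y)))
    + E (A (B (C y))) - al • E (B (A (C y))) - be • E (C (A (B y))) + E (C (B (A y)))
    + A (E (C (B y))) - al • E (A (C (B y))) - be • C (A (E (B y))) + C (E (A (B y)))
    + B (A (E (C y))) - al • B (E (A (C y))) - be • B (C (A (E y))) + B (C (E (A y)))
     ∈ Isub D := by
  intro K _ _ u col Z hG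
  have h := osc0 D u col hG (Psi D u col y) i j k m n l o (algebraMap ℂ K al) (algebraMap ℂ K be)
    hp13 hp23 hp24 hs12 hs13 hs23 hs24 (by rw [← map_add, hab]) _ _ _ _ rfl rfl rfl rfl
  simp only [FL] at h
  subst hA hB hC hE
  simp only [map_sub, map_add, map_smul, Psi_Xm, Pi.sub_apply, Pi.add_apply, Pi.smul_apply, smul_K]
  exact h

variable [Nonempty ι]

theorem om2 (a b : ι × ℤ) (v : TT ι) : om D W (Xm a.1 a.2 (Xm b.1 b.2 (wd []))) v
    = XO D W b.1 b.2 (XO D W a.1 a.2 v) := by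
  simp [om_Xm, om_nil, -Xm_wd]

theorem rp_quad0 (i j : ι) (m n : ℤ) (hp : D.pr i j = 1) (v : TT ι) :
    XO D W i m (XO D W j n v) = D.sg i j • XO D W j n (XO D W i m v) := by
  have h := om_Isub D W _ (rm_quad0 D j i n m (by rw [D.pr_symm, hp]) (wd []))
  have h' := congrArg (fun T => T v) h
  simp only [map_sub, map_smul, om_Xm, om_nil, one_mul, LinearMap.sub_apply, LinearMap.smul_apply,
    Module.End.mul_apply, LinearMap.zero_apply] at h'
  rw [D.sg_symm]
  exact sub_eq_zero.1 h'

theorem rp_quad1 (i j : ι) (m n : ℤ) (hs : D.sg i j = 1) (v : TT ι) :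
    XO D W j n (XO D W i (m + 1) v) - D.pr i j • XO D W i (m + 1) (XO D W j n v)
      - D.pr i j • XO D W j (n + 1) (XO D W i m v) + XO D W i m (XO D W j (n + 1) v) = 0 := by
  have h := om_Isub D W _ (rm_quad1 D i j m n hs (wd []))
  have h' := congrArg (fun T => T v) h
  simpa only [map_sub, map_add, map_smul, om_Xm, om_nil, one_mul, LinearMap.sub_apply,
    LinearMap.add_apply, LinearMap.smul_apply,
    Module.End.mul_apply, LinearMap.zero_apply] using h'

theorem rp_serre (i j : ι) (m n k : ℤ) (hs : D.sg i j = 1) (hsi : D.sg i i = 1)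
    (hp : D.pr i i = (D.pr i j ^ 2)⁻¹) (r : ℂ) (hr : r = D.pr i j + (D.pr i j)⁻¹) (v : TT ι) :
    XO D W j k (XO D W i n (XO D W i m v)) + XO D W j k (XO D W i m (XO D W i n v))
      - r • (XO D W i n (XO D W j k (XO D W i m v)) + XO D W i m (XO D W j k (XO D W i n v)))
      + XO D W i m (XO D W i n (XO D W j k v)) + XO D W i n (XO D W i m (XO D W j k v)) = 0 := by
  have h := om_Isub D W _ (rm_serre D i j m n k hs hsi hp r hr (wd []))
  have h' := congrArg (fun T => T v) h
  simpa only [map_sub, map_add, map_smul, om_Xm, om_nil, one_mul, LinearMap.sub_apply,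
    LinearMap.add_apply, LinearMap.smul_apply,
    Module.End.mul_apply, LinearMap.zero_apply] using h'

theorem rp_osc (i j k : ι) (m n l o : ℤ)
    (al be : ℂ) (hp13 : D.pr i k = 1) (hp23 : D.pr j k = (D.pr i j)⁻¹)
    (hp24 : D.pr j j = 1) (hs12 : D.sg i j = 1) (hs13 : D.sg i k = 1) (hs23 : D.sg j k = 1)
    (hs24 : D.sg j j = -1)
    (hab : al + be = D.pr i j + (D.pr i j)⁻¹) (y : TT ι)
    (A B C E : Module.End ℂ (TT ι)) (hA : A = XO D W i m) (hB : B = XO D W j n) (hC : C = XO D W k l)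
    (hE : E = XO D W j o) :
    A (B (C (E y))) - al • B (A (C (E y))) - be • C (A (B (E y))) + C (B (A (E y)))
    + E (A (B (C y))) - al • E (B (A (C y))) - be • E (C (A (B y))) + E (C (B (A y)))
    + A (E (C (B y))) - al • E (A (C (B y))) - be • C (A (E (B y))) + C (E (A (B y)))
    + B (A (E (C y))) - al • B (E (A (C y))) - be • B (C (A (E y))) + B (C (E (A y)))
     = 0 := by
  have h := om_Isub D W _ (rm_osc D i j k m n l o be al hp13 hp23 hp24 hs12 hs13 hs23 hs24
    (by rw [add_comm, hab]) (wd []) _ _ _ _ rfl rfl rfl rfl)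
  have h' := congrArg (fun T => T y) h
  simp only [map_sub, map_add, map_smul, om_Xm, om_nil, one_mul, LinearMap.sub_apply,
    LinearMap.add_apply, LinearMap.smul_apply,
    Module.End.mul_apply, LinearMap.zero_apply] at h'
  subst hA hB hC hE
  rw [← h']
  module

end QW
end

noncomputable section
namespace QW
set_option linter.unusedSectionVars false
set_option linter.unusedSimpArgs false
open Finset

variable {ι : Type} [DecidableEq ι] (D : Dat ι) (W : HWD ι)

theorem HO_XO_apply (i j : ι) (s m : ℤ) (v : TT ι) :
    XO D W j m (HO D W i s v) = HO D W i s (XO D W j m v) + dco D i j s • XO D W j (m + s) v :=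
  congrArg (fun T => T v) (HO_XO D W i j s m)

theorem KO_XO_apply (ε : ℤ) (i j : ι) (m : ℤ) (v : TT ι) :
    XO D W j m (KO D W ε i v) = D.pr i j ^ ε • KO D W ε i (XO D W j m v) :=
  congrArg (fun T => T v) (KO_XO D W ε i j m)

/-- vacuum coefficient -/
def vac : TT ι →ₗ[ℂ] ℂ := lin fun w => if w = [] then 1 else 0

/-- degree one coefficient row -/
def rowW (c0 : ι) : Wd ι → LaurentPolynomial ℂ
  | [] => 0
  | [x] => if x.1 = c0 then LaurentPolynomial.T x.2 else 0
  | _ :: _ :: _ => 0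

def row (c0 : ι) : TT ι →ₗ[ℂ] LaurentPolynomial ℂ := lin (rowW c0)

theorem vac_eq (x : TT ι) : vac x = x [] := by
  have : vac = Finsupp.lapply (R := ℂ) (M := ℂ) ([] : Wd ι) := by
    apply lin_ext; intro w; rw [vac, lin_wd]; simp [wd, Finsupp.single_apply]
  rw [this]; rfl

theorem vac_nil : vac (wd ([] : Wd ι)) = 1 := by simp [vac]
theorem vac_Xm (j : ι) (n : ℤ) (x : TT ι) : vac (Xm j n x) = 0 := by
  have : vac ∘ₗ Xm j n = 0 := by apply lin_ext; intro w; simp [vac]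
  exact congrArg (fun T => T x) this
theorem row_nil (c0 : ι) : row c0 (wd ([] : Wd ι)) = 0 := by simp [row, rowW]
theorem row_Xm (c0 : ι) (j : ι) (n : ℤ) (x : TT ι) : row c0 (Xm j n x) =
    vac x • if j = c0 then LaurentPolynomial.T n else 0 := by
  have : row c0 ∘ₗ Xm j n = LinearMap.smulRight vac (if j = c0 then LaurentPolynomial.T n else 0) := by
    apply lin_ext; intro w
    cases w <;> simp [vac, row, rowW]
  exact congrArg (fun T => T x) this

theorem vac_HO (i : ι) (s : ℤ) (x : TT ι) : vac (HO D W i s x) = W.η i s * vac x := by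
  have : vac ∘ₗ HO D W i s = W.η i s • vac := by
    apply lin_ext_cons
    · simp [HO, Hop_nil, vac_nil]
    · intro j n w _
      simp only [LinearMap.comp_apply, HO, Hop_Xm_apply, map_add, map_smul, vac_Xm, LinearMap.smul_apply]
      simp
  exact congrArg (fun T => T x) this

theorem vac_KO (ε : ℤ) (i : ι) (x : TT ι) : vac (KO D W ε i x) = W.ke i ^ ε * vac x := by
  have : vac ∘ₗ KO D W ε i = W.ke i ^ ε • vac := by
    apply lin_ext_cons
    · simp [KO, Kop_nil, vac_nil]
    · intro j n w _
      simp only [LinearMap.comp_apply, KO, Kop_Xm_apply, map_add, map_smul, vac_Xm, LinearMap.smul_apply]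
      simp
  exact congrArg (fun T => T x) this

theorem row_HO (c0 i : ι) (s : ℤ) (x : TT ι) : row c0 (HO D W i s x) =
    (LaurentPolynomial.C (W.η i s) + LaurentPolynomial.C (dco D i c0 s) * LaurentPolynomial.T s) * row c0 x := by
  have : row c0 ∘ₗ HO D W i s = (LinearMap.mulLeft ℂ (LaurentPolynomial.C (W.η i s) +
      LaurentPolynomial.C (dco D i c0 s) * LaurentPolynomial.T s)) ∘ₗ row c0 := by
    apply lin_ext_cons
    · simp [HO, Hop_nil, row_nil]
    · intro j n w _
      simp only [LinearMap.comp_apply, HO, Hop_Xm_apply, map_add, map_smul, row_Xm, LinearMap.mulLeft_apply]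
      have := vac_HO D W i s (wd w)
      rw [HO] at this
      rw [this]
      split_ifs with h
      · subst h
        simp only [LaurentPolynomial.smul_eq_C_mul, LaurentPolynomial.T_add, map_mul]
        ring
      · simp
  exact congrArg (fun T => T x) this

theorem row_KO (c0 : ι) (ε : ℤ) (i : ι) (x : TT ι) : row c0 (KO D W ε i x) =
    (W.ke i ^ ε * D.pr i c0 ^ ε) • row c0 x := by
  have : row c0 ∘ₗ KO D W ε i = (W.ke i ^ ε * D.pr i c0 ^ ε) • row c0 := by
    apply lin_ext_cons
    · simp [KO, Kop_nil, row_nil]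
    · intro j n w _
      simp only [LinearMap.comp_apply, KO, Kop_Xm_apply, map_add, map_smul, row_Xm, LinearMap.smul_apply]
      have := vac_KO D W ε i (wd w)
      rw [KO] at this
      rw [this]
      split_ifs with h
      · subst h
        simp only [smul_smul]
        congr 1; ring
      · simp
  exact congrArg (fun T => T x) this

def XL : List (ι × ℤ) → TT ι →ₗ[ℂ] TT ι
  | [] => LinearMap.id
  | a :: l => XL l ∘ₗ XO D W a.1 a.2

variable (c0 : ι) (J : Ideal (LaurentPolynomial ℂ))

def NS : Submodule ℂ (TT ι) where
  carrier := {x | ∀ l, vac (XL D W l x) = 0 ∧ row c0 (XL D W l x) ∈ J}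
  zero_mem' := by intro l; simp
  add_mem' := by
    intro x y hx hy l
    rw [map_add, map_add, map_add, (hx l).1, (hy l).1]
    exact ⟨by simp, J.add_mem (hx l).2 (hy l).2⟩
  smul_mem' := by
    intro c x hx l
    rw [map_smul, map_smul, map_smul, (hx l).1, LaurentPolynomial.smul_eq_C_mul]
    exact ⟨by simp, J.mul_mem_left _ (hx l).2⟩

theorem mem_NS (x : TT ι) : x ∈ NS D W c0 J ↔ ∀ l, vac (XL D W l x) = 0 ∧ row c0 (XL D W l x) ∈ J := Iff.rfl

theorem mem_NS_iff (x : TT ι) : x ∈ NS D W c0 J ↔ (vac x = 0 ∧ row c0 x ∈ J) ∧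
    ∀ j m, XO D W j m x ∈ NS D W c0 J := by
  constructor
  · intro h
    exact ⟨h [], fun j m l => h ((j, m) :: l)⟩
  · rintro ⟨h0, h⟩ l
    cases l with
    | nil => exact h0
    | cons a l => exact h a.1 a.2 l

theorem XO_NS (j : ι) (m : ℤ) (x : TT ι) (hx : x ∈ NS D W c0 J) : XO D W j m x ∈ NS D W c0 J :=
  ((mem_NS_iff D W c0 J x).1 hx).2 j m

theorem HO_NS (i : ι) (s : ℤ) (x : TT ι) (hx : x ∈ NS D W c0 J) : HO D W i s x ∈ NS D W c0 J := by
  intro l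
  induction l generalizing x with
  | nil =>
    have h := hx []
    simp only [XL, LinearMap.id_apply] at h ⊢
    rw [vac_HO, row_HO, h.1]
    exact ⟨by simp, J.mul_mem_left _ h.2⟩
  | cons a l ih =>
    have h1 := ih _ (XO_NS D W c0 J a.1 a.2 x hx)
    have h2 := (NS D W c0 J).smul_mem (dco D i a.1 s) (XO_NS D W c0 J a.1 (a.2 + s) x hx) l
    simp only [XL, LinearMap.comp_apply]
    rw [HO_XO_apply, map_add, map_add, map_add, h1.1, h2.1]
    exact ⟨by simp, J.add_mem h1.2 h2.2⟩

theorem KO_NS (ε : ℤ) (i : ι) (x : TT ι) (hx : x ∈ NS D W c0 J) : KO D W ε i x ∈ NS D W c0 J := by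
  intro l
  induction l generalizing x with
  | nil =>
    have h := hx []
    simp only [XL, LinearMap.id_apply] at h ⊢
    rw [vac_KO, row_KO, h.1, LaurentPolynomial.smul_eq_C_mul]
    exact ⟨by simp, J.mul_mem_left _ h.2⟩
  | cons a l ih =>
    have h1 := ih _ (XO_NS D W c0 J a.1 a.2 x hx)
    simp only [XL, LinearMap.comp_apply]
    rw [KO_XO_apply, map_smul, map_smul, map_smul, h1.1, LaurentPolynomial.smul_eq_C_mul]
    exact ⟨by simp, J.mul_mem_left _ h1.2⟩

theorem expC_NS (S : Submodule ℂ (TT ι)) (t : ℂ) (a : ℕ → Module.End ℂ (TT ι)) (ha : ∀ s, ∀ x ∈ S, a s x ∈ S)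
    (k : ℕ) : ∀ x ∈ S, QAS.expC t a k x ∈ S := by
  induction k using Nat.strong_induction_on with
  | _ k ih =>
    intro x hx
    cases k with
    | zero => rw [expC_zero]; simpa using hx
    | succ n =>
      rw [expC_succ]
      simp only [LinearMap.smul_apply, LinearMap.sum_apply, Module.End.mul_apply]
      refine S.smul_mem _ (S.smul_mem _ (S.sum_mem fun s hs => S.smul_mem _ (ha _ _ (ih _ ?_ _ hx))))
      omega

theorem PhO_NS (ε : ℤ) (hε : ε = 1 ∨ ε = -1) (i : ι) (k : ℕ) (x : TT ι) (hx : x ∈ NS D W c0 J) :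
    PhO D W ε i k x ∈ NS D W c0 J := by
  rw [PhO_eq D W ε hε]
  exact KO_NS D W c0 J _ _ _ (expC_NS _ _ _ (fun s x hx => HO_NS D W c0 J _ _ x hx) _ _ hx)

theorem phZ_apply (i : ι) (n : ℤ) (x : TT ι) : phZ D (gam D W) i n x =
    (if 0 ≤ n then PhO D W 1 i n.toNat x else 0) - (if n ≤ 0 then PhO D W (-1) i (-n).toNat x else 0) := by
  rw [phZ]
  unfold PhO
  rw [LinearMap.sub_apply]
  split_ifs <;> simp

theorem phZ_NS (i : ι) (n : ℤ) (x : TT ι) (hx : x ∈ NS D W c0 J) :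
    phZ D (gam D W) i n x ∈ NS D W c0 J := by
  rw [phZ_apply]
  apply Submodule.sub_mem
  · split_ifs
    · exact PhO_NS D W c0 J _ (Or.inl rfl) _ _ _ hx
    · exact Submodule.zero_mem _
  · split_ifs
    · exact PhO_NS D W c0 J _ (Or.inr rfl) _ _ _ hx
    · exact Submodule.zero_mem _

theorem XOXm_apply (i j : ι) (m n : ℤ) (v : TT ι) :
    XO D W i m (Xm j n v) = D.sg i j • Xm j n (XO D W i m v) +
      if i = j then (D.ka i)⁻¹ • phZ D (gam D W) i (m + n) v else 0 := XO_Xm_apply D _ i j m n v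

theorem Xm_NS (j : ι) (n : ℤ) (x : TT ι) (hx : x ∈ NS D W c0 J) : Xm j n x ∈ NS D W c0 J := by
  intro l
  induction l generalizing x with
  | nil =>
    have h := hx []
    simp only [XL, LinearMap.id_apply] at h ⊢
    rw [vac_Xm, row_Xm, h.1]
    exact ⟨rfl, by simp⟩
  | cons a l ih =>
    have h1 := (ih _ (XO_NS D W c0 J a.1 a.2 x hx))
    have h2 : (if a.1 = j then (D.ka a.1)⁻¹ • phZ D (gam D W) a.1 (a.2 + n) x else 0) ∈ NS D W c0 J := by
      split_ifs
      · exact Submodule.smul_mem _ _ (phZ_NS D W c0 J _ _ _ hx)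
      · exact Submodule.zero_mem _
    have h3 := h2 l
    simp only [XL, LinearMap.comp_apply]
    rw [XOXm_apply, map_add, map_add, map_add, map_smul, map_smul, map_smul, h1.1, h3.1,
      LaurentPolynomial.smul_eq_C_mul]
    exact ⟨by simp, J.add_mem (J.mul_mem_left _ h1.2) h3.2⟩

theorem row_Isub (x : TT ι) (hx : x ∈ Isub D) : row c0 x = 0 := by
  rw [row, lin, Finsupp.linearCombination_apply, Finsupp.sum]
  apply Finset.sum_eq_zero
  intro w _
  match w with
  | [] => simp [rowW]
  | [a] => rw [Isub_one D x hx a.1 a.2, zero_smul]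
  | _ :: _ :: _ => simp [rowW]

theorem Isub_NS [Nonempty ι] (x : TT ι) (hx : x ∈ Isub D) : x ∈ NS D W c0 J := by
  intro l
  induction l generalizing x with
  | nil =>
    simp only [XL, LinearMap.id_apply]
    rw [vac_eq, Isub_nil D x hx, row_Isub D c0 x hx]
    exact ⟨rfl, J.zero_mem⟩
  | cons a l ih => exact ih _ (Xp_Isub D _ _ _ _ hx)

end QW
end

noncomputable section
namespace QW
set_option linter.unusedSectionVars false
set_option linter.unusedSimpArgs false
open Finset QAS

theorem cc_symm (M i j : ℕ) : cc M i j = cc M j i := by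
  unfold cc form4 innerE
  split_ifs <;> first | omega | (subst_vars; omega)

theorem lof_sq (M i : ℕ) : lof M i * lof M i = 1 := by
  unfold lof; split_ifs <;> norm_num

theorem cc_MM (M : ℕ) : cc M M M = 0 := by
  unfold cc form4 innerE lof
  simp

theorem cc_serre (M i j : ℕ) (h : cc M i j = 1 ∨ cc M i j = -1) (hi : i ≠ M) :
    cc M i i = -2 * cc M i j := by
  have h4 : i = j ∨ i = j + 1 ∨ j = i + 1 ∨ (i ≠ j ∧ i ≠ j + 1 ∧ i + 1 ≠ j) := by omega
  have hii : cc M i i = lof M i + lof M (i + 1) := by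
    simp [cc, form4, innerE]
  have hl : lof M i = lof M (i + 1) := by
    unfold lof; split_ifs <;> omega
  have hl1 : lof M i = 1 ∨ lof M i = -1 := by
    unfold lof; split_ifs <;> omega
  rcases h4 with h4 | h4 | h4 | ⟨h4, h5, h6⟩
  · subst h4; omega
  · subst h4
    have : cc M (j + 1) j = - lof M (j + 1) := by
      simp [cc, form4, innerE]
      omega
    omega
  · subst h4
    have : cc M i (i + 1) = - lof M (i + 1) := by
      simp [cc, form4, innerE]
      omega
    omega
  · have : cc M i j = 0 := by
      simp [cc, form4, innerE, h4, h5, h6]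
    omega

theorem qz_ne (q : ℂ) (hq0 : q ≠ 0) (hq1 : ∀ k : ℕ, k ≠ 0 → q ^ k ≠ 1) (k : ℤ) (hk : k ≠ 0) : q ^ k ≠ 1 := by
  intro h
  rcases Int.natAbs_eq k with e | e
  · rw [e, zpow_natCast] at h
    exact hq1 _ (by omega) h
  · rw [e, zpow_neg, zpow_natCast, inv_eq_one] at h
    exact hq1 _ (by omega) h

theorem qpar_ne (q : ℂ) (hq0 : q ≠ 0) (M i : ℕ) : qpar q M i ≠ 0 := zpow_ne_zero _ hq0

theorem qpar_z_ne (q : ℂ) (hq0 : q ≠ 0) (hq1 : ∀ k : ℕ, k ≠ 0 → q ^ k ≠ 1) (M i : ℕ) (k : ℤ) (hk : k ≠ 0) :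
    qpar q M i ^ k ≠ 1 := by
  rw [qpar, ← zpow_mul]
  apply qz_ne q hq0 hq1
  unfold lof; split_ifs <;> omega

theorem ka_ne' (q : ℂ) (hq0 : q ≠ 0) (hq1 : ∀ k : ℕ, k ≠ 0 → q ^ k ≠ 1) (M i : ℕ) :
    qpar q M i - (qpar q M i)⁻¹ ≠ 0 := by
  intro h
  have h1 := qpar_ne q hq0 M i
  apply qpar_z_ne q hq0 hq1 M i 2 (by norm_num)
  have : qpar q M i = (qpar q M i)⁻¹ := sub_eq_zero.1 h
  rw [zpow_ofNat, sq]
  nth_rw 1 [this]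
  exact inv_mul_cancel₀ h1

def DD (q : ℂ) (hq0 : q ≠ 0) (hq1 : ∀ k : ℕ, k ≠ 0 → q ^ k ≠ 1) (M N : ℕ) : Dat (Idx M N) where
  pr i j := q ^ (-cc M i.1 j.1)
  sg i j := sgn M i.1 j.1
  ka i := qpar q M i.1 - (qpar q M i.1)⁻¹
  pr_ne i j := zpow_ne_zero _ hq0
  pr_symm i j := by rw [cc_symm]
  sg_sq i j := by unfold sgn; split_ifs <;> norm_num
  sg_symm i j := by
    unfold sgn
    simp only [and_comm]
  ka_ne i := ka_ne' q hq0 hq1 M i.1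

variable (q : ℂ) (hq0 : q ≠ 0) (hq1 : ∀ k : ℕ, k ≠ 0 → q ^ k ≠ 1) (M N : ℕ) (W : HWD (Idx M N))

theorem dco_qint (i j : Idx M N) (s : ℤ) : dco (DD q hq0 hq1 M N) i j s =
    - (qint (qpar q M i.1) (s * lof M i.1 * cc M i.1 j.1) / (s : ℂ)) := by
  have e : ∀ k : ℤ, qpar q M i.1 ^ (k * lof M i.1 * cc M i.1 j.1) = q ^ (k * cc M i.1 j.1) := by
    intro k
    rw [qpar, ← zpow_mul]
    congr 1
    linear_combination (k * cc M i.1 j.1) * lof_sq M i.1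
  unfold dco qint
  have e2 := e (-s)
  rw [show -s * lof M i.1 * cc M i.1 j.1 = -(s * lof M i.1 * cc M i.1 j.1) by ring] at e2
  rw [e, e2]
  simp only [DD]
  rw [← zpow_mul, ← zpow_mul, div_div, ← neg_div]
  congr 1
  rw [neg_sub]
  congr 2 <;> ring

/-- action of generators on the tensor space -/
def genOp : Gen M N false → Module.End ℂ (TT (Idx M N))
  | Gen.Xp i n => XO (DD q hq0 hq1 M N) W i n
  | Gen.Xm i n => Xm i n
  | Gen.K i => KO (DD q hq0 hq1 M N) W 1 i
  | Gen.Ki i => KO (DD q hq0 hq1 M N) W (-1) i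
  | Gen.H i s => HO (DD q hq0 hq1 M N) W i s.1
  | Gen.K0 _ => 0
  | Gen.K0i _ => 0

def Th : FA M N false →ₐ[ℂ] Module.End ℂ (TT (Idx M N)) := FreeAlgebra.lift ℂ (genOp q hq0 hq1 M N W)

@[simp] theorem Th_gi (g : Gen M N false) : Th q hq0 hq1 M N W (gi g) = genOp q hq0 hq1 M N W g := by
  simp [Th, gi]

theorem expC_map {A B : Type} [Ring A] [Algebra ℂ A] [Ring B] [Algebra ℂ B] (φ : A →ₐ[ℂ] B) (t : ℂ) (a : ℕ → A)
    (b : ℕ → B) (h : ∀ s, φ (a (s + 1)) = b (s + 1)) (k : ℕ) : φ (expC t a k) = expC t b k := by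
  induction k using Nat.strong_induction_on with
  | _ k ih =>
    cases k with
    | zero => rw [expC_zero, expC_zero, map_one]
    | succ n =>
      rw [expC_succ, expC_succ, map_smul, map_smul, map_sum]
      congr 2
      refine Finset.sum_congr rfl fun s hs => ?_
      rw [map_smul, map_mul, h, ih _ (by omega)]

theorem Th_phiP (i : Idx M N) (n : ℤ) : Th q hq0 hq1 M N W (phiPF q M N false i.1 n) =
    if 0 ≤ n then PhO (DD q hq0 hq1 M N) W 1 i n.toNat else 0 := by
  rw [phiPF]
  split_ifs with h
  · rw [map_mul, PhO_eq _ _ _ (Or.inl rfl), KF, dif_pos i.2, Th_gi]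
    congr 1
    rw [show ((1:ℤ):ℂ) * (DD q hq0 hq1 M N).ka i = qpar q M i.1 - (qpar q M i.1)⁻¹ by simp [DD]]
    refine expC_map (A := FA M N false) (B := Module.End ℂ (TT (Idx M N))) (Th q hq0 hq1 M N W) _ _ _ (fun s => ?_) _
    rw [HF, dif_pos ⟨i.2, by omega⟩, Th_gi]
    simp [genOp]
  · simp

theorem Th_phiM (i : Idx M N) (n : ℤ) : Th q hq0 hq1 M N W (phiMF q M N false i.1 n) =
    if n ≤ 0 then PhO (DD q hq0 hq1 M N) W (-1) i (-n).toNat else 0 := by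
  rw [phiMF]
  split_ifs with h
  · rw [map_mul, PhO_eq _ _ _ (Or.inr rfl), KiF, dif_pos i.2, Th_gi]
    congr 1
    rw [show ((-1:ℤ):ℂ) * (DD q hq0 hq1 M N).ka i = -(qpar q M i.1 - (qpar q M i.1)⁻¹) by simp [DD]]
    refine expC_map (A := FA M N false) (B := Module.End ℂ (TT (Idx M N))) (Th q hq0 hq1 M N W) _ _ _ (fun s => ?_) _
    rw [HF, dif_pos ⟨i.2, by omega⟩, Th_gi]
    simp [genOp]
  · simp

variable (c0 : Idx M N) (J : Ideal (LaurentPolynomial ℂ))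

abbrev NQ := NS (DD q hq0 hq1 M N) W c0 J

theorem genOp_NS (g : Gen M N false) (x : TT (Idx M N)) (hx : x ∈ NQ q hq0 hq1 M N W c0 J) :
    genOp q hq0 hq1 M N W g x ∈ NQ q hq0 hq1 M N W c0 J := by
  cases g with
  | Xp i n => exact XO_NS _ _ _ _ _ _ _ hx
  | Xm i n => exact Xm_NS _ _ _ _ _ _ _ hx
  | K i => exact KO_NS _ _ _ _ _ _ _ hx
  | Ki i => exact KO_NS _ _ _ _ _ _ _ hx
  | H i s => exact HO_NS _ _ _ _ _ _ _ hx
  | K0 h => exact absurd h (by simp)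
  | K0i h => exact absurd h (by simp)

def ThQ : FA M N false →ₐ[ℂ] Module.End ℂ (TT (Idx M N) ⧸ NQ q hq0 hq1 M N W c0 J) :=
  FreeAlgebra.lift ℂ fun g => (NQ q hq0 hq1 M N W c0 J).mapQ (NQ q hq0 hq1 M N W c0 J)
    (genOp q hq0 hq1 M N W g) (genOp_NS q hq0 hq1 M N W c0 J g)

theorem ThQ_mk (a : FA M N false) : ∀ v : TT (Idx M N), ThQ q hq0 hq1 M N W c0 J a
    ((NQ q hq0 hq1 M N W c0 J).mkQ v) = (NQ q hq0 hq1 M N W c0 J).mkQ (Th q hq0 hq1 M N W a v) := by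
  induction a using FreeAlgebra.induction with
  | grade0 r => intro v; simp [Module.algebraMap_end_apply]
  | grade1 g => intro v; simp [ThQ, Th]
  | mul a b ha hb => intro v; rw [map_mul, map_mul, Module.End.mul_apply, Module.End.mul_apply, hb, ha]
  | add a b ha hb => intro v; rw [map_add, map_add, LinearMap.add_apply, LinearMap.add_apply, hb, ha, map_add]

theorem Th_rel [Nonempty (Idx M N)] (a b : FA M N false) (h : rel q M N false 3 a b) (v : TT (Idx M N)) :
    Th q hq0 hq1 M N W a v - Th q hq0 hq1 M N W b v ∈ NQ q hq0 hq1 M N W c0 J := by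
  have fromI : ∀ {x : TT (Idx M N)}, x ∈ QW.Isub (DD q hq0 hq1 M N) → x ∈ NQ q hq0 hq1 M N W c0 J :=
    fun {x} hx => Isub_NS _ _ _ _ x hx
  have from0 : ∀ {x : TT (Idx M N)}, x = 0 → x ∈ NQ q hq0 hq1 M N W c0 J := by
    intro x hx; rw [hx]; exact Submodule.zero_mem _
  have hpr : ∀ i j : Idx M N, (DD q hq0 hq1 M N).pr i j = q ^ (-cc M i.1 j.1) := fun _ _ => rfl
  have hsg : ∀ i j : Idx M N, (DD q hq0 hq1 M N).sg i j = sgn M i.1 j.1 := fun _ _ => rfl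
  have hsg1 : ∀ i j : Idx M N, (i.1 ≠ M ∨ j.1 ≠ M) → sgn M i.1 j.1 = 1 := by
    intro i j h; unfold sgn; rw [if_neg (by tauto)]
  have hcs : ∀ i j : Idx M N, cc M i.1 j.1 ≠ 0 → sgn M i.1 j.1 = 1 := by
    intro i j h
    apply hsg1
    by_contra hc
    push Not at hc
    rw [hc.1, hc.2, cc_MM] at h
    exact h rfl
  have comm0 : ∀ {A B : Module.End ℂ (TT (Idx M N))}, A = B → A v - B v ∈ NQ q hq0 hq1 M N W c0 J := by
    intro A B h; rw [h, sub_self]; exact Submodule.zero_mem _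
  cases h with
  | KKi i =>
    apply comm0
    simp only [map_mul, Th_gi, genOp, map_one]
    exact K_inv _ _ _ (by simp [W.ke_ne i]) _ _
  | KiK i =>
    apply comm0
    simp only [map_mul, Th_gi, genOp, map_one]
    have := K_inv (DD q hq0 hq1 M N) (W.ke i ^ (-1 : ℤ)) (W.ke i ^ (1 : ℤ)) (by simp [W.ke_ne i]) (-1) i
    simpa [KO] using this
  | KK i j => apply comm0; simp only [map_mul, Th_gi, genOp]; exact KK_comm _ _ _ _ _ _ _
  | KKi2 i j => apply comm0; simp only [map_mul, Th_gi, genOp]; exact KK_comm _ _ _ _ _ _ _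
  | KiKi i j => apply comm0; simp only [map_mul, Th_gi, genOp]; exact KK_comm _ _ _ _ _ _ _
  | KH i j s => apply comm0; simp only [map_mul, Th_gi, genOp]; exact KH_comm _ _ _ _ _ _ _
  | KiH i j s => apply comm0; simp only [map_mul, Th_gi, genOp]; exact KH_comm _ _ _ _ _ _ _
  | HH i j s t => apply comm0; simp only [map_mul, Th_gi, genOp]; exact HH_comm _ _ _ _ _ _ _
  | KXp i j n =>
    apply from0
    simp only [map_mul, map_smul, Th_gi, genOp, Module.End.mul_apply, LinearMap.smul_apply]
    rw [KO_XO_apply, smul_smul, hpr, zpow_one, ← zpow_add₀ hq0, add_neg_cancel, zpow_zero, one_smul, sub_self]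
  | KXm i j n =>
    apply from0
    simp only [map_mul, map_smul, Th_gi, genOp, Module.End.mul_apply, LinearMap.smul_apply]
    rw [KO, Kop_Xm_apply, hpr, zpow_one, zpow_one, sub_self]
  | HXp i j s n =>
    apply from0
    simp only [map_mul, map_sub, map_smul, Th_gi, genOp, Module.End.mul_apply, LinearMap.smul_apply,
      LinearMap.sub_apply]
    rw [HO_XO_apply, dco_qint]
    module
  | HXm i j s n =>
    apply from0
    simp only [map_mul, map_sub, map_neg, map_smul, Th_gi, genOp, Module.End.mul_apply, LinearMap.smul_apply,
      LinearMap.sub_apply, LinearMap.neg_apply]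
    rw [HO, Hop_Xm_apply, dco_qint]
    module
  | XpXm i j m n =>
    apply from0
    simp only [map_mul, map_sub, map_smul, Th_gi, genOp, Module.End.mul_apply, LinearMap.smul_apply,
      LinearMap.sub_apply]
    rw [XOXm_apply, hsg]
    split_ifs with hij
    · rw [phZ_apply, map_smul, map_sub, Th_phiP, Th_phiM, LinearMap.smul_apply, LinearMap.sub_apply]
      have : (DD q hq0 hq1 M N).ka i = qpar q M i.1 - (qpar q M i.1)⁻¹ := rfl
      rw [this]
      split_ifs <;> simp
    · simp
  | XX0p i j m n h2 h =>
    apply from0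
    simp only [map_mul, map_sub, map_smul, map_zero, Th_gi, genOp, Module.End.mul_apply, LinearMap.smul_apply,
      LinearMap.sub_apply, LinearMap.zero_apply]
    rw [rp_quad0 _ _ _ _ _ _ (by rw [hpr, h]; simp), hsg]
    simp
  | XX0m i j m n h2 h =>
    simp only [map_mul, map_sub, map_smul, map_zero, Th_gi, genOp, Module.End.mul_apply, LinearMap.smul_apply,
      LinearMap.sub_apply, LinearMap.zero_apply, sub_zero]
    exact fromI (rm_quad0 (DD q hq0 hq1 M N) i j m n (by rw [hpr, h]; simp) v)
  | XXp i j m n h2 h =>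
    apply from0
    simp only [map_mul, map_sub, map_smul, map_zero, Th_gi, genOp, Module.End.mul_apply, LinearMap.smul_apply,
      LinearMap.sub_apply, LinearMap.zero_apply]
    have := rp_quad1 (DD q hq0 hq1 M N) W i j m n (by rw [hsg, hcs i j h]) v
    rw [hpr, zpow_neg] at this
    have hne : q ^ cc M i.1 j.1 ≠ 0 := zpow_ne_zero _ hq0
    have h' := congrArg (fun x => (-q ^ cc M i.1 j.1) • x) this
    simp only [smul_zero] at h'
    rw [← h']
    simp only [smul_sub, smul_add, smul_smul, neg_mul, mul_inv_cancel₀ hne]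
    module
  | XXm i j m n h2 h =>
    simp only [map_mul, map_sub, map_smul, map_zero, Th_gi, genOp, Module.End.mul_apply, LinearMap.smul_apply,
      LinearMap.sub_apply, LinearMap.zero_apply]
    have := fromI (rm_quad1 (DD q hq0 hq1 M N) i j m n (by rw [hsg, hcs i j h]) v)
    rw [hpr] at this
    convert this using 1
    module
  | serreP i j m n k h3 h hi =>
    apply from0
    simp only [brF, map_mul, map_add, map_sub, map_smul, map_zero, Th_gi, genOp, Module.End.mul_apply, LinearMap.smul_apply,
      LinearMap.sub_apply, LinearMap.add_apply, LinearMap.zero_apply, sub_zero]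
    have := rp_serre (DD q hq0 hq1 M N) W i j m n k (by rw [hsg, hsg1 i j (Or.inl hi)])
      (by rw [hsg, hsg1 i i (Or.inl hi)]) (by
        rw [hpr, hpr, cc_serre M _ _ h hi, ← zpow_natCast, ← zpow_mul, ← zpow_neg]; congr 1; push_cast; ring)
      (q + q⁻¹) (by rw [hpr]; rcases h with h | h <;> rw [h] <;> simp [add_comm]) v
    rw [← this]
    simp only [smul_sub, smul_smul, mul_inv_cancel₀ hq0]
    module
  | serreM i j m n k h3 h hi =>
    simp only [brF, map_mul, map_add, map_sub, map_smul, map_zero, Th_gi, genOp, Module.End.mul_apply, LinearMap.smul_apply,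
      LinearMap.sub_apply, LinearMap.add_apply, LinearMap.zero_apply, sub_zero]
    have := fromI (rm_serre (DD q hq0 hq1 M N) i j m n k (by rw [hsg, hsg1 i j (Or.inl hi)])
      (by rw [hsg, hsg1 i i (Or.inl hi)]) (by
        rw [hpr, hpr, cc_serre M _ _ h hi, ← zpow_natCast, ← zpow_mul, ← zpow_neg]; congr 1; push_cast; ring)
      (q + q⁻¹) (by rw [hpr]; rcases h with h | h <;> rw [h] <;> simp [add_comm]) v)
    convert this using 1
    simp only [smul_sub, smul_smul, mul_inv_cancel₀ hq0]
    module
  | oscP m n k u h3 hM hN =>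
    apply from0
    have b1 : 1 ≤ M - 1 ∧ M - 1 ≤ M + N - 1 := by omega
    have b2 : 1 ≤ M ∧ M ≤ M + N - 1 := by omega
    have b3 : 1 ≤ M + 1 ∧ M + 1 ≤ M + N - 1 := by omega
    have c13 : cc M (M - 1) (M + 1) = 0 := by
      unfold cc form4 innerE lof; split_ifs <;> omega
    have c23 : cc M M (M + 1) = 1 := by
      unfold cc form4 innerE lof; split_ifs <;> omega
    have c12 : cc M (M - 1) M = -1 := by
      unfold cc form4 innerE lof; split_ifs <;> omega
    simp only [oscOf, XpF, dif_pos b1, dif_pos b2, dif_pos b3, brF, map_mul, map_add, map_sub, map_smul, map_zero,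
      Th_gi, genOp, Module.End.mul_apply, LinearMap.smul_apply,
      LinearMap.sub_apply, LinearMap.add_apply, LinearMap.zero_apply, sub_zero]
    have := rp_osc (DD q hq0 hq1 M N) W ⟨M - 1, b1⟩ ⟨M, b2⟩ ⟨M + 1, b3⟩ m n k u q⁻¹ q
      (by rw [hpr, c13]; simp) (by rw [hpr, hpr, c23, c12]; simp) (by rw [hpr, cc_MM]; simp)
      (by rw [hsg, hsg1 _ _ (by left; simp; omega)]) (by rw [hsg, hsg1 _ _ (by left; simp; omega)])
      (by rw [hsg, hsg1 _ _ (by right; simp)]) (by rw [hsg]; simp [sgn])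
      (by rw [hpr, c12]; simp [add_comm]) v _ _ _ _ rfl rfl rfl rfl
    rw [← this]
    simp only [smul_sub, smul_smul, mul_inv_cancel₀ hq0]
    module
  | oscM m n k u h3 hM hN =>
    have b1 : 1 ≤ M - 1 ∧ M - 1 ≤ M + N - 1 := by omega
    have b2 : 1 ≤ M ∧ M ≤ M + N - 1 := by omega
    have b3 : 1 ≤ M + 1 ∧ M + 1 ≤ M + N - 1 := by omega
    have c13 : cc M (M - 1) (M + 1) = 0 := by
      unfold cc form4 innerE lof; split_ifs <;> omega
    have c23 : cc M M (M + 1) = 1 := by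
      unfold cc form4 innerE lof; split_ifs <;> omega
    have c12 : cc M (M - 1) M = -1 := by
      unfold cc form4 innerE lof; split_ifs <;> omega
    simp only [oscOf, XmF, dif_pos b1, dif_pos b2, dif_pos b3, brF, map_mul, map_add, map_sub, map_smul, map_zero,
      Th_gi, genOp, Module.End.mul_apply, LinearMap.smul_apply,
      LinearMap.sub_apply, LinearMap.add_apply, LinearMap.zero_apply, sub_zero]
    have := fromI (rm_osc (DD q hq0 hq1 M N) ⟨M - 1, b1⟩ ⟨M, b2⟩ ⟨M + 1, b3⟩ m n k u q⁻¹ q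
      (by rw [hpr, c13]; simp) (by rw [hpr, hpr, c23, c12]; simp) (by rw [hpr, cc_MM]; simp)
      (by rw [hsg, hsg1 _ _ (by left; simp; omega)]) (by rw [hsg, hsg1 _ _ (by left; simp; omega)])
      (by rw [hsg, hsg1 _ _ (by right; simp)]) (by rw [hsg]; simp [sgn])
      (by rw [hpr, c12]; simp [add_comm]) v _ _ _ _ rfl rfl rfl rfl)
    convert this using 1
    simp only [smul_sub, smul_smul, mul_inv_cancel₀ hq0]
    module
  | K0K0i he => exact absurd he (by simp)
  | K0iK0 he => exact absurd he (by simp)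
  | K0K he i => exact absurd he (by simp)
  | K0Ki he i => exact absurd he (by simp)
  | K0H he i s => exact absurd he (by simp)
  | K0Xp he i n => exact absurd he (by simp)
  | K0Xm he i n => exact absurd he (by simp)

end QW
end

noncomputable section
namespace QW
set_option linter.unusedSectionVars false
set_option linter.unusedSimpArgs false
open Finset QAS

theorem exists_log (t : ℂ) (ht : t ≠ 0) (G : ℕ → ℂ) (hG : G 0 = 1) :
    ∃ a : ℕ → ℂ, ∀ n, QAS.expC t a n = G n := by
  let S : PowerSeries ℂ := PowerSeries.mk G
  have hS : PowerSeries.constantCoeff S ≠ 0 := by simp [S, hG]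
  let A : PowerSeries ℂ := PowerSeries.mk (fun n => ((n : ℂ) + 1) * G (n + 1)) * S⁻¹
  have hA : A * S = PowerSeries.mk (fun n => ((n : ℂ) + 1) * G (n + 1)) := by
    simp only [A]; rw [mul_assoc, PowerSeries.inv_mul_cancel _ hS, mul_one]
  refine ⟨fun s => PowerSeries.coeff (s - 1) A / (t * s), ?_⟩
  intro n
  induction n using Nat.strong_induction_on with
  | _ n ih =>
    cases n with
    | zero => rw [expC_zero, hG]
    | succ n =>
      rw [expC_succ]
      have h := congrArg (PowerSeries.coeff n) hA
      rw [PowerSeries.coeff_mul, PowerSeries.coeff_mk,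
        Finset.Nat.sum_antidiagonal_eq_sum_range_succ_mk] at h
      have hn : (n : ℂ) + 1 ≠ 0 := by exact_mod_cast Nat.succ_ne_zero n
      have : t • ∑ s ∈ Finset.range (n + 1), ((s : ℂ) + 1) • (PowerSeries.coeff (s + 1 - 1) A / (t * ((s + 1 : ℕ) : ℂ)) *
          QAS.expC t (fun s => PowerSeries.coeff (s - 1) A / (t * s)) (n - s)) = ((n : ℂ) + 1) * G (n + 1) := by
        rw [← h, Finset.smul_sum]
        refine Finset.sum_congr rfl fun s hs => ?_
        rw [ih (n - s) (by omega)]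
        have hs1 : (s : ℂ) + 1 ≠ 0 := by exact_mod_cast Nat.succ_ne_zero s
        simp only [S, PowerSeries.coeff_mk, smul_eq_mul, Nat.add_sub_cancel]
        push_cast
        field_simp
      rw [this, smul_eq_mul]
      field_simp

theorem exists_HWD {ι : Type} (D : Dat ι) (ke : ι → ℂ) (hke : ∀ i, ke i ≠ 0) (gp gm : ι → ℕ → ℂ)
    (hp : ∀ i, gp i 0 = ke i) (hm : ∀ i, gm i 0 = (ke i)⁻¹) :
    ∃ W : HWD ι, W.ke = ke ∧ gam D W 1 = gp ∧ gam D W (-1) = gm := by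
  have h1 : ∀ i, ∃ a : ℕ → ℂ, ∀ n, QAS.expC (((1 : ℤ) : ℂ) * D.ka i) a n = (ke i)⁻¹ * gp i n := fun i =>
    exists_log _ (by simpa using D.ka_ne i) _ (by rw [hp]; exact inv_mul_cancel₀ (hke i))
  have h2 : ∀ i, ∃ a : ℕ → ℂ, ∀ n, QAS.expC (((-1 : ℤ) : ℂ) * D.ka i) a n = ke i * gm i n := fun i =>
    exists_log _ (by simpa using D.ka_ne i) _ (by rw [hm]; exact mul_inv_cancel₀ (hke i))
  choose a ha using h1
  choose b hb using h2
  refine ⟨⟨ke, hke, fun i m => if 0 < m then a i m.toNat else b i (-m).toNat⟩, rfl, ?_, ?_⟩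
  · funext i k
    unfold gam
    have := expC_map (AlgHom.id ℂ ℂ) (((1 : ℤ) : ℂ) * D.ka i)
      (fun s => if (0 : ℤ) < 1 * (s : ℤ) then a i (1 * (s : ℤ)).toNat else b i (-(1 * (s : ℤ))).toNat) (a i)
      (fun s => by simp) k
    simp only [AlgHom.id_apply] at this
    rw [this, ha]
    simp [hke i]
  · funext i k
    unfold gam
    have := expC_map (AlgHom.id ℂ ℂ) (((-1 : ℤ) : ℂ) * D.ka i)
      (fun s => if (0 : ℤ) < -1 * (s : ℤ) then a i (-1 * (s : ℤ)).toNat else b i (-(-1 * (s : ℤ))).toNat) (b i)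
      (fun s => by
        rw [if_neg (by push_cast; omega)]; simp) k
    simp only [AlgHom.id_apply] at this
    rw [this, hb]
    simp [hke i]

variable (q : ℂ) (hq0 : q ≠ 0) (hq1 : ∀ k : ℕ, k ≠ 0 → q ^ k ≠ 1) (M N : ℕ) (W : HWD (Idx M N))
  (c0 : Idx M N) (J : Ideal (LaurentPolynomial ℂ))

def ThA [Nonempty (Idx M N)] : ALG q M N false 3 →ₐ[ℂ] Module.End ℂ (TT (Idx M N) ⧸ NQ q hq0 hq1 M N W c0 J) :=
  RingQuot.liftAlgHom ℂ ⟨ThQ q hq0 hq1 M N W c0 J, by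
    intro a b h
    refine LinearMap.ext fun v => ?_
    obtain ⟨v, rfl⟩ := Submodule.mkQ_surjective _ v
    rw [ThQ_mk, ThQ_mk, ← sub_eq_zero, ← map_sub, Submodule.mkQ_apply, Submodule.Quotient.mk_eq_zero]
    exact Th_rel q hq0 hq1 M N W c0 J a b h v⟩

theorem ThA_mk [Nonempty (Idx M N)] (a : FA M N false) :
    ThA q hq0 hq1 M N W c0 J (mkA q M N false 3 a) = ThQ q hq0 hq1 M N W c0 J a := by
  unfold ThA mkA
  exact RingQuot.liftAlgHom_mkAlgHom_apply ..

def AnnI [Nonempty (Idx M N)] : Ideal (ALG q M N false 3) where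
  carrier := {x | ThA q hq0 hq1 M N W c0 J x (Submodule.mkQ _ (wd [])) = 0}
  zero_mem' := by simp
  add_mem' := by
    intro a b ha hb
    simp only [Set.mem_ofPred_eq] at *
    rw [map_add, LinearMap.add_apply, ha, hb, add_zero]
  smul_mem' := by
    intro a b hb
    simp only [Set.mem_ofPred_eq, smul_eq_mul] at *
    rw [map_mul, Module.End.mul_apply, hb, map_zero]

theorem mem_AnnI [Nonempty (Idx M N)] (a : FA M N false) : mkA q M N false 3 a ∈ AnnI q hq0 hq1 M N W c0 J ↔
    Th q hq0 hq1 M N W a (wd []) ∈ NQ q hq0 hq1 M N W c0 J := by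
  change ThA q hq0 hq1 M N W c0 J _ _ = 0 ↔ _
  rw [ThA_mk, ThQ_mk, Submodule.mkQ_apply, Submodule.Quotient.mk_eq_zero]

end QW
end

noncomputable section
namespace QW
set_option linter.unusedSectionVars false
set_option linter.unusedSimpArgs false
open Finset

/-! partial fractions -/
def rsd (R : Finset ℕ) (x u : ℕ → ℂ) (s : ℕ) : ℂ :=
  (x s - (x s)⁻¹) * ∏ b ∈ R.erase s, (x b * u s - (x b)⁻¹ * u b) / (u s - u b)

theorem rsd_insert_self (R : Finset ℕ) (x u : ℕ → ℂ) (s : ℕ) (hs : s ∉ R) :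
    rsd (insert s R) x u s = (x s - (x s)⁻¹) * ∏ b ∈ R, (x b * u s - (x b)⁻¹ * u b) / (u s - u b) := by
  rw [rsd, Finset.erase_insert hs]

theorem rsd_insert (R : Finset ℕ) (x u : ℕ → ℂ) (s t : ℕ) (hs : s ∉ R) (ht : t ∈ R) :
    rsd (insert s R) x u t = (x s * u t - (x s)⁻¹ * u s) / (u t - u s) * rsd R x u t := by
  have hst : s ≠ t := fun h => hs (h ▸ ht)
  rw [rsd, Finset.erase_insert_of_ne hst, Finset.prod_insert (fun h => hs (Finset.mem_of_mem_erase h)), rsd]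
  ring

theorem pf_eval (R : Finset ℕ) (x u : ℕ → ℂ) (hu : Set.InjOn u R) : ∀ w : ℂ, (∀ s ∈ R, w ≠ u s) →
    ∏ s ∈ R, (x s * w - (x s)⁻¹ * u s) / (w - u s) =
      ∏ s ∈ R, (x s)⁻¹ + ∑ s ∈ R, rsd R x u s * (w / (w - u s)) := by
  induction R using Finset.induction_on with
  | empty => intro w _; simp
  | insert s0 R hs ih =>
    intro w hw
    have hu' : Set.InjOn u R := hu.mono (by simp)
    have hne : ∀ s ∈ R, u s0 - u s ≠ 0 := fun s hsR h => hs (by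
      have := hu (by simp) (by simp [hsR]) (sub_eq_zero.1 h)
      rwa [this])
    have h1 := ih hu' w (fun s h => hw s (Finset.mem_insert_of_mem h))
    have h2 := ih hu' (u s0) (fun s h => sub_ne_zero.1 (hne s h))
    have hw0 : w - u s0 ≠ 0 := sub_ne_zero.2 (hw s0 (by simp))
    rw [Finset.prod_insert hs, Finset.prod_insert hs, Finset.sum_insert hs, h1, rsd_insert_self _ _ _ _ hs, h2]
    have e3 : ∑ t ∈ R, rsd (insert s0 R) x u t * (w / (w - u t)) =
        ∑ t ∈ R, (x s0 * u t - (x s0)⁻¹ * u s0) / (u t - u s0) * rsd R x u t * (w / (w - u t)) :=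
      Finset.sum_congr rfl fun t ht => by rw [rsd_insert R x u s0 t hs ht]
    rw [e3]
    rw [mul_add, mul_add, add_mul, Finset.mul_sum, Finset.mul_sum, Finset.sum_mul]
    have e1 : (x s0 * w - (x s0)⁻¹ * u s0) / (w - u s0) = (x s0)⁻¹ + (x s0 - (x s0)⁻¹) * (w / (w - u s0)) := by
      generalize (x s0)⁻¹ = y
      field_simp; ring
    have e2 : ∀ t ∈ R, (x s0 * w - (x s0)⁻¹ * u s0) / (w - u s0) * (rsd R x u t * (w / (w - u t))) =
        (x s0 - (x s0)⁻¹) * (rsd R x u t * (u s0 / (u s0 - u t))) * (w / (w - u s0)) +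
        (x s0 * u t - (x s0)⁻¹ * u s0) / (u t - u s0) * rsd R x u t * (w / (w - u t)) := by
      intro t ht
      have h3 := hne t ht
      have h4 : w - u t ≠ 0 := sub_ne_zero.2 (hw t (by simp [ht]))
      have h5 : u t - u s0 = -(u s0 - u t) := by ring
      rw [h5]
      generalize (x s0)⁻¹ = y
      field_simp; ring
    rw [Finset.sum_congr rfl e2, Finset.sum_add_distrib, e1]
    ring

def geo (u : ℂ) : PowerSeries ℂ := PowerSeries.mk fun k => u ^ k

theorem geo_eq (u : ℂ) : (1 - PowerSeries.C u * PowerSeries.X) * geo u = 1 := by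
  ext n
  rw [sub_mul, one_mul, map_sub, mul_assoc, PowerSeries.coeff_C_mul]
  cases n with
  | zero => simp [geo]
  | succ n => rw [PowerSeries.coeff_succ_X_mul]; simp [geo, pow_succ, PowerSeries.coeff_one]; ring

open PowerSeries in
theorem geo_ne (u : ℂ) : (1 - C u * X : PowerSeries ℂ) ≠ 0 := fun h => by
  have := geo_eq u; rw [h] at this; simp at this

def fac (x u : ℂ) : PowerSeries ℂ := (PowerSeries.C x - PowerSeries.C (x⁻¹ * u) * PowerSeries.X) * geo u

open PowerSeries in
theorem fac_eq (x u : ℂ) : fac x u = C x⁻¹ + C (x - x⁻¹) * geo u := by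
  apply mul_left_cancel₀ (geo_ne u)
  have h := geo_eq u
  unfold fac
  simp only [map_mul, map_sub]
  generalize geo u = g at *
  linear_combination (C x - C x⁻¹ * C u * X - (C x - C x⁻¹)) * h

open PowerSeries in
theorem geo_mul (u w : ℂ) (h : u - w ≠ 0) : geo u * geo w = C (u / (u - w)) * geo u - C (w / (u - w)) * geo w := by
  apply mul_left_cancel₀ (geo_ne u)
  apply mul_left_cancel₀ (geo_ne w)
  have h1 := geo_eq u
  have h2 := geo_eq w
  have e : C (u / (u - w)) - C (w / (u - w)) = (1 : PowerSeries ℂ) := by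
    rw [← map_sub, ← sub_div, div_self h, map_one]
  have e' : C (u / (u - w)) * C w = C (w / (u - w)) * (C u : PowerSeries ℂ) := by
    rw [← map_mul, ← map_mul]; congr 1; ring
  generalize geo u = g at *
  generalize geo w = k at *
  linear_combination (1 - C w * X) * k * h1 + h2 - C (u / (u - w)) * (1 - C w * X) * h1 + C (w / (u - w)) * (1 - C u * X) * h2 - e + e' * X

open PowerSeries in
theorem pf_ser (R : Finset ℕ) (x u : ℕ → ℂ) (hu : Set.InjOn u R) :
    ∏ s ∈ R, fac (x s) (u s) = C (∏ s ∈ R, (x s)⁻¹) + ∑ s ∈ R, C (rsd R x u s) * geo (u s) := by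
  induction R using Finset.induction_on with
  | empty => simp
  | insert s0 R hs ih =>
    have hu' : Set.InjOn u R := hu.mono (by simp)
    have hne : ∀ s ∈ R, u s0 - u s ≠ 0 := fun s hsR h => hs (by
      have := hu (by simp) (by simp [hsR]) (sub_eq_zero.1 h)
      rwa [this])
    have h2 := pf_eval R x u hu' (u s0) (fun s h => sub_ne_zero.1 (hne s h))
    rw [Finset.prod_insert hs, Finset.prod_insert hs, Finset.sum_insert hs, ih hu', rsd_insert_self _ _ _ _ hs, h2]
    have e3 : ∑ t ∈ R, C (rsd (insert s0 R) x u t) * geo (u t) =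
        ∑ t ∈ R, C ((x s0 * u t - (x s0)⁻¹ * u s0) / (u t - u s0) * rsd R x u t) * geo (u t) :=
      Finset.sum_congr rfl fun t ht => by rw [rsd_insert R x u s0 t hs ht]
    rw [e3]
    have e2 : ∀ t ∈ R, fac (x s0) (u s0) * (C (rsd R x u t) * geo (u t)) =
        C (x s0 - (x s0)⁻¹) * C (rsd R x u t * (u s0 / (u s0 - u t))) * geo (u s0) +
        C ((x s0 * u t - (x s0)⁻¹ * u s0) / (u t - u s0) * rsd R x u t) * geo (u t) := by
      intro t ht
      have h3 := hne t ht
      have h4 := geo_mul (u s0) (u t) h3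
      have h5 : (x s0 * u t - (x s0)⁻¹ * u s0) / (u t - u s0) =
         (x s0)⁻¹ - (x s0 - (x s0)⁻¹) * (u t / (u s0 - u t)) := by
        rw [show u t - u s0 = -(u s0 - u t) by ring]
        generalize (x s0)⁻¹ = y
        field_simp; ring
      rw [fac_eq, h5]
      simp only [map_mul, map_sub] at h4 ⊢
      linear_combination (C (x s0) - C (x s0)⁻¹) * C (rsd R x u t) * h4
    rw [mul_add, Finset.mul_sum, Finset.sum_congr rfl e2, Finset.sum_add_distrib, fac_eq]
    simp only [map_mul, map_add, map_sum, Finset.mul_sum, Finset.sum_mul, mul_add, add_mul, map_sub, ← Finset.sum_sub_distrib]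
    ring

theorem pf_coeff (R : Finset ℕ) (x u : ℕ → ℂ) (hu : Set.InjOn u R) (k : ℕ) :
    PowerSeries.coeff k (∏ s ∈ R, fac (x s) (u s)) =
      (if k = 0 then ∏ s ∈ R, (x s)⁻¹ else 0) + ∑ s ∈ R, rsd R x u s * u s ^ k := by
  rw [pf_ser R x u hu, map_add, map_sum, PowerSeries.coeff_C]
  simp only [PowerSeries.coeff_C_mul, geo, PowerSeries.coeff_mk]

theorem rsd_inv (R : Finset ℕ) (x u : ℕ → ℂ) (hu : Set.InjOn u R) (h0 : ∀ s ∈ R, u s ≠ 0) (s : ℕ) (hs : s ∈ R) :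
    rsd R (fun s => (x s)⁻¹) (fun s => (u s)⁻¹) s = - rsd R x u s := by
  unfold rsd
  rw [inv_inv, ← neg_mul, neg_sub]
  congr 1
  refine Finset.prod_congr rfl fun b hb => ?_
  have hb' := Finset.mem_of_mem_erase hb
  have h1 := h0 s hs
  have h2 := h0 b hb'
  have h3 : u s - u b ≠ 0 := fun h => Finset.ne_of_mem_erase hb (hu hb' hs (sub_eq_zero.1 h).symm)
  have h4 : (u s)⁻¹ - (u b)⁻¹ = -(u s - u b) / (u s * u b) := by field_simp; ring
  simp only [inv_inv]
  rw [h4]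
  generalize (x b)⁻¹ = y
  rw [div_div_eq_mul_div, div_eq_div_iff (neg_ne_zero.2 h3) h3]
  field_simp
  ring

/-- total eigenvalue -/
theorem phi_tot (R : Finset ℕ) (x u : ℕ → ℂ) (hu : Set.InjOn u R) (h0 : ∀ s ∈ R, u s ≠ 0) (n : ℤ) :
    (if 0 ≤ n then PowerSeries.coeff n.toNat (∏ s ∈ R, fac (x s) (u s)) else 0) -
    (if n ≤ 0 then PowerSeries.coeff (-n).toNat (∏ s ∈ R, fac (x s)⁻¹ (u s)⁻¹) else 0) =
     ∑ s ∈ R, rsd R x u s * u s ^ n := by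
  have hi : Set.InjOn (fun s => (u s)⁻¹) R := fun a ha b hb h => hu ha hb (inv_injective h)
  have hm : ∀ k, PowerSeries.coeff k (∏ s ∈ R, fac (x s)⁻¹ (u s)⁻¹) =
      (if k = 0 then ∏ s ∈ R, x s else 0) - ∑ s ∈ R, rsd R x u s * (u s)⁻¹ ^ k := by
    intro k
    have := pf_coeff R (fun s => (x s)⁻¹) (fun s => (u s)⁻¹) hi k
    simp only [inv_inv] at this
    rw [this, sub_eq_add_neg, ← Finset.sum_neg_distrib]
    congr 1
    refine Finset.sum_congr rfl fun s hs => ?_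
    rw [rsd_inv R x u hu h0 s hs, neg_mul]
  rcases lt_trichotomy n 0 with h | h | h
  · rw [if_neg (by omega), if_pos h.le, hm, if_neg (by omega)]
    simp only [zero_sub, neg_neg]
    refine Finset.sum_congr rfl fun s hs => ?_
    rw [inv_pow, ← zpow_natCast, ← zpow_neg]
    congr 2; omega
  · subst h
    have h1 := pf_coeff R x u hu 0
    have h2 := hm 0
    have h3 : PowerSeries.coeff 0 (∏ s ∈ R, fac (x s) (u s)) = ∏ s ∈ R, x s := by
      rw [PowerSeries.coeff_zero_eq_constantCoeff_apply, map_prod]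
      refine Finset.prod_congr rfl fun s hs => ?_
      simp [fac, geo]
    simp only [le_refl, if_true, Int.toNat_zero, neg_zero, h2] at *
    rw [h3] at h1 ⊢
    simp only [pow_zero, zpow_zero] at *
    linear_combination (0:ℂ) * h1
  · rw [if_pos h.le, if_neg (by omega), pf_coeff R x u hu, if_neg (by omega)]
    simp only [sub_zero, zero_add]
    refine Finset.sum_congr rfl fun s hs => ?_
    rw [← zpow_natCast]
    congr 2; omega

end QW
end

noncomputable section
namespace QW
set_option linter.unusedSectionVars false
set_option linter.unusedSimpArgs false
open Finset

variable {ι : Type} [DecidableEq ι]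

def Ci (i : ι) : Submodule ℂ (TT ι) := Submodule.span ℂ {x | ∃ w : Wd ι, (∀ a ∈ w, a.1 = i) ∧ x = wd w}

theorem Ci_nil (i : ι) : wd [] ∈ Ci i := Submodule.subset_span ⟨[], by simp, rfl⟩

theorem Ci_Xm (i : ι) (n : ℤ) (x : TT ι) (hx : x ∈ Ci i) : Xm i n x ∈ Ci i := by
  unfold Ci at hx
  induction hx using Submodule.span_induction with
  | mem x h =>
    obtain ⟨w, hw, rfl⟩ := h
    rw [Xm_wd]
    refine Submodule.subset_span ⟨_, ?_, rfl⟩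
    intro a ha
    rcases List.mem_cons.1 ha with h | h
    · rw [h]
    · exact hw a h
  | zero => simp
  | add x y _ _ hx hy => rw [map_add]; exact Submodule.add_mem _ hx hy
  | smul c x _ hx => rw [map_smul]; exact Submodule.smul_mem _ _ hx

theorem Ci_ind (i : ι) {p : TT ι → Prop} (h0 : p 0) (hadd : ∀ x y, p x → p y → p (x + y))
    (hs : ∀ (c : ℂ) x, p x → p (c • x)) (hn : p (wd []))
    (hX : ∀ n x, x ∈ Ci i → p x → p (Xm i n x)) (x : TT ι) (hx : x ∈ Ci i) : p x := by
  unfold Ci at hx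
  induction hx using Submodule.span_induction with
  | mem x h =>
    obtain ⟨w, hw, rfl⟩ := h
    induction w with
    | nil => exact hn
    | cons a w ih =>
      obtain ⟨j, n⟩ := a
      have hj : j = i := hw (j, n) (by simp)
      subst hj
      rw [← Xm_wd]
      have h1 : ∀ a ∈ w, a.1 = j := fun a ha => hw a (by simp [ha])
      exact hX _ _ (Submodule.subset_span ⟨w, h1, rfl⟩) (ih h1)
  | zero => exact h0
  | add x y _ _ hx hy => exact hadd _ _ hx hy
  | smul c x _ hx => exact hs _ _ hx

theorem Ci_Phi (D : Dat ι) (ε : ℤ) (i j : ι) (b : ℕ → ℂ) (x : TT ι) (hx : x ∈ Ci i) : ∀ k, Phi D ε j b k x ∈ Ci i := by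
  refine Ci_ind i (p := fun x => ∀ k, Phi D ε j b k x ∈ Ci i) ?_ ?_ ?_ ?_ ?_ x hx
  · intro k; simp
  · intro x y hx hy k; rw [map_add]; exact Submodule.add_mem _ (hx k) (hy k)
  · intro c x hx k; rw [map_smul]; exact Submodule.smul_mem _ _ (hx k)
  · intro k; rw [Phi_nil]; exact Submodule.smul_mem _ _ (Ci_nil i)
  · intro n x hx h k
    have := congrArg (fun A => A x) (Phi_Xm D ε j b k i n)
    simp only [Module.End.mul_apply, LinearMap.sum_apply, LinearMap.smul_apply] at this
    rw [this]
    exact Submodule.sum_mem _ fun a _ => Submodule.smul_mem _ _ (Ci_Xm _ _ _ (h _))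

theorem phZ_app (D : Dat ι) (γ : ℤ → ι → ℕ → ℂ) (i : ι) (n : ℤ) (x : TT ι) : phZ D γ i n x =
   (if 0 ≤ n then Phi D 1 i (γ 1 i) n.toNat x else 0) - (if n ≤ 0 then Phi D (-1) i (γ (-1) i) (-n).toNat x else 0) := by
  unfold phZ
  split_ifs <;> simp

theorem Ci_phZ (D : Dat ι) (γ : ℤ → ι → ℕ → ℂ) (i j : ι) (n : ℤ) (x : TT ι) (hx : x ∈ Ci i) :
    phZ D γ j n x ∈ Ci i := by
  rw [phZ_app]
  apply Submodule.sub_mem <;> split_ifs <;> first | exact Ci_Phi _ _ _ _ _ _ hx _ | exact Submodule.zero_mem _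

theorem Ci_Xp (D : Dat ι) (γ : ℤ → ι → ℕ → ℂ) (i : ι) (m : ℤ) (x : TT ι) (hx : x ∈ Ci i) : Xp D γ i m x ∈ Ci i := by
  refine Ci_ind i (p := fun x => Xp D γ i m x ∈ Ci i) ?_ ?_ ?_ ?_ ?_ x hx
  · simp
  · intro x y hx hy; rw [map_add]; exact Submodule.add_mem _ hx hy
  · intro c x hx; rw [map_smul]; exact Submodule.smul_mem _ _ hx
  · rw [Xp_nil]; exact Submodule.zero_mem _
  · intro n x hx h
    rw [XO_Xm_apply, if_pos rfl]
    exact Submodule.add_mem _ (Submodule.smul_mem _ _ (Ci_Xm _ _ _ h)) (Submodule.smul_mem _ _ (Ci_phZ _ _ _ _ _ _ hx))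

theorem Ci_Xp_ne (D : Dat ι) (γ : ℤ → ι → ℕ → ℂ) (i j : ι) (hij : j ≠ i) (m : ℤ) (x : TT ι) (hx : x ∈ Ci i) :
    Xp D γ j m x = 0 := by
  refine Ci_ind i (p := fun x => Xp D γ j m x = 0) ?_ ?_ ?_ ?_ ?_ x hx
  · simp
  · intro x y hx hy; rw [map_add, hx, hy, add_zero]
  · intro c x hx; rw [map_smul, hx, smul_zero]
  · rw [Xp_nil]
  · intro n x hx h
    rw [XO_Xm_apply, if_neg hij, h]; simp

theorem Ci_row (c0 i : ι) (h : i ≠ c0) (x : TT ι) (hx : x ∈ Ci i) : row c0 x = 0 := by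
  refine Ci_ind i (p := fun x => row c0 x = 0) ?_ ?_ ?_ ?_ ?_ x hx
  · simp
  · intro x y hx hy; rw [map_add, hx, hy, add_zero]
  · intro c x hx; rw [map_smul, hx, smul_zero]
  · rw [row_nil]
  · intro n x hx _
    rw [row_Xm, if_neg h, smul_zero]

def gA (v : ℂ) (d : ℕ) (u : ℕ → ℂ) (ε : ℤ) (k : ℕ) : ℂ :=
  PowerSeries.coeff k (∏ s ∈ range d, fac (v ^ ε) (u s ^ ε))

/-- flip of a factor -/
theorem fac_gser (x u p : ℂ) (hx : x ≠ 0) (hp : p = x⁻¹ * x⁻¹) : fac x u * gser p u = fac x⁻¹ u := by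
  subst hp
  have h := gser_eq (K := ℂ) (x⁻¹ * x⁻¹) u
  simp only [Algebra.algebraMap_self, RingHom.id_apply] at h
  unfold fac
  have h1 : (PowerSeries.C x * PowerSeries.C x⁻¹ : PowerSeries ℂ) = 1 := by
    rw [← map_mul, mul_inv_cancel₀ hx, map_one]
  simp only [map_mul, inv_inv] at *
  generalize gser (x⁻¹ * x⁻¹) u = g at *
  generalize geo u = k at *
  linear_combination PowerSeries.C x * k * h + (PowerSeries.C x⁻¹ * k + PowerSeries.C x⁻¹ * PowerSeries.C u * PowerSeries.X * g * k) * h1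

theorem Psi_PhiA (D : Dat ι) (i : ι) (v : ℂ) (hv : v ≠ 0) (hpr : D.pr i i = v⁻¹ * v⁻¹) (d : ℕ) (u : ℕ → ℂ)
    (ε : ℤ) (hε : ε = 1 ∨ ε = -1) (b : ℕ → ℂ) (hb : b = gA v d u ε) (x : TT ι) (k : ℕ) (A : Finset ℕ)
    (hA : A ⊆ range d) (h0 : ∀ a ∈ range d, u a ≠ 0) :
    Psi D u (fun _ => i) (Phi D ε i b k x) A =
      PowerSeries.coeff k (∏ s ∈ range d, fac ((if s ∈ A then v⁻¹ else v) ^ ε) (u s ^ ε)) * Psi D u (fun _ => i) x A := by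
  rw [Psi_Phi D u (fun _ => i) ε i b x k A (fun a ha => h0 a (hA ha))]
  congr 2
  have hb' : (mkb b : PowerSeries ℂ) = ∏ s ∈ range d, fac (v ^ ε) (u s ^ ε) := by
    ext k; simp [mkb, hb, gA]
  rw [hb', ← Finset.prod_sdiff hA, mul_assoc, ← Finset.prod_mul_distrib, ← Finset.prod_sdiff hA]
  congr 1
  · refine Finset.prod_congr rfl fun s hs => ?_
    rw [if_neg (Finset.mem_sdiff.1 hs).2]
  · refine Finset.prod_congr rfl fun s hs => ?_
    rw [if_pos hs, fac_gser, inv_zpow]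
    · exact zpow_ne_zero _ hv
    · rw [hpr]; rcases hε with h | h <;> subst h <;> simp

def rho (v : ℂ) (d : ℕ) (u : ℕ → ℂ) (t : ℕ) : ℂ :=
  ∏ s ∈ (range d).erase t, (v * u t - v⁻¹ * u s) / (u t - u s)

structure Hyp (D : Dat ι) (γ : ℤ → ι → ℕ → ℂ) (i : ι) (v : ℂ) (d : ℕ) (u : ℕ → ℂ) : Prop where
  hv : v ≠ 0
  hpr : D.pr i i = v⁻¹ * v⁻¹
  hsg : D.sg i i = 1
  hka : D.ka i = v - v⁻¹
  hγ1 : γ 1 i = gA v d u 1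
  hγ2 : γ (-1) i = gA v d u (-1)
  h0 : ∀ a ∈ range d, u a ≠ 0
  hG : ∀ a ∈ range d, ∀ b ∈ range d, a ≠ b → u a - v⁻¹ * v⁻¹ * u b ≠ 0
  hu : Set.InjOn u (range d)

variable {D : Dat ι} {γ : ℤ → ι → ℕ → ℂ} {i : ι} {v : ℂ} {d : ℕ} {u : ℕ → ℂ}

theorem Hyp.gen (h : Hyp D γ i v d u) : Generic D u (fun _ => i) (range d) :=
  ⟨h.h0, fun a ha b hb hab => by
    simpa [h.hpr] using h.hG a ha b hb hab⟩

theorem rsd_A (h : Hyp D γ i v d u) (A : Finset ℕ) (hA : A ⊆ range d) (s : ℕ) (hs : s ∈ range d) :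
    rsd (range d) (fun s => if s ∈ A then v⁻¹ else v) u s =
      (if s ∈ A then - D.ka i else D.ka i) * (rho v d u s * ∏ b ∈ A.erase s, gq (v⁻¹ * v⁻¹) (u s) (u b)) := by
  have hv := h.hv
  unfold rsd rho
  congr 1
  · rw [h.hka]; by_cases hsA : s ∈ A <;> simp [hsA]
  · have : A.erase s = ((range d).erase s).filter (· ∈ A) := by
      ext b; simp only [mem_erase, mem_filter]
      constructor
      · rintro ⟨h1, h2⟩; exact ⟨⟨h1, hA h2⟩, h2⟩
      · rintro ⟨⟨h1, _⟩, h2⟩; exact ⟨h1, h2⟩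
    rw [this, Finset.prod_filter, ← Finset.prod_mul_distrib]
    refine Finset.prod_congr rfl fun b hb => ?_
    have hb' := Finset.mem_of_mem_erase hb
    by_cases hbA : b ∈ A
    · have h1 := h.hG s hs b hb' (Finset.ne_of_mem_erase hb).symm
      have h3 : u s - u b ≠ 0 := fun h' => Finset.ne_of_mem_erase hb (h.hu hb' hs (sub_eq_zero.1 h').symm)
      have h2 : v * u s - v⁻¹ * u b = v * (u s - v⁻¹ * v⁻¹ * u b) := by
        field_simp
      simp only [hbA, if_true]
      rw [h2, inv_inv, gq, div_mul_div_comm, div_eq_div_iff h3 (mul_ne_zero h3 h1)]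
      have h4 : v⁻¹ * u s - v * u b = v * (v⁻¹ * v⁻¹ * u s - u b) := by field_simp
      rw [h4]; ring
    · simp [hbA]

theorem Psi_phZA (h : Hyp D γ i v d u) (A : Finset ℕ) (hA : A ⊆ range d) (n : ℤ) (x : TT ι) :
    Psi D u (fun _ => i) (phZ D γ i n x) A =
      (∑ s ∈ range d, (if s ∈ A then - D.ka i else D.ka i) *
        (rho v d u s * ∏ b ∈ A.erase s, gq (v⁻¹ * v⁻¹) (u s) (u b)) * u s ^ n) * Psi D u (fun _ => i) x A := by
  have h1 := phi_tot (range d) (fun s => if s ∈ A then v⁻¹ else v) u h.hu h.h0 n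
  rw [Finset.sum_congr rfl fun s hs => by rw [rsd_A h A hA s hs]] at h1
  rw [← h1, phZ_app, map_sub, Pi.sub_apply, sub_mul]
  congr 1
  · split_ifs
    · rw [Psi_PhiA D i v h.hv h.hpr d u 1 (Or.inl rfl) _ h.hγ1 x _ A hA h.h0]; simp
    · simp
  · split_ifs
    · rw [Psi_PhiA D i v h.hv h.hpr d u (-1) (Or.inr rfl) _ h.hγ2 x _ A hA h.h0]; simp only [zpow_neg, zpow_one]
    · simp

theorem zt_ne (h : Hyp D γ i v d u) (a b : ℕ) (ha : a ∈ range d) (hb : b ∈ range d) (hab : a ≠ b) :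
    zt D u (fun _ => i) a b ≠ 0 := by
  unfold zt
  rw [if_neg hab]
  split_ifs
  · simp only [Algebra.algebraMap_self, RingHom.id_apply, h.hpr, gq]
    refine div_ne_zero ?_ (h.hG a ha b hb hab)
    have := h.hG b hb a ha hab.symm
    intro h'; apply this; linear_combination -h'
  · simp [h.hsg]

theorem zt_div (h : Hyp D γ i v d u) (a b : ℕ) (ha : a ∈ range d) (hb : b ∈ range d) (hab : a ≠ b) :
    zt D u (fun _ => i) a b * (zt D u (fun _ => i) b a)⁻¹ = gq (v⁻¹ * v⁻¹) (u a) (u b) := by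
  have := zt_ne h b a hb ha hab.symm
  rw [zt_swap D u _ h.gen ha hb hab]
  simp only [Algebra.algebraMap_self, RingHom.id_apply, h.hpr, h.hsg]
  field_simp

def EA (D : Dat ι) (i : ι) (v : ℂ) (d : ℕ) (u : ℕ → ℂ) (m : ℤ) (t : ℕ) (A : Finset ℕ) : ℂ :=
  u t ^ m * rho v d u t * (∏ b ∈ A, zt D u (fun _ => i) b t)⁻¹

theorem Psi_XpA (h : Hyp D γ i v d u) (m : ℤ) (x : TT ι) (hx : x ∈ Ci i) : ∀ A ⊆ range d,
    Psi D u (fun _ => i) (Xp D γ i m x) A =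
      ∑ t ∈ range d \ A, EA D i v d u m t A * Psi D u (fun _ => i) x (insert t A) := by
  refine Ci_ind i (p := fun x => ∀ A ⊆ range d, Psi D u (fun _ => i) (Xp D γ i m x) A =
      ∑ t ∈ range d \ A, EA D i v d u m t A * Psi D u (fun _ => i) x (insert t A)) ?_ ?_ ?_ ?_ ?_ x hx
  · intro A _; simp
  · intro x y hx hy A hA
    simp only [map_add, Pi.add_apply, hx A hA, hy A hA, mul_add, Finset.sum_add_distrib]
  · intro c x hx A hA
    simp only [map_smul, Pi.smul_apply, hx A hA, Finset.mul_sum, smul_eq_mul]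
    exact Finset.sum_congr rfl fun t _ => by ring
  · intro A hA
    rw [Xp_nil]
    simp [Psi_nil]
  · intro n x hx ih A hA
    rw [XO_Xm_apply, if_pos rfl, h.hsg, one_smul, map_add, map_smul, Pi.add_apply, Pi.smul_apply, Psi_phZA h A hA,
      Psi_Xm, Psi_Xm]
    simp only [Fop_apply, if_true]
    set F := Psi D u (fun _ => i) x with hF
    have hka : D.ka i ≠ 0 := D.ka_ne i
    -- expand the left side
    have hL : ∀ a ∈ A, u a ^ n * (∏ b ∈ A.erase a, zt D u (fun _ => i) a b) *
        Psi D u (fun _ => i) (Xp D γ i m x) (A.erase a) =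
        u a ^ (m + n) * (rho v d u a * ∏ b ∈ A.erase a, gq (v⁻¹ * v⁻¹) (u a) (u b)) * F A +
        ∑ t ∈ range d \ A, EA D i v d u m t A * (u a ^ n * (zt D u (fun _ => i) a t *
          ∏ b ∈ A.erase a, zt D u (fun _ => i) a b) * F (insert t (A.erase a))) := by
      intro a ha
      rw [ih (A.erase a) ((Finset.erase_subset _ _).trans hA)]
      have e1 : range d \ A.erase a = insert a (range d \ A) := by
        ext b; simp only [mem_sdiff, mem_erase, mem_insert, not_and]
        constructor
        · rintro ⟨h1, h2⟩
          by_cases hb : b = a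
          · exact Or.inl hb
          · exact Or.inr ⟨h1, h2 hb⟩
        · rintro (h1 | ⟨h1, h2⟩)
          · subst h1; exact ⟨hA ha, fun h => absurd rfl h⟩
          · exact ⟨h1, fun _ => h2⟩
      rw [e1, Finset.sum_insert (by simp [ha]), mul_add, Finset.insert_erase ha, Finset.mul_sum]
      congr 1
      · unfold EA
        have e2 : ∏ b ∈ A.erase a, gq (v⁻¹ * v⁻¹) (u a) (u b) =
            (∏ b ∈ A.erase a, zt D u (fun _ => i) a b) * (∏ b ∈ A.erase a, zt D u (fun _ => i) b a)⁻¹ := by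
          rw [← Finset.prod_inv_distrib, ← Finset.prod_mul_distrib]
          refine Finset.prod_congr rfl fun b hb => ?_
          rw [zt_div h a b (hA ha) (hA (Finset.mem_of_mem_erase hb)) (Finset.ne_of_mem_erase hb).symm]
        rw [e2, zpow_add₀ (h.h0 a (hA ha))]
        ring
      · refine Finset.sum_congr rfl fun t ht => ?_
        have hta : a ≠ t := by rintro rfl; exact (mem_sdiff.1 ht).2 ha
        have hz := zt_ne h a t (hA ha) (mem_sdiff.1 ht).1 hta
        unfold EA
        rw [← Finset.mul_prod_erase A (fun b => zt D u (fun _ => i) b t) ha, mul_inv]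
        field_simp
    rw [Finset.sum_congr rfl hL, Finset.sum_add_distrib]
    have hR : ∀ t ∈ range d \ A, EA D i v d u m t A * ∑ a ∈ insert t A, u a ^ n *
        (∏ b ∈ (insert t A).erase a, zt D u (fun _ => i) a b) * F ((insert t A).erase a) =
        u t ^ (m + n) * (rho v d u t * ∏ b ∈ A.erase t, gq (v⁻¹ * v⁻¹) (u t) (u b)) * F A +
        ∑ a ∈ A, EA D i v d u m t A * (u a ^ n * (zt D u (fun _ => i) a t *
          ∏ b ∈ A.erase a, zt D u (fun _ => i) a b) * F (insert t (A.erase a))) := by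
      intro t ht
      have htA := (mem_sdiff.1 ht).2
      rw [Finset.sum_insert htA, Finset.erase_insert htA, Finset.erase_eq_of_notMem htA, mul_add, Finset.mul_sum]
      congr 1
      · unfold EA
        have e2 : ∏ b ∈ A, gq (v⁻¹ * v⁻¹) (u t) (u b) =
            (∏ b ∈ A, zt D u (fun _ => i) t b) * (∏ b ∈ A, zt D u (fun _ => i) b t)⁻¹ := by
          rw [← Finset.prod_inv_distrib, ← Finset.prod_mul_distrib]
          refine Finset.prod_congr rfl fun b hb => ?_
          rw [zt_div h t b (mem_sdiff.1 ht).1 (hA hb) (by rintro rfl; exact htA hb)]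
        rw [e2, zpow_add₀ (h.h0 t (mem_sdiff.1 ht).1)]
        ring
      · refine Finset.sum_congr rfl fun a ha => ?_
        have hta : t ≠ a := by rintro rfl; exact htA ha
        rw [Finset.erase_insert_of_ne hta, Finset.prod_insert (fun h => htA (Finset.mem_of_mem_erase h))]
    rw [Finset.sum_congr rfl hR, Finset.sum_add_distrib]
    rw [Finset.sum_comm]
    have key : ∑ a ∈ A, u a ^ (m + n) * (rho v d u a * ∏ b ∈ A.erase a, gq (v⁻¹ * v⁻¹) (u a) (u b)) * F A +
      (D.ka i)⁻¹ • ((∑ s ∈ range d, (if s ∈ A then - D.ka i else D.ka i) *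
        (rho v d u s * ∏ b ∈ A.erase s, gq (v⁻¹ * v⁻¹) (u s) (u b)) * u s ^ (m + n)) * F A) =
      ∑ t ∈ range d \ A, u t ^ (m + n) * (rho v d u t * ∏ b ∈ A.erase t, gq (v⁻¹ * v⁻¹) (u t) (u b)) * F A := by
      rw [← Finset.sum_sdiff hA, add_mul, Finset.sum_mul, Finset.sum_mul, smul_add, Finset.smul_sum, Finset.smul_sum]
      have k1 : ∀ s ∈ A, (D.ka i)⁻¹ • ((if s ∈ A then - D.ka i else D.ka i) *
        (rho v d u s * ∏ b ∈ A.erase s, gq (v⁻¹ * v⁻¹) (u s) (u b)) * u s ^ (m + n) * F A) =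
         - (u s ^ (m + n) * (rho v d u s * ∏ b ∈ A.erase s, gq (v⁻¹ * v⁻¹) (u s) (u b)) * F A) := by
        intro s hs; rw [if_pos hs, smul_eq_mul]; field_simp
      have k2 : ∀ s ∈ range d \ A, (D.ka i)⁻¹ • ((if s ∈ A then - D.ka i else D.ka i) *
        (rho v d u s * ∏ b ∈ A.erase s, gq (v⁻¹ * v⁻¹) (u s) (u b)) * u s ^ (m + n) * F A) =
         (u s ^ (m + n) * (rho v d u s * ∏ b ∈ A.erase s, gq (v⁻¹ * v⁻¹) (u s) (u b)) * F A) := by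
        intro s hs; rw [if_neg (mem_sdiff.1 hs).2, smul_eq_mul]; field_simp
      rw [Finset.sum_congr rfl k1, Finset.sum_congr rfl k2, Finset.sum_neg_distrib]
      ring
    rw [← key]; ring

/-- degree vanishing -/
theorem Psi_deg (D : Dat ι) (u : ℕ → ℂ) (i : ι) (r : ℕ) : ∀ B : Finset ℕ, B.card ≠ r →
    Psi D u (fun _ => i) ((Xm i 0 ^ r) (wd [])) B = 0 := by
  induction r with
  | zero =>
    intro B hB
    rw [pow_zero, Module.End.one_apply, Psi_nil, if_neg]
    rintro rfl; simp at hB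
  | succ r ih =>
    intro B hB
    rw [pow_succ', Module.End.mul_apply, Psi_Xm, Fop_apply]
    refine Finset.sum_eq_zero fun a ha => ?_
    rw [if_pos rfl, ih, mul_zero]
    rw [Finset.card_erase_of_mem ha]
    have := Finset.card_pos.2 ⟨a, ha⟩
    omega

def XG (D : Dat ι) (γ : ℤ → ι → ℕ → ℂ) (i : ι) : List ℤ → TT ι → TT ι
  | [], x => x
  | m :: l, x => XG D γ i l (Xp D γ i m x)

theorem vac_Psi (D : Dat ι) (u : ℕ → ℂ) (i : ι) (x : TT ι) (hx : x ∈ Ci i) : vac x = Psi D u (fun _ => i) x ∅ := by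
  refine Ci_ind i (p := fun x => vac x = Psi D u (fun _ => i) x ∅) ?_ ?_ ?_ ?_ ?_ x hx
  · simp
  · intro x y hx hy; simp [hx, hy]
  · intro c x hx; simp [hx]
  · rw [vac_nil, Psi_nil]; simp
  · intro n x _ _
    rw [vac_Xm, Psi_Xm, Fop_apply]; simp

theorem Psi_XG (h : Hyp D γ i v d u) (l : List ℤ) : ∀ (x : TT ι), x ∈ Ci i →
    (∀ B ⊆ range d, Psi D u (fun _ => i) x B = 0) → ∀ B ⊆ range d, Psi D u (fun _ => i) (XG D γ i l x) B = 0 := by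
  induction l with
  | nil => intro x _ h; exact h
  | cons m l ih =>
    intro x hx hB
    refine ih _ (Ci_Xp _ _ _ _ _ hx) ?_
    intro B hB'
    rw [Psi_XpA h m x hx B hB']
    refine Finset.sum_eq_zero fun t ht => ?_
    rw [hB _ (Finset.insert_subset (mem_sdiff.1 ht).1 hB'), mul_zero]

theorem Ci_XG (D : Dat ι) (γ : ℤ → ι → ℕ → ℂ) (i : ι) (l : List ℤ) : ∀ x : TT ι, x ∈ Ci i → XG D γ i l x ∈ Ci i := by
  induction l with
  | nil => intro x h; exact h
  | cons m l ih => intro x hx; exact ih _ (Ci_Xp _ _ _ _ _ hx)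

theorem Ci_pow (i : ι) (r : ℕ) : (Xm i 0 ^ r) (wd []) ∈ Ci i := by
  induction r with
  | zero => exact Ci_nil i
  | succ r ih => rw [pow_succ', Module.End.mul_apply]; exact Ci_Xm _ _ _ ih

theorem vac_XG (h : Hyp D γ i v d u) (l : List ℤ) : vac (XG D γ i l ((Xm i 0 ^ (d + 1)) (wd []))) = 0 := by
  rw [vac_Psi D u i _ (Ci_XG _ _ _ _ _ (Ci_pow i _))]
  refine Psi_XG h l _ (Ci_pow i _) ?_ ∅ (Finset.empty_subset _)
  intro B hB
  apply Psi_deg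
  have := Finset.card_le_card hB
  rw [Finset.card_range] at this
  omega

end QW
end

noncomputable section
namespace QW
set_option linter.unusedSectionVars false
set_option linter.unusedSimpArgs false
open Finset Topology Filter

variable {ι : Type} [DecidableEq ι]

def Cts (ι : Type) (z0 : ℂ) : Submodule ℂ (ℂ → TT ι) :=
  Submodule.span ℂ {f | ∃ (c : ℂ → ℂ) (y : TT ι), ContinuousAt c z0 ∧ f = fun z => c z • y}

theorem Cts_mk {z0 : ℂ} (c : ℂ → ℂ) (y : TT ι) (hc : ContinuousAt c z0) : (fun z => c z • y) ∈ Cts ι z0 :=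
  Submodule.subset_span ⟨c, y, hc, rfl⟩

theorem Cts_const {z0 : ℂ} (y : TT ι) : (fun _ => y) ∈ Cts ι z0 := by
  have := Cts_mk (z0 := z0) (fun _ => 1) y continuousAt_const
  simpa using this

theorem Cts_smul {z0 : ℂ} (c : ℂ → ℂ) (hc : ContinuousAt c z0) (f : ℂ → TT ι) (hf : f ∈ Cts ι z0) :
    (fun z => c z • f z) ∈ Cts ι z0 := by
  unfold Cts at hf
  induction hf using Submodule.span_induction with
  | mem f h =>
    obtain ⟨e, y, he, rfl⟩ := h
    simp only [smul_smul]
    exact Cts_mk (fun z => c z * e z) y (hc.mul he)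
  | zero => simp only [Pi.zero_apply, smul_zero, map_zero]; exact Cts_const 0
  | add f g _ _ hf hg =>
    have := Submodule.add_mem _ hf hg
    convert this using 1
    funext z; simp
  | smul a f _ hf =>
    have := Submodule.smul_mem _ a hf
    convert this using 1
    funext z; exact smul_comm (c z) a (f z)

theorem Cts_app {z0 : ℂ} (T : ℂ → Module.End ℂ (TT ι)) (hT : ∀ w, (fun z => T z (wd w)) ∈ Cts ι z0)
    (f : ℂ → TT ι) (hf : f ∈ Cts ι z0) : (fun z => T z (f z)) ∈ Cts ι z0 := by
  have hT' : ∀ y, (fun z => T z y) ∈ Cts ι z0 := by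
    intro y
    induction y using TT_ind with
    | h0 => simp only [Pi.zero_apply, smul_zero, map_zero]; exact Cts_const 0
    | hadd x y hx hy =>
      have := Submodule.add_mem _ hx hy
      convert this using 1
      funext z; simp
    | hs c w =>
      have := Submodule.smul_mem _ c (hT w)
      convert this using 1
      funext z; simp
  unfold Cts at hf
  induction hf using Submodule.span_induction with
  | mem f h =>
    obtain ⟨e, y, he, rfl⟩ := h
    simp only [map_smul]
    exact Cts_smul e he _ (hT' y)
  | zero => simp only [Pi.zero_apply, smul_zero, map_zero]; exact Cts_const 0
  | add f g _ _ hf hg =>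
    have := Submodule.add_mem _ hf hg
    convert this using 1
    funext z; simp
  | smul a f _ hf =>
    have := Submodule.smul_mem _ a hf
    convert this using 1
    funext z; simp

theorem Cts_lin {z0 : ℂ} (T : Module.End ℂ (TT ι)) (f : ℂ → TT ι) (hf : f ∈ Cts ι z0) :
    (fun z => T (f z)) ∈ Cts ι z0 := Cts_app (fun _ => T) (fun _ => Cts_const _) f hf

theorem Cts_vac {z0 : ℂ} (f : ℂ → TT ι) (hf : f ∈ Cts ι z0) : ContinuousAt (fun z => vac (f z)) z0 := by
  unfold Cts at hf
  induction hf using Submodule.span_induction with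
  | mem f h =>
    obtain ⟨e, y, he, rfl⟩ := h
    simp only [map_smul, smul_eq_mul]
    exact he.mul continuousAt_const
  | zero => simpa using continuousAt_const
  | add f g _ _ hf hg => simp only [Pi.add_apply, map_add]; exact hf.add hg
  | smul a f _ hf => simp only [Pi.smul_apply, map_smul, smul_eq_mul]; exact continuousAt_const.mul hf

theorem Cts_Phi {z0 : ℂ} (D : Dat ι) (ε : ℤ) (i : ι) (b : ℂ → ℕ → ℂ) (hb : ∀ k, ContinuousAt (fun z => b z k) z0)
    (w : Wd ι) : ∀ k, (fun z => Phi D ε i (b z) k (wd w)) ∈ Cts ι z0 := by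
  induction w with
  | nil => intro k; simp only [Phi_nil]; exact Cts_mk _ _ (hb k)
  | cons a w ih =>
    intro k
    obtain ⟨j, n⟩ := a
    have : (fun z => Phi D ε i (b z) k (wd ((j, n) :: w))) =
        ∑ a ∈ range (k + 1), gco (D.pr i j ^ ε) a • (fun z => Xm j (n + ε * a) (Phi D ε i (b z) (k - a) (wd w))) := by
      funext z
      have := congrArg (fun A => A (wd w)) (Phi_Xm D ε i (b z) k j n)
      simp only [Module.End.mul_apply, LinearMap.sum_apply, LinearMap.smul_apply, Xm_wd] at this
      rw [this]; simp
    rw [this]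
    exact Submodule.sum_mem _ fun a _ => Submodule.smul_mem _ _ (Cts_lin _ _ (ih _))

theorem Cts_Xp {z0 : ℂ} (D : Dat ι) (i : ι) (m : ℤ) (γ : ℂ → ℤ → ι → ℕ → ℂ)
    (hb : ∀ ε k, ContinuousAt (fun z => γ z ε i k) z0)
    (w : Wd ι) : (fun z => Xp D (γ z) i m (wd w)) ∈ Cts ι z0 := by
  induction w with
  | nil => simp only [Xp_nil]; exact Cts_const _
  | cons a w ih =>
    obtain ⟨j, n⟩ := a
    have h1 : (fun z => if i = j then (D.ka i)⁻¹ • phZ D (γ z) i (m + n) (wd w) else 0) ∈ Cts ι z0 := by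
      split_ifs
      · have h2 : (fun z => phZ D (γ z) i (m + n) (wd w)) ∈ Cts ι z0 := by
          simp only [phZ_app]
          refine Submodule.sub_mem (Cts ι z0) (x := fun z => if 0 ≤ m + n then Phi D 1 i (γ z 1 i) (m + n).toNat (wd w) else 0)
            (y := fun z => if m + n ≤ 0 then Phi D (-1) i (γ z (-1) i) (-(m + n)).toNat (wd w) else 0) ?_ ?_
          · split_ifs
            · exact Cts_Phi D 1 i (fun z => γ z 1 i) (hb 1) w _
            · exact Cts_const _
          · split_ifs
            · exact Cts_Phi D (-1) i (fun z => γ z (-1) i) (hb (-1)) w _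
            · exact Cts_const _
        exact Submodule.smul_mem _ _ h2
      · exact Cts_const _
    have h3 := Submodule.add_mem _ (Submodule.smul_mem _ (D.sg i j) (Cts_lin (Xm j n) _ ih)) h1
    convert h3 using 1
    funext z
    rw [← Xm_wd, XO_Xm_apply]; rfl

theorem Cts_XG {z0 : ℂ} (D : Dat ι) (i : ι) (γ : ℂ → ℤ → ι → ℕ → ℂ)
    (hb : ∀ ε k, ContinuousAt (fun z => γ z ε i k) z0) (l : List ℤ) : ∀ f ∈ Cts ι z0,
    (fun z => XG D (γ z) i l (f z)) ∈ Cts ι z0 := by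
  induction l with
  | nil => intro f hf; exact hf
  | cons m l ih =>
    intro f hf
    exact ih _ (Cts_app (fun z => Xp D (γ z) i m) (Cts_Xp D i m γ hb) f hf)

theorem cont_prod {z0 : ℂ} (R : Finset ℕ) (F : ℕ → ℂ → PowerSeries ℂ)
    (hF : ∀ s ∈ R, ∀ k, ContinuousAt (fun z => PowerSeries.coeff k (F s z)) z0) :
    ∀ k, ContinuousAt (fun z => PowerSeries.coeff k (∏ s ∈ R, F s z)) z0 := by
  induction R using Finset.induction_on with
  | empty => intro k; simp only [Finset.prod_empty]; exact continuousAt_const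
  | insert s R hs ih =>
    intro k
    simp only [Finset.prod_insert hs, PowerSeries.coeff_mul]
    exact tendsto_finsetSum _ fun p _ => (hF s (by simp) p.1).mul
      (ih (fun t ht => hF t (by simp [ht])) p.2)

theorem cont_gA (v : ℂ) (d : ℕ) (u : ℕ → ℂ) (hu : ∀ s ∈ range d, u s ≠ 0) (ε : ℤ) (k : ℕ) :
    ContinuousAt (fun z : ℂ => gA v d (fun s => u s * z ^ s) ε k) 1 := by
  unfold gA
  refine cont_prod _ (fun s z => fac (v ^ ε) ((u s * z ^ s) ^ ε)) ?_ k
  intro s hs k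
  simp only [fac_eq, map_add, PowerSeries.coeff_C_mul, geo, PowerSeries.coeff_mk]
  refine continuousAt_const.add (continuousAt_const.mul (ContinuousAt.pow ?_ k))
  refine ContinuousAt.zpow₀ ?_ ε (Or.inl (by simpa using hu s hs))
  fun_prop

theorem ev_ne (a b : ℕ) (hab : a ≠ b) (x y : ℂ) (hx : x ≠ 0) : ∀ᶠ z : ℂ in 𝓝[≠] 1, x * z ^ a - y * z ^ b ≠ 0 := by
  let p : Polynomial ℂ := Polynomial.C x * Polynomial.X ^ a - Polynomial.C y * Polynomial.X ^ b
  have hp : p ≠ 0 := by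
    intro h
    have := congrArg (fun p => Polynomial.coeff p a) h
    simp [p, Polynomial.coeff_X_pow, hab, hx] at this
  have h1 : {z : ℂ | p.IsRoot z}.Finite := Polynomial.finite_setOfPred_isRoot hp
  have h2 := nhdsNE_le_cofinite (1 : ℂ) h1.compl_mem_cofinite
  filter_upwards [h2] with z hz h
  apply hz
  simpa [p, Polynomial.IsRoot] using h

theorem even_main (D : Dat ι) (γ : ℤ → ι → ℕ → ℂ) (i : ι) (v : ℂ) (d : ℕ) (u : ℕ → ℂ)
    (hv : v ≠ 0) (hpr : D.pr i i = v⁻¹ * v⁻¹) (hsg : D.sg i i = 1) (hka : D.ka i = v - v⁻¹)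
    (hγ1 : γ 1 i = gA v d u 1) (hγ2 : γ (-1) i = gA v d u (-1)) (h0 : ∀ a ∈ range d, u a ≠ 0) (l : List ℤ) :
    vac (XG D γ i l ((Xm i 0 ^ (d + 1)) (wd []))) = 0 := by
  classical
  let γz : ℂ → ℤ → ι → ℕ → ℂ := fun z ε j k =>
    if j = i ∧ (ε = 1 ∨ ε = -1) then gA v d (fun s => u s * z ^ s) ε k else γ ε j k
  have hγz : γz 1 = γ := by
    funext ε j k
    simp only [γz, one_pow, mul_one]
    split_ifs with h
    · obtain ⟨rfl, rfl | rfl⟩ := h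
      · rw [hγ1]
      · rw [hγ2]
    · rfl
  have hc : ∀ ε k, ContinuousAt (fun z => γz z ε i k) 1 := by
    intro ε k
    simp only [γz]
    split_ifs
    · exact cont_gA v d u h0 ε k
    · exact continuousAt_const
  have hF := Cts_vac _ (Cts_XG D i γz hc l _ (Cts_const ((Xm i 0 ^ (d + 1)) (wd []))))
  have hev : ∀ᶠ z : ℂ in 𝓝[≠] 1, vac (XG D (γz z) i l ((Xm i 0 ^ (d + 1)) (wd []))) = 0 := by
    have e1 : ∀ᶠ z : ℂ in 𝓝[≠] 1, z ≠ 0 :=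
      (continuousAt_id.eventually_ne one_ne_zero).filter_mono nhdsWithin_le_nhds
    have e2 : ∀ᶠ z : ℂ in 𝓝[≠] 1, ∀ a ∈ range d, ∀ b ∈ range d, a ≠ b → 
        u a * z ^ a - v⁻¹ * v⁻¹ * (u b) * z ^ b ≠ 0 := by
      rw [Filter.eventually_all_finset]; intro a ha
      rw [Filter.eventually_all_finset]; intro b hb
      rw [Filter.eventually_imp_distrib_left]; intro hab
      exact ev_ne a b hab _ _ (h0 a ha)
    have e3 : ∀ᶠ z : ℂ in 𝓝[≠] 1, ∀ a ∈ range d, ∀ b ∈ range d, a ≠ b → 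
        u a * z ^ a - (u b) * z ^ b ≠ 0 := by
      rw [Filter.eventually_all_finset]; intro a ha
      rw [Filter.eventually_all_finset]; intro b hb
      rw [Filter.eventually_imp_distrib_left]; intro hab
      exact ev_ne a b hab _ _ (h0 a ha)
    filter_upwards [e1, e2, e3] with z h1 h2 h3
    refine vac_XG (v := v) (u := fun s => u s * z ^ s) ?_ l
    refine ⟨hv, hpr, hsg, hka, ?_, ?_, ?_, ?_, ?_⟩
    · funext k; simp [γz]
    · funext k; simp [γz]
    · intro a ha; exact mul_ne_zero (h0 a ha) (pow_ne_zero _ h1)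
    · intro a ha b hb hab
      have := h2 a ha b hb hab
      rwa [mul_assoc (v⁻¹ * v⁻¹)] at this
    · intro a ha b hb h
      by_contra hab
      exact h3 a ha b hb hab (sub_eq_zero.2 h)
  have h1 : Tendsto (fun z => vac (XG D (γz z) i l ((Xm i 0 ^ (d + 1)) (wd [])))) (𝓝[≠] 1) (𝓝 _) :=
    hF.tendsto.mono_left nhdsWithin_le_nhds
  have h2 : Tendsto (fun z => vac (XG D (γz z) i l ((Xm i 0 ^ (d + 1)) (wd [])))) (𝓝[≠] 1) (𝓝 0) :=
    tendsto_const_nhds.congr' (hev.mono fun z hz => hz.symm)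
  have := tendsto_nhds_unique h1 h2
  rwa [hγz] at this

theorem XL_zero (D : Dat ι) (W : HWD ι) (l : List (ι × ℤ)) : XL D W l 0 = 0 := map_zero _

/-- the even generator lies in the radical -/
theorem even_NS (D : Dat ι) (W : HWD ι) (c0 : ι) (J : Ideal (LaurentPolynomial ℂ)) (i : ι) (hi : i ≠ c0)
    (v : ℂ) (d : ℕ) (u : ℕ → ℂ)
    (hv : v ≠ 0) (hpr : D.pr i i = v⁻¹ * v⁻¹) (hsg : D.sg i i = 1) (hka : D.ka i = v - v⁻¹)
    (hγ1 : gam D W 1 i = gA v d u 1) (hγ2 : gam D W (-1) i = gA v d u (-1)) (h0 : ∀ a ∈ range d, u a ≠ 0) :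
    (Xm i 0 ^ (d + 1)) (wd []) ∈ NS D W c0 J := by
  rw [mem_NS]
  have key : ∀ (l : List (ι × ℤ)) (x : TT ι), x ∈ Ci i → (∀ l, vac (XG D (gam D W) i l x) = 0) →
      XL D W l x ∈ Ci i ∧ vac (XL D W l x) = 0 := by
    intro l
    induction l with
    | nil => intro x hx h; exact ⟨hx, h []⟩
    | cons a l ih =>
      intro x hx h
      obtain ⟨j, m⟩ := a
      have e : XL D W ((j, m) :: l) x = XL D W l (XO D W j m x) := rfl
      rw [e]
      by_cases hj : j = i
      · subst hj
        exact ih _ (Ci_Xp _ _ _ _ _ hx) (fun l => h (m :: l))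
      · have : XO D W j m x = 0 := Ci_Xp_ne _ _ _ _ hj _ _ hx
        rw [this, map_zero]
        exact ⟨Submodule.zero_mem _, map_zero _⟩
  intro l
  have := key l _ (Ci_pow i (d + 1)) (even_main D (gam D W) i v d u hv hpr hsg hka hγ1 hγ2 h0)
  refine ⟨this.2, ?_⟩
  rw [Ci_row c0 i hi _ this.1]
  exact Ideal.zero_mem _

end QW
end

noncomputable section
namespace QW
set_option linter.unusedSectionVars false
set_option linter.unusedSimpArgs false
open Finset QAS

theorem factor_P (d : ℕ) : ∀ P : Polynomial ℂ, P.natDegree = d → P.coeff 0 = 1 →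
    ∃ α : ℕ → ℂ, (∀ s ∈ range d, α s ≠ 0) ∧
      P = ∏ s ∈ range d, (1 - Polynomial.C (α s) * Polynomial.X) := by
  induction d with
  | zero =>
    intro P hd h0
    refine ⟨fun _ => 1, by simp, ?_⟩
    rw [Polynomial.eq_C_of_natDegree_eq_zero hd, h0]; simp
  | succ d ih =>
    intro P hd h0
    obtain ⟨r, hr⟩ := IsAlgClosed.exists_root P (by
      intro h; rw [Polynomial.degree_eq_natDegree (by rintro rfl; simp at h0), hd] at h
      exact absurd h (by exact_mod_cast Nat.succ_ne_zero d))
    have hr0 : r ≠ 0 := by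
      rintro rfl
      rw [Polynomial.IsRoot, ← Polynomial.coeff_zero_eq_eval_zero, h0] at hr
      exact one_ne_zero hr
    obtain ⟨R, hR⟩ := Polynomial.dvd_iff_isRoot.2 hr
    have hP : P = (1 - Polynomial.C r⁻¹ * Polynomial.X) * (Polynomial.C (-r) * R) := by
      rw [hR]
      have : (Polynomial.C r⁻¹ * Polynomial.C r : Polynomial ℂ) = 1 := by
        rw [← Polynomial.C_mul, inv_mul_cancel₀ hr0, Polynomial.C_1]
      rw [Polynomial.C_neg]
      linear_combination (-Polynomial.X * R) * this
    have hR0 : R ≠ 0 := by rintro rfl; rw [mul_zero] at hR; rw [hR] at h0; simp at h0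
    have hd' : (Polynomial.C (-r) * R).natDegree = d := by
      rw [Polynomial.natDegree_C_mul (neg_ne_zero.2 hr0)]
      rw [hR, Polynomial.natDegree_mul (Polynomial.X_sub_C_ne_zero r) hR0, Polynomial.natDegree_X_sub_C] at hd
      omega
    obtain ⟨α, h1, h2⟩ := ih _ hd' (by
      have := h0; rw [hP, Polynomial.mul_coeff_zero] at this; simpa using this)
    refine ⟨fun s => if s = d then r⁻¹ else α s, ?_, ?_⟩
    · intro s hs
      dsimp only
      split_ifs with h
      · exact inv_ne_zero hr0
      · exact h1 s (by simp at hs ⊢; omega)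
    · rw [Finset.prod_range_succ]
      dsimp only
      rw [if_pos rfl, hP, h2, mul_comm]
      congr 1
      refine Finset.prod_congr rfl fun s hs => ?_
      rw [if_neg (by simp at hs; omega)]

theorem toPS_coe (p : Polynomial ℂ) : toPS p = (p : PowerSeries ℂ) := by
  ext n; simp [toPS]

theorem pscale_prod (w : ℂ) (d : ℕ) (α : ℕ → ℂ) : pscale w (∏ s ∈ range d, (1 - Polynomial.C (α s) * Polynomial.X)) =
    ∏ s ∈ range d, (1 - Polynomial.C (w * α s) * Polynomial.X) := by
  rw [pscale, Polynomial.prod_comp]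
  refine Finset.prod_congr rfl fun s _ => ?_
  simp; ring

theorem coe_prod (d : ℕ) (F : ℕ → Polynomial ℂ) : ((∏ s ∈ range d, F s : Polynomial ℂ) : PowerSeries ℂ) =
    ∏ s ∈ range d, (F s : PowerSeries ℂ) := by
  induction d with
  | zero => simp
  | succ d ih => rw [Finset.prod_range_succ, Polynomial.coe_mul, ih, Finset.prod_range_succ]

theorem reflect_prod (d : ℕ) (β : ℕ → ℂ) : (∏ s ∈ range d, (1 - Polynomial.C (β s) * Polynomial.X)).reflect d =
    ∏ s ∈ range d, (Polynomial.X - Polynomial.C (β s)) := by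
  induction d with
  | zero => simp
  | succ d ih =>
    have hdeg : ∀ s, (1 - Polynomial.C (β s) * Polynomial.X : Polynomial ℂ).natDegree ≤ 1 := by
      intro s; compute_degree
    rw [Finset.prod_range_succ, Polynomial.reflect_mul _ _ (F := d) (G := 1) ?_ (hdeg d), ih, Finset.prod_range_succ]
    · congr 1
      rw [Polynomial.reflect_sub, Polynomial.reflect_one]
      simp [Polynomial.reflect_C_mul]
    · refine (Polynomial.natDegree_prod_le _ _).trans ?_
      calc _ ≤ ∑ s ∈ range d, 1 := Finset.sum_le_sum fun s _ => hdeg s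
        _ = d := by simp

theorem gammaP_gA (q : ℂ) (hq0 : q ≠ 0) (M i : ℕ) (P : Polynomial ℂ) (α : ℕ → ℂ)
    (hα : ∀ s ∈ range P.natDegree, α s ≠ 0)
    (hP : P = ∏ s ∈ range P.natDegree, (1 - Polynomial.C (α s) * Polynomial.X)) (k : ℕ) :
    gammaP q M i P (k : ℤ) = gA (qpar q M i) P.natDegree (fun s => qpar q M i * α s) 1 k := by
  have hv := qpar_ne q hq0 M i
  unfold gammaP gA
  generalize qpar q M i = v at *
  generalize P.natDegree = d at *
  subst hP
  rw [if_pos (by omega), Int.toNat_natCast, toPS_coe, toPS_coe, pscale_prod, pscale_prod, coe_prod, coe_prod]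
  rw [← PowerSeries.coeff_C_mul]
  congr 1
  have hinv : (∏ s ∈ range d, ((1 - Polynomial.C (v * α s) * Polynomial.X : Polynomial ℂ) : PowerSeries ℂ))⁻¹ =
      ∏ s ∈ range d, geo (v * α s) := by
    symm
    rw [PowerSeries.eq_inv_iff_mul_eq_one, ← Finset.prod_mul_distrib]
    · refine Finset.prod_eq_one fun s _ => ?_
      rw [mul_comm]
      simpa using geo_eq (v * α s)
    · rw [map_prod]; simp
  rw [hinv, ← Finset.prod_mul_distrib, map_pow]
  conv_lhs => enter [1]; rw [← Finset.card_range d, ← Finset.prod_const]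
  rw [← Finset.prod_mul_distrib]
  refine Finset.prod_congr rfl fun s _ => ?_
  simp only [zpow_one, fac, inv_mul_cancel_left₀ hv]
  have : (PowerSeries.C v * PowerSeries.C v⁻¹ : PowerSeries ℂ) = 1 := by
    rw [← map_mul, mul_inv_cancel₀ hv, map_one]
  simp
  linear_combination (-PowerSeries.C (α s) * PowerSeries.X * geo (v * α s)) * this

theorem gammaM_gA (q : ℂ) (hq0 : q ≠ 0) (M i : ℕ) (P : Polynomial ℂ) (α : ℕ → ℂ)
    (hα : ∀ s ∈ range P.natDegree, α s ≠ 0)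
    (hP : P = ∏ s ∈ range P.natDegree, (1 - Polynomial.C (α s) * Polynomial.X)) (k : ℕ) :
    gammaM q M i P (-(k : ℤ)) = gA (qpar q M i) P.natDegree (fun s => qpar q M i * α s) (-1) k := by
  have hv := qpar_ne q hq0 M i
  unfold gammaM gA
  generalize qpar q M i = v at *
  generalize P.natDegree = d at *
  subst hP
  rw [if_pos (by omega), neg_neg, Int.toNat_natCast, toPS_coe, toPS_coe, pscale_prod, pscale_prod,
    reflect_prod, reflect_prod, coe_prod, coe_prod]
  rw [← PowerSeries.coeff_C_mul]
  congr 1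
  have hinv : (∏ s ∈ range d, ((Polynomial.X - Polynomial.C (v * α s) : Polynomial ℂ) : PowerSeries ℂ))⁻¹ =
      ∏ s ∈ range d, (- PowerSeries.C (v * α s)⁻¹ * geo (v * α s)⁻¹) := by
    symm
    rw [PowerSeries.eq_inv_iff_mul_eq_one, ← Finset.prod_mul_distrib]
    · refine Finset.prod_eq_one fun s hs => ?_
      have h1 := geo_eq (v * α s)⁻¹
      have h2 : (PowerSeries.C (v * α s)⁻¹ * PowerSeries.C (v * α s) : PowerSeries ℂ) = 1 := by
        rw [← map_mul, inv_mul_cancel₀ (mul_ne_zero hv (hα s hs)), map_one]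
      rw [Polynomial.coe_sub, Polynomial.coe_X, Polynomial.coe_C]
      linear_combination geo (v * α s)⁻¹ * h2 + h1
    · rw [map_prod, Finset.prod_ne_zero_iff]
      intro s hs
      simpa using ⟨hv, hα s hs⟩
  rw [hinv, ← Finset.prod_mul_distrib, map_pow]
  conv_lhs => enter [1]; rw [← Finset.card_range d, ← Finset.prod_const]
  rw [← Finset.prod_mul_distrib]
  refine Finset.prod_congr rfl fun s hs => ?_
  rw [Polynomial.coe_sub, Polynomial.coe_X, Polynomial.coe_C]
  simp only [zpow_neg, zpow_one, fac, inv_inv]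
  have h1 : (PowerSeries.C v * PowerSeries.C (v⁻¹ * α s) * PowerSeries.C (v * α s)⁻¹ : PowerSeries ℂ) = PowerSeries.C v⁻¹ := by
    rw [← map_mul, ← map_mul]; congr 1
    have := hα s hs
    field_simp
  rw [map_mul PowerSeries.C v (v * α s)⁻¹]
  linear_combination geo (v * α s)⁻¹ * h1

end QW
end

noncomputable section
namespace QW
set_option linter.unusedSectionVars false
set_option linter.unusedSimpArgs false
open Finset QAS

theorem gA_zero (v : ℂ) (d : ℕ) (u : ℕ → ℂ) (ε : ℤ) : gA v d u ε 0 = (v ^ ε) ^ d := by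
  unfold gA
  rw [PowerSeries.coeff_zero_eq_constantCoeff, map_prod]
  simp [fac, geo]

theorem exists_W (q : ℂ) (hq0 : q ≠ 0) (hq1 : ∀ k : ℕ, k ≠ 0 → q ^ k ≠ 1) (M N : ℕ) (Λ : HW q M N) :
    ∃ W : HWD (Idx M N), (∀ i : Idx M N, i.1 = M → W.ke i = Λ.c) ∧
      (∀ i : Idx M N, i.1 ≠ M → (∀ k : ℕ, gam (DD q hq0 hq1 M N) W 1 i k = gammaP q M i.1 (Λ.P i.1) k) ∧
        (∀ k : ℕ, gam (DD q hq0 hq1 M N) W (-1) i k = gammaM q M i.1 (Λ.P i.1) (-(k : ℤ)))) ∧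
      (∀ i : Idx M N, i.1 = M →
        (∀ k : ℕ, gam (DD q hq0 hq1 M N) W 1 i k = if k = 0 then Λ.c else (q - q⁻¹) * Λ.f k) ∧
        (∀ k : ℕ, gam (DD q hq0 hq1 M N) W (-1) i k = if k = 0 then Λ.c⁻¹ else - ((q - q⁻¹) * Λ.f (-(k : ℤ))))) := by
  obtain ⟨W, h1, h2, h3⟩ := exists_HWD (DD q hq0 hq1 M N)
    (fun i => if i.1 = M then Λ.c else qpar q M i.1 ^ (Λ.P i.1).natDegree)
    (by
      intro i; split_ifs
      · exact Λ.c_ne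
      · exact pow_ne_zero _ (qpar_ne q hq0 M i.1))
    (fun i k => if i.1 = M then (if k = 0 then Λ.c else (q - q⁻¹) * Λ.f k) else gammaP q M i.1 (Λ.P i.1) k)
    (fun i k => if i.1 = M then (if k = 0 then Λ.c⁻¹ else - ((q - q⁻¹) * Λ.f (-(k : ℤ)))) else
      gammaM q M i.1 (Λ.P i.1) (-(k : ℤ)))
    (by
      intro i; split_ifs with h h'
      · rfl
      · exact absurd rfl h'
      · obtain ⟨α, ha, hP⟩ := factor_P _ (Λ.P i.1) rfl (Λ.P_const i.1)
        rw [gammaP_gA q hq0 M i.1 _ α ha hP, gA_zero, zpow_one])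
    (by
      intro i; split_ifs with h h'
      · rfl
      · exact absurd rfl h'
      · obtain ⟨α, ha, hP⟩ := factor_P _ (Λ.P i.1) rfl (Λ.P_const i.1)
        rw [gammaM_gA q hq0 M i.1 _ α ha hP, gA_zero, zpow_neg_one, inv_pow])
  refine ⟨W, fun i hi => by simp [h1, hi], fun i hi => ⟨fun k => by simp [h2, hi], fun k => by simp [h3, hi]⟩,
    fun i hi => ⟨fun k => by simp [h2, hi], fun k => by simp [h3, hi]⟩⟩

/-- Laurent polynomial of the reversed polynomial -/
def rv (Q : Polynomial ℂ) : LaurentPolynomial ℂ :=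
  ∑ s ∈ range (Q.natDegree + 1), Q.coeff (Q.natDegree - s) • LaurentPolynomial.T (s : ℤ)

section
variable (q : ℂ) (hq0 : q ≠ 0) (hq1 : ∀ k : ℕ, k ≠ 0 → q ^ k ≠ 1) (M N : ℕ)

def oddF (Q : Polynomial ℂ) : FA M N false :=
  ∑ s ∈ Finset.range (Q.natDegree + 1),
    Q.coeff (Q.natDegree - s) • XmF M N false M ((s : ℤ) + 0)

theorem oddF_mk (Q : Polynomial ℂ) : mkA q M N false 3 (oddF M N Q) = oddElt q M N false Q 0 := by
  unfold oddF oddElt XmA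
  rw [map_sum]
  simp only [map_smul]

theorem Th_XmF (W : HWD (Idx M N)) (i : Idx M N) (n : ℤ) : Th q hq0 hq1 M N W (XmF M N false i.1 n) = Xm i n := by
  rw [XmF, dif_pos i.2, Th_gi]; rfl

theorem Th_odd (W : HWD (Idx M N)) (c0 : Idx M N) (hc : c0.1 = M) (Q : Polynomial ℂ) :
    Th q hq0 hq1 M N W (oddF M N Q) (wd []) =
      ∑ s ∈ range (Q.natDegree + 1), Q.coeff (Q.natDegree - s) • Xm c0 (s : ℤ) (wd []) := by
  unfold oddF
  rw [map_sum, LinearMap.sum_apply]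
  refine Finset.sum_congr rfl fun s _ => ?_
  rw [map_smul, LinearMap.smul_apply, add_zero]
  have : XmF M N false M (s : ℤ) = XmF M N false c0.1 (s : ℤ) := by rw [hc]
  rw [this, Th_XmF]

theorem row_odd (W : HWD (Idx M N)) (c0 : Idx M N) (hc : c0.1 = M) (Q : Polynomial ℂ) :
    row c0 (Th q hq0 hq1 M N W (oddF M N Q) (wd [])) = rv Q := by
  rw [Th_odd q hq0 hq1 M N W c0 hc, map_sum, rv]
  refine Finset.sum_congr rfl fun s _ => ?_
  rw [map_smul, row_Xm, if_pos rfl, vac_nil, one_smul]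

theorem cc_diag (i : ℕ) (h : i ≠ M) : cc M i i = 2 * lof M i := by
  unfold cc form4 innerE lof
  split_ifs <;> omega

theorem weyl_le_Ann [Nonempty (Idx M N)] (hM : 1 ≤ M) (hN : 1 ≤ N) (hMN : M ≠ N) (Λ : HW q M N)
    (Q : Polynomial ℂ) (hQ : annih Q Λ.f) (W : HWD (Idx M N)) (c0 : Idx M N) (hc : c0.1 = M)
    (hW1 : W.ke c0 = Λ.c)
    (hW2 : ∀ i : Idx M N, i.1 ≠ M → (∀ k : ℕ, gam (DD q hq0 hq1 M N) W 1 i k = gammaP q M i.1 (Λ.P i.1) k) ∧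
        (∀ k : ℕ, gam (DD q hq0 hq1 M N) W (-1) i k = gammaM q M i.1 (Λ.P i.1) (-(k : ℤ))))
    (hW3 : (∀ k : ℕ, gam (DD q hq0 hq1 M N) W 1 c0 k = if k = 0 then Λ.c else (q - q⁻¹) * Λ.f k) ∧
        (∀ k : ℕ, gam (DD q hq0 hq1 M N) W (-1) c0 k = if k = 0 then Λ.c⁻¹ else - ((q - q⁻¹) * Λ.f (-(k : ℤ))))) :
    weylIdeal q M N false Λ Q ≤ AnnI q hq0 hq1 M N W c0 (Ideal.span {rv Q}) := by
  have hqq : q - q⁻¹ ≠ 0 := by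
    have := ka_ne' q hq0 hq1 M M
    simpa [qpar, lof] using this
  have hphi : ∀ n : ℤ, (if 0 ≤ n then PhO (DD q hq0 hq1 M N) W 1 c0 n.toNat (wd []) else 0) -
      (if n ≤ 0 then PhO (DD q hq0 hq1 M N) W (-1) c0 (-n).toNat (wd []) else 0) =
      ((q - q⁻¹) * Λ.f n) • wd ([] : Wd (Idx M N)) := by
    intro n
    unfold PhO
    rw [Phi_nil, Phi_nil, hW3.1, hW3.2]
    rcases lt_trichotomy n 0 with h | h | h
    · rw [if_neg (by omega), if_pos (by omega), if_neg (by omega), Int.toNat_of_nonneg (by omega)]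
      simp
    · subst h
      have : (q - q⁻¹) * Λ.f 0 = Λ.c - Λ.c⁻¹ := by rw [Λ.f_zero, mul_div_cancel₀ _ hqq]
      rw [this]; simp [sub_smul]
    · rw [if_pos (by omega), if_neg (by omega), if_neg (by omega), Int.toNat_of_nonneg (by omega)]
      simp
  unfold weylIdeal
  rw [Ideal.span_le]
  rintro x ((hx | hx) | hx)
  · rcases hx with (((⟨i, n, rfl⟩ | ⟨i, n, h1, h2, h3, hx⟩) | rfl) | ⟨n, rfl⟩) | ⟨h, _⟩
    · refine (mem_AnnI q hq0 hq1 M N W c0 _ _).2 ?_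
      rw [XpF]
      split_ifs with h
      · rw [Th_gi]
        have : genOp q hq0 hq1 M N W (Gen.Xp ⟨i, h⟩ n) (wd []) = 0 := Xp_nil ..
        rw [this]; exact Submodule.zero_mem _
      · simp
    · obtain ⟨g1, g2⟩ := hW2 ⟨i, h1, h2⟩ h3
      rcases hx with rfl | rfl
      · rw [phiPA, ← AlgHom.commutes (mkA q M N false 3), ← map_sub]
        refine (mem_AnnI q hq0 hq1 M N W c0 _ _).2 ?_
        rw [map_sub, Th_phiP q hq0 hq1 M N W ⟨i, h1, h2⟩, AlgHom.commutes, LinearMap.sub_apply]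
        split_ifs with h
        · unfold PhO
          rw [Phi_nil, g1, Int.toNat_of_nonneg h, Module.algebraMap_end_apply, sub_self]
          exact Submodule.zero_mem _
        · rw [gammaP, if_neg h]; simp
      · rw [phiMA, ← AlgHom.commutes (mkA q M N false 3), ← map_sub]
        refine (mem_AnnI q hq0 hq1 M N W c0 _ _).2 ?_
        rw [map_sub, Th_phiM q hq0 hq1 M N W ⟨i, h1, h2⟩, AlgHom.commutes, LinearMap.sub_apply]
        split_ifs with h
        · unfold PhO
          rw [Phi_nil, g2, Int.toNat_of_nonneg (by omega), Module.algebraMap_end_apply, neg_neg, sub_self]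
          exact Submodule.zero_mem _
        · rw [gammaM, if_neg h]; simp
    · rw [KA, ← AlgHom.commutes (mkA q M N false 3), ← map_sub]
      refine (mem_AnnI q hq0 hq1 M N W c0 _ _).2 ?_
      have : KF M N false M = gi (Gen.K c0) := by
        rw [KF, dif_pos (by omega)]; congr 2; exact Subtype.ext hc.symm
      rw [map_sub, this, Th_gi, AlgHom.commutes, LinearMap.sub_apply, genOp, KO, Kop_nil, zpow_one, hW1,
        Module.algebraMap_end_apply, sub_self]
      exact Submodule.zero_mem _
    · rw [phiPA, phiMA, ← AlgHom.commutes (mkA q M N false 3), ← map_sub, ← map_sub]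
      refine (mem_AnnI q hq0 hq1 M N W c0 _ _).2 ?_
      have e1 : phiPF q M N false M n = phiPF q M N false c0.1 n := by rw [hc]
      have e2 : phiMF q M N false M n = phiMF q M N false c0.1 n := by rw [hc]
      rw [map_sub, map_sub, e1, e2, Th_phiP, Th_phiM, AlgHom.commutes, LinearMap.sub_apply, LinearMap.sub_apply,
        Module.algebraMap_end_apply, ← hphi n]
      split_ifs <;> simp
    · simp at h
  · obtain ⟨i, h1, h2, h3, rfl⟩ := hx
    obtain ⟨g1, g2⟩ := hW2 ⟨i, h1, h2⟩ h3
    obtain ⟨α, ha, hP⟩ := factor_P _ (Λ.P i) rfl (Λ.P_const i)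
    rw [XmA, ← map_pow]
    refine (mem_AnnI q hq0 hq1 M N W c0 _ _).2 ?_
    rw [map_pow, Th_XmF q hq0 hq1 M N W ⟨i, h1, h2⟩, add_comm 1]
    refine even_NS _ _ _ _ _ ?_ (qpar q M i) _ (fun s => qpar q M i * α s) (qpar_ne q hq0 M i) ?_ ?_ ?_ ?_ ?_ ?_
    · intro h; apply h3; rw [← hc, ← h]
    · change q ^ (-cc M i i) = _
      rw [cc_diag M i h3, qpar, ← zpow_neg, ← zpow_add₀ hq0]
      congr 1; ring
    · change sgn M i i = 1
      simp [sgn, h3]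
    · rfl
    · funext k; rw [g1, gammaP_gA q hq0 M i _ α ha hP]
    · funext k; rw [g2, gammaM_gA q hq0 M i _ α ha hP]
    · intro a h; exact mul_ne_zero (qpar_ne q hq0 M i) (ha a h)
  · rw [oddRels, if_neg (by omega)] at hx
    rw [Set.mem_singleton_iff] at hx
    rw [hx, ← oddF_mk]
    refine (mem_AnnI q hq0 hq1 M N W c0 _ _).2 ?_
    rw [NQ, mem_NS_iff]
    refine ⟨⟨?_, ?_⟩, ?_⟩
    · rw [Th_odd q hq0 hq1 M N W c0 hc, map_sum]
      refine Finset.sum_eq_zero fun s _ => ?_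
      rw [map_smul, vac_Xm, smul_zero]
    · rw [row_odd q hq0 hq1 M N W c0 hc]
      exact Ideal.subset_span rfl
    · intro j m
      have : XO (DD q hq0 hq1 M N) W j m (Th q hq0 hq1 M N W (oddF M N Q) (wd [])) = 0 := by
        rw [Th_odd q hq0 hq1 M N W c0 hc, map_sum]
        have e : ∀ s ∈ range (Q.natDegree + 1), XO (DD q hq0 hq1 M N) W j m (Q.coeff (Q.natDegree - s) • Xm c0 (s : ℤ) (wd [])) =
            (if j = c0 then ((DD q hq0 hq1 M N).ka j)⁻¹ * ((q - q⁻¹) * (Q.coeff (Q.natDegree - s) * Λ.f (m + s))) else 0) • wd [] := by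
          intro s _
          have z : XO (DD q hq0 hq1 M N) W j m (wd []) = 0 := Xp_nil ..
          rw [map_smul, XOXm_apply, z, map_zero, smul_zero, zero_add]
          split_ifs with h
          · subst h
            rw [phZ_apply, hphi, smul_smul, smul_smul]
            congr 1; ring
          · simp
        rw [Finset.sum_congr rfl e, ← Finset.sum_smul]
        split_ifs with h
        · rw [← Finset.mul_sum, ← Finset.mul_sum]
          have := hQ (m + Q.natDegree)
          rw [← Finset.sum_range_reflect] at this
          have e2 : ∑ s ∈ range (Q.natDegree + 1), Q.coeff (Q.natDegree - s) * Λ.f (m + s) = 0 := by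
            rw [← this]
            refine Finset.sum_congr rfl fun s hs => ?_
            have hs' : s ≤ Q.natDegree := by simp at hs; omega
            rw [Nat.add_sub_cancel]
            congr 2
            push_cast [Nat.cast_sub hs']; ring
          rw [e2]; simp
        · simp
      rw [this]; exact Submodule.zero_mem _

theorem rv_eq (Q : Polynomial ℂ) : rv Q = Polynomial.toLaurent Q.reverse := by
  have h : Q.reverse = ∑ s ∈ range (Q.natDegree + 1), Polynomial.C (Q.coeff (Q.natDegree - s)) * Polynomial.X ^ s := by
    ext n
    rw [Polynomial.finsetSum_coeff]
    simp only [Polynomial.coeff_C_mul_X_pow]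
    rw [Finset.sum_ite_eq]
    rw [Polynomial.coeff_reverse]
    split_ifs with hn
    · rw [Polynomial.revAt_le (by simp at hn; omega)]
    · rw [Polynomial.revAt_eq_self_of_lt (by simp at hn; omega), Polynomial.coeff_eq_zero_of_natDegree_lt (by simp at hn; omega)]
  rw [h, map_sum, rv]
  refine Finset.sum_congr rfl fun s _ => ?_
  rw [map_mul, Polynomial.toLaurent_C, Polynomial.toLaurent_X_pow, LaurentPolynomial.smul_eq_C_mul]

theorem reflect_reflect' (n : ℕ) (Q : Polynomial ℂ) : (Q.reflect n).reflect n = Q := by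
  ext k
  rw [Polynomial.coeff_reflect, Polynomial.coeff_reflect, Polynomial.revAt_invol]

theorem dvd_of_rv (Q₁ Q₂ : Polynomial ℂ) (h1 : Q₁.coeff 0 = 1) (h2 : Q₂.coeff 0 = 1)
    (h : rv Q₂ ∈ Ideal.span {rv Q₁}) : Q₁ ∣ Q₂ := by
  rw [Ideal.mem_span_singleton, rv_eq, rv_eq] at h
  obtain ⟨g, hg⟩ := h
  obtain ⟨n, g', hg'⟩ := LaurentPolynomial.exists_T_pow g
  have e : Polynomial.toLaurent (Polynomial.X ^ n * Q₂.reverse) = Polynomial.toLaurent (Q₁.reverse * g') := by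
    rw [map_mul, map_mul, hg', hg, Polynomial.toLaurent_X_pow]; ring
  have e' := Polynomial.toLaurent_injective e
  have e2 := congrArg Polynomial.reverse e'
  rw [Polynomial.reverse_mul_of_domain, Polynomial.reverse_mul_of_domain] at e2
  have r : ∀ Q : Polynomial ℂ, Q.coeff 0 = 1 → Q.reverse.reverse = Q := by
    intro Q hQ
    have hz : Q.natTrailingDegree = 0 := Polynomial.natTrailingDegree_eq_zero.2 (Or.inr (by rw [hQ]; exact one_ne_zero))
    have hd := Polynomial.reverse_natDegree Q
    unfold Polynomial.reverse at *
    rw [hd, hz, Nat.sub_zero, reflect_reflect']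
  rw [r _ h1, r _ h2] at e2
  have : (Polynomial.X ^ n : Polynomial ℂ).reverse = 1 := by
    simp [Polynomial.reverse]
  rw [this, one_mul] at e2
  exact ⟨_, e2⟩

theorem forward (q : ℂ) (hq0 : q ≠ 0) (hq1 : ∀ k : ℕ, k ≠ 0 → q ^ k ≠ 1) (M N : ℕ) (hM : 1 ≤ M) (hN : 1 ≤ N)
    (hMN : M ≠ N) (Λ : HW q M N) (Q₁ Q₂ : Polynomial ℂ)
    (h11 : Q₁.coeff 0 = 1) (h21 : Q₂.coeff 0 = 1)
    (h1f : annih Q₁ Λ.f)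
    (h : weylIdeal q M N false Λ Q₂ ≤ weylIdeal q M N false Λ Q₁) : Q₁ ∣ Q₂ := by
  obtain ⟨W, hW1, hW2, hW3⟩ := exists_W q hq0 hq1 M N Λ
  let c0 : Idx M N := ⟨M, by omega⟩
  have : Nonempty (Idx M N) := ⟨c0⟩
  have hle := weyl_le_Ann q hq0 hq1 M N hM hN hMN Λ Q₁ h1f W c0 rfl (hW1 c0 rfl) hW2 (hW3 c0 rfl)
  have hm : oddElt q M N false Q₂ 0 ∈ weylIdeal q M N false Λ Q₂ := by
    refine Ideal.subset_span (Or.inr ?_)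
    rw [oddRels, if_neg (by omega)]; rfl
  have := hle (h hm)
  rw [← oddF_mk, mem_AnnI, NQ, mem_NS_iff, row_odd q hq0 hq1 M N W c0 rfl] at this
  exact dvd_of_rv Q₁ Q₂ h11 h21 this.1.2
end
end QW
end

noncomputable section
namespace QW
set_option linter.unusedSectionVars false
set_option linter.unusedSimpArgs false
open Finset QAS

section
variable {A : Type} [Ring A] [Algebra ℂ A] (I : Ideal A)

/-- elements acting by a scalar on the generator of `A / I` -/
def scal : Subalgebra ℂ A where
  carrier := {x | ∃ c : ℂ, x - algebraMap ℂ A c ∈ I}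
  mul_mem' := by
    rintro x y ⟨c, hc⟩ ⟨d, hd⟩
    refine ⟨c * d, ?_⟩
    have : x * y - algebraMap ℂ A (c * d) = x * (y - algebraMap ℂ A d) + algebraMap ℂ A d * (x - algebraMap ℂ A c) := by
      rw [mul_sub, mul_sub, ← map_mul, mul_comm d c, Algebra.commutes d x]; abel
    rw [this]
    exact I.add_mem (I.mul_mem_left _ hd) (I.mul_mem_left _ hc)
  add_mem' := by
    rintro x y ⟨c, hc⟩ ⟨d, hd⟩
    refine ⟨c + d, ?_⟩
    have : x + y - algebraMap ℂ A (c + d) = (x - algebraMap ℂ A c) + (y - algebraMap ℂ A d) := by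
      rw [map_add]; abel
    rw [this]
    exact I.add_mem hc hd
  algebraMap_mem' := fun r => ⟨r, by rw [sub_self]; exact I.zero_mem⟩

theorem scal_inv (x y : A) (h : y * x = 1) (c : ℂ) (hc : c ≠ 0) (hx : x - algebraMap ℂ A c ∈ I) : y ∈ scal I := by
  refine ⟨c⁻¹, ?_⟩
  have : y - algebraMap ℂ A c⁻¹ = (algebraMap ℂ A (-c⁻¹) * y) * (x - algebraMap ℂ A c) := by
    rw [mul_sub, mul_assoc, h, mul_assoc, ← Algebra.commutes c y, ← mul_assoc, ← map_mul, neg_mul, inv_mul_cancel₀ hc]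
    simp
    abel
  rw [this]
  exact I.mul_mem_left _ hx

theorem expC_scal (t : ℂ) (ht : t ≠ 0) (a : ℕ → A) (S : Subalgebra ℂ A) (h : ∀ n, expC t a n ∈ S) (n : ℕ) :
    a (n + 1) ∈ S := by
  induction n using Nat.strong_induction_on with
  | _ n ih =>
    have e := expC_succ' t a n
    rw [Finset.sum_range_succ, Nat.sub_self, expC_zero, mul_one, smul_add] at e
    have hn : (n : ℂ) + 1 ≠ 0 := by exact_mod_cast Nat.succ_ne_zero n
    have h1 : t • ∑ s ∈ range n, ((s : ℂ) + 1) • (a (s + 1) * expC t a (n - s)) ∈ S := by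
      refine S.smul_mem (S.sum_mem fun s hs => S.smul_mem (S.mul_mem (ih s (by simpa using hs)) (h _)) _) _
    have h2 : t • ((n : ℂ) + 1) • a (n + 1) ∈ S := by
      have := S.sub_mem (S.smul_mem (h (n + 1)) ((n : ℂ) + 1)) h1
      rwa [e, add_sub_cancel_left] at this
    have := S.smul_mem (S.smul_mem h2 t⁻¹) ((n : ℂ) + 1)⁻¹
    rwa [smul_smul t⁻¹, inv_mul_cancel₀ ht, one_smul, smul_smul, inv_mul_cancel₀ hn, one_smul] at this
end

section
variable (q : ℂ) (hq0 : q ≠ 0) (hq1 : ∀ k : ℕ, k ≠ 0 → q ^ k ≠ 1) (M N : ℕ) (Λ : HW q M N)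

theorem mk_rel (a b : FA M N false) (h : rel q M N false 3 a b) : mkA q M N false 3 a = mkA q M N false 3 b :=
  RingQuot.mkAlgHom_rel ℂ h

theorem KiK_A (j : Idx M N) : KiA q M N false 3 j.1 * KA q M N false 3 j.1 = 1 := by
  have := mk_rel q M N _ _ (rel.KiK j)
  rw [KiA, KA, KF, KiF, dif_pos j.2, dif_pos j.2, ← map_mul]
  rw [map_one] at this
  exact this

theorem KKi_A (j : Idx M N) : KA q M N false 3 j.1 * KiA q M N false 3 j.1 = 1 := by
  have := mk_rel q M N _ _ (rel.KKi j)
  rw [KiA, KA, KF, KiF, dif_pos j.2, dif_pos j.2, ← map_mul]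
  rw [map_one] at this
  exact this

theorem phiPA_eq (i k : ℕ) : phiPA q M N false 3 i (k : ℤ) = KA q M N false 3 i *
    expC (qpar q M i - (qpar q M i)⁻¹) (fun s => HA q M N false 3 i (s : ℤ)) k := by
  rw [phiPA, phiPF, if_pos (by omega), map_mul, Int.toNat_natCast]
  rw [expC_map (A := FA M N false) (B := ALG q M N false 3) (mkA q M N false 3) _ _
    (fun s => HA q M N false 3 i (s : ℤ)) (fun s => rfl)]
  rfl

theorem phiMA_eq (i k : ℕ) : phiMA q M N false 3 i (-(k : ℤ)) = KiA q M N false 3 i *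
    expC (-(qpar q M i - (qpar q M i)⁻¹)) (fun s => HA q M N false 3 i (-(s : ℤ))) k := by
  rw [phiMA, phiMF, if_pos (by omega), map_mul, neg_neg, Int.toNat_natCast]
  rw [expC_map (A := FA M N false) (B := ALG q M N false 3) (mkA q M N false 3) _ _
    (fun s => HA q M N false 3 i (-(s : ℤ))) (fun s => rfl)]
  rfl

theorem HA_scal (q : ℂ) (hq0 : q ≠ 0) (hq1 : ∀ k : ℕ, k ≠ 0 → q ^ k ≠ 1) (M N : ℕ) (Λ : HW q M N) (Q : Polynomial ℂ) (j : Idx M N) (hj : j.1 ≠ M) (s : ℤ) (hs : s ≠ 0) :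
    HA q M N false 3 j.1 s ∈ scal (weylIdeal q M N false Λ Q) := by
  have hP : ∀ n : ℤ, phiPA q M N false 3 j.1 n - algebraMap ℂ _ (gammaP q M j.1 (Λ.P j.1) n) ∈ weylIdeal q M N false Λ Q :=
    fun n => Ideal.subset_span (Or.inl (Or.inl (Or.inl (Or.inl (Or.inl (Or.inr
      ⟨j.1, n, j.2.1, j.2.2, hj, Or.inl rfl⟩))))))
  have hN : ∀ n : ℤ, phiMA q M N false 3 j.1 n - algebraMap ℂ _ (gammaM q M j.1 (Λ.P j.1) n) ∈ weylIdeal q M N false Λ Q :=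
    fun n => Ideal.subset_span (Or.inl (Or.inl (Or.inl (Or.inl (Or.inl (Or.inr
      ⟨j.1, n, j.2.1, j.2.2, hj, Or.inr rfl⟩))))))
  have hK : KA q M N false 3 j.1 - algebraMap ℂ _ (gammaP q M j.1 (Λ.P j.1) (0 : ℕ)) ∈ weylIdeal q M N false Λ Q := by
    have := hP (0 : ℕ)
    rwa [phiPA_eq, expC_zero, mul_one] at this
  have hg : gammaP q M j.1 (Λ.P j.1) (0 : ℕ) ≠ 0 := by
    obtain ⟨α, ha, hP⟩ := factor_P _ (Λ.P j.1) rfl (Λ.P_const j.1)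
    rw [gammaP_gA q hq0 M j.1 _ α ha hP, gA_zero]
    exact pow_ne_zero _ (zpow_ne_zero _ (qpar_ne q hq0 M j.1))
  have hKi := scal_inv _ _ _ (KiK_A q M N j) _ hg hK
  have hka := ka_ne' q hq0 hq1 M j.1
  rcases lt_or_gt_of_ne hs with h | h
  · have := expC_scal (-(qpar q M j.1 - (qpar q M j.1)⁻¹)) (neg_ne_zero.2 hka)
      (fun s => HA q M N false 3 j.1 (-(s : ℤ))) (scal (weylIdeal q M N false Λ Q)) (fun n => by
        have h1 : KA q M N false 3 j.1 ∈ scal (weylIdeal q M N false Λ Q) := ⟨_, hK⟩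
        have h2 : phiMA q M N false 3 j.1 (-(n : ℤ)) ∈ scal (weylIdeal q M N false Λ Q) := ⟨_, hN _⟩
        have h3 := Subalgebra.mul_mem _ h1 h2
        rwa [phiMA_eq, ← mul_assoc, KKi_A, one_mul] at h3) ((-s).toNat - 1)
    rwa [show (-(((-s).toNat - 1 + 1 : ℕ) : ℤ)) = s by omega] at this
  · have := expC_scal (qpar q M j.1 - (qpar q M j.1)⁻¹) hka
      (fun s => HA q M N false 3 j.1 (s : ℤ)) (scal (weylIdeal q M N false Λ Q)) (fun n => by
        have h2 : phiPA q M N false 3 j.1 (n : ℤ) ∈ scal (weylIdeal q M N false Λ Q) := ⟨_, hP _⟩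
        have h3 := Subalgebra.mul_mem _ hKi h2
        rwa [phiPA_eq, ← mul_assoc, KiK_A, one_mul] at h3) (s.toNat - 1)
    rwa [show ((s.toNat - 1 + 1 : ℕ) : ℤ) = s by omega] at this

theorem HXm_A (j c0 : Idx M N) (s : ℤ) (hs : s ≠ 0) (n : ℤ) :
    HA q M N false 3 j.1 s * XmA q M N false 3 c0.1 n = XmA q M N false 3 c0.1 n * HA q M N false 3 j.1 s -
      (qint (qpar q M j.1) (s * lof M j.1 * cc M j.1 c0.1) / (s : ℂ)) • XmA q M N false 3 c0.1 (n + s) := by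
  have := mk_rel q M N _ _ (rel.HXm (lvl := 3) (ext := false) (q := q) j c0 ⟨s, hs⟩ n)
  rw [map_sub, map_mul, map_mul, map_neg, map_smul] at this
  have hH : HA q M N false 3 j.1 s = mkA q M N false 3 (gi (Gen.H j ⟨s, hs⟩)) := by
    rw [HA, HF, dif_pos ⟨j.2, hs⟩]
  have hX : ∀ n, XmA q M N false 3 c0.1 n = mkA q M N false 3 (gi (Gen.Xm c0 n)) := by
    intro n; rw [XmA, XmF, dif_pos c0.2]
  rw [hH, hX, hX, sub_eq_iff_eq_add.1 this]
  abel

theorem odd_mem (q : ℂ) (hq0 : q ≠ 0) (hq1 : ∀ k : ℕ, k ≠ 0 → q ^ k ≠ 1) (M N : ℕ) (Λ : HW q M N) (hM : 1 ≤ M) (hN : 1 ≤ N) (hMN : M ≠ N) (Q : Polynomial ℂ) (t : ℤ) :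
    oddElt q M N false Q t ∈ weylIdeal q M N false Λ Q := by
  have h0 : oddElt q M N false Q 0 ∈ weylIdeal q M N false Λ Q := by
    refine Ideal.subset_span (Or.inr ?_)
    rw [oddRels, if_neg (by omega)]; rfl
  by_cases ht : t = 0
  · rw [ht]; exact h0
  obtain ⟨j, hj, hcc⟩ : ∃ j : Idx M N, j.1 ≠ M ∧ (cc M j.1 M = 1 ∨ cc M j.1 M = -1) := by
    by_cases h2 : 2 ≤ M
    · refine ⟨⟨M - 1, by omega⟩, by dsimp only; omega, ?_⟩
      unfold cc form4 innerE lof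
      dsimp only
      split_ifs <;> omega
    · refine ⟨⟨M + 1, by omega⟩, by dsimp only; omega, ?_⟩
      unfold cc form4 innerE lof
      dsimp only
      split_ifs <;> omega
  obtain ⟨c, hc⟩ := HA_scal q hq0 hq1 M N Λ Q j hj t ht
  have key : HA q M N false 3 j.1 t * oddElt q M N false Q 0 = oddElt q M N false Q 0 * HA q M N false 3 j.1 t -
      (qint (qpar q M j.1) (t * lof M j.1 * cc M j.1 M) / (t : ℂ)) • oddElt q M N false Q t := by
    unfold oddElt
    rw [Finset.mul_sum, Finset.sum_mul, Finset.smul_sum, ← Finset.sum_sub_distrib]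
    refine Finset.sum_congr rfl fun s _ => ?_
    have := HXm_A q M N j ⟨M, by omega⟩ t ht ((s : ℤ) + 0)
    dsimp only at this
    rw [mul_smul_comm, this, smul_sub, smul_mul_assoc, smul_comm, add_zero]
  have hne : qint (qpar q M j.1) (t * lof M j.1 * cc M j.1 M) / (t : ℂ) ≠ 0 := by
    have hk : t * lof M j.1 * cc M j.1 M ≠ 0 := by
      refine mul_ne_zero (mul_ne_zero ht ?_) (by omega)
      unfold lof; split_ifs <;> omega
    generalize t * lof M j.1 * cc M j.1 M = k at hk
    refine div_ne_zero (div_ne_zero ?_ (ka_ne' q hq0 hq1 M j.1)) (by exact_mod_cast ht)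
    have hv := qpar_ne q hq0 M j.1
    intro h
    apply qpar_z_ne q hq0 hq1 M j.1 (2 * k) (by omega)
    rw [two_mul, zpow_add₀ hv, sub_eq_zero.1 h, zpow_neg]
    rw [zpow_neg] at h
    have := zpow_ne_zero k hv
    have h' := sub_eq_zero.1 h
    rw [← h']
    nth_rw 1 [h']
    exact inv_mul_cancel₀ this
  have m1 : oddElt q M N false Q 0 * HA q M N false 3 j.1 t ∈ weylIdeal q M N false Λ Q := by
    have e : oddElt q M N false Q 0 * HA q M N false 3 j.1 t =
        oddElt q M N false Q 0 * (HA q M N false 3 j.1 t - algebraMap ℂ _ c) + algebraMap ℂ _ c * oddElt q M N false Q 0 := by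
      rw [mul_sub, Algebra.commutes c]; abel
    rw [e]
    exact Ideal.add_mem _ (Ideal.mul_mem_left _ _ hc) (Ideal.mul_mem_left _ _ h0)
  have m2 := Ideal.sub_mem _ m1 (Ideal.mul_mem_left _ (HA q M N false 3 j.1 t) h0)
  rw [key, sub_sub_cancel] at m2
  have m3 := Ideal.mul_mem_left _ (algebraMap ℂ _ (qint (qpar q M j.1) (t * lof M j.1 * cc M j.1 M) / (t : ℂ))⁻¹) m2
  rwa [← Algebra.smul_def, smul_smul, inv_mul_cancel₀ hne, one_smul] at m3

theorem reverse_sum (Q : Polynomial ℂ) : Q.reverse =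
    ∑ s ∈ range (Q.natDegree + 1), Polynomial.monomial s (Q.coeff (Q.natDegree - s)) := by
  ext n
  rw [Polynomial.finsetSum_coeff]
  simp only [Polynomial.coeff_monomial]
  rw [Finset.sum_ite_eq' (range (Q.natDegree + 1)) n]
  rw [Polynomial.coeff_reverse]
  split_ifs with hn
  · rw [Polynomial.revAt_le (by simp at hn; omega)]
  · rw [Polynomial.revAt_eq_self_of_lt (by simp at hn; omega), Polynomial.coeff_eq_zero_of_natDegree_lt (by simp at hn; omega)]

def psi : Polynomial ℂ →ₗ[ℂ] ALG q M N false 3 :=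
  Polynomial.lsum fun s => LinearMap.toSpanSingleton ℂ _ (XmA q M N false 3 M (s : ℤ))

theorem psi_mono (s : ℕ) (c : ℂ) : psi q M N (Polynomial.monomial s c) = c • XmA q M N false 3 M (s : ℤ) := by
  unfold psi
  rw [Polynomial.lsum_apply, Polynomial.sum_monomial_index]
  · simp
  · simp

theorem psi_odd (Q : Polynomial ℂ) (t : ℕ) (c : ℂ) :
    psi q M N (Q.reverse * Polynomial.monomial t c) = c • oddElt q M N false Q t := by
  rw [reverse_sum, Finset.sum_mul, map_sum, oddElt, Finset.smul_sum]
  refine Finset.sum_congr rfl fun s _ => ?_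
  rw [Polynomial.monomial_mul_monomial, psi_mono, smul_smul, mul_comm]
  push_cast; rfl

theorem backward (q : ℂ) (hq0 : q ≠ 0) (hq1 : ∀ k : ℕ, k ≠ 0 → q ^ k ≠ 1) (M N : ℕ) (Λ : HW q M N) (hM : 1 ≤ M) (hN : 1 ≤ N) (hMN : M ≠ N) (Q₁ Q₂ : Polynomial ℂ)
    (h21 : Q₂.coeff 0 = 1) (h : Q₁ ∣ Q₂) :
    weylIdeal q M N false Λ Q₂ ≤ weylIdeal q M N false Λ Q₁ := by
  obtain ⟨R, rfl⟩ := h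
  have hm : ∀ g : Polynomial ℂ, psi q M N (Q₁.reverse * g) ∈ weylIdeal q M N false Λ Q₁ := by
    intro g
    induction g using Polynomial.induction_on' with
    | add a b ha hb => rw [mul_add, map_add]; exact Ideal.add_mem _ ha hb
    | monomial t c =>
      rw [psi_odd, Algebra.smul_def]
      exact Ideal.mul_mem_left _ _ (odd_mem q hq0 hq1 M N Λ hM hN hMN Q₁ t)
  unfold weylIdeal
  rw [Ideal.span_le]
  rintro x (hx | hx)
  · exact Ideal.subset_span (Or.inl hx)
  · rw [oddRels, if_neg (by omega), Set.mem_singleton_iff] at hx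
    have := psi_odd q M N (Q₁ * R) 0 1
    rw [one_smul, Polynomial.monomial_zero_one, mul_one] at this
    rw [hx]
    change oddElt q M N false (Q₁ * R) ((0 : ℕ) : ℤ) ∈ _
    rw [← this, Polynomial.reverse_mul_of_domain]
    exact hm _
end
end QW
end



open QAS in
/-- Proposition 4.18 (c): for `(P̲,f,c;Q₁), (P̲,f,c;Q₂) ∈ R̃_{M,N}`, the
canonical epimorphism `M(P̲,f,c) ↠ W(P̲,f,c;Q₁)` factorizes through
`M(P̲,f,c) ↠ W(P̲,f,c;Q₂)` — equivalently the defining ideal of `W(Q₂)` is contained in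
that of `W(Q₁)` — if and only if `Q₁ ∣ Q₂`. -/
theorem weyl_factorization (q : ℂ) (hq0 : q ≠ 0)
    (hq1 : ∀ k : ℕ, k ≠ 0 → q ^ k ≠ 1) (M N : ℕ) (hM : 1 ≤ M) (hN : 1 ≤ N)
    (hMN : M ≠ N) (Λ : HW q M N) (Q₁ Q₂ : Polynomial ℂ)
    (h11 : Q₁.coeff 0 = 1) (h21 : Q₂.coeff 0 = 1)
    (h1f : annih Q₁ Λ.f) (h2f : annih Q₂ Λ.f) :
    weylIdeal q M N false Λ Q₂ ≤ weylIdeal q M N false Λ Q₁ ↔ Q₁ ∣ Q₂ := by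
  exact ⟨QW.forward q hq0 hq1 M N hM hN hMN Λ Q₁ Q₂ h11 h21 h1f,
    QW.backward q hq0 hq1 M N Λ hM hN hMN Q₁ Q₂ h21⟩
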